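/- Let U_s be an admissible shear flow satisfying Criterion 1: ξ(Δ_s) = 0 and ξ₋(Δ_s) > ξ₊(Δ_s). Then there exist K > 0 and η > 0 such that for every integer k ≥ K there exists μ_k ∈ ℂ with Im μ_k ≥ η and a smooth function φ_k : [0,∞) → ℂ satisfying (μ_k − U_s)φ_k' + U_s' φ_k − (i/k) φ_k''' = F, φ_k(0) = 0, φ_k'(0) = 1, φ_k'(y) → 0 and φ_k(y) → Δ_s as y → ∞. Equivalently, λ_k := −i k μ_k satisfies Re λ_k ≥ η k and the linearized prescribed displacement thickness (PDT) system displays a (λ_k, k) instability. -/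

import Mathlib

open MeasureTheory Filter Set

noncomputable section

/-- The source term `F(y) = 1 - U(y) + y U'(y)` of the eigenmode ODE. -/
def srcF (U : ℝ → ℝ) (y : ℝ) : ℝ := 1 - U y + y * deriv U y

/-- The displacement thickness `Δ_s = ∫₀^∞ (1 - U)`. -/
def deltaS (U : ℝ → ℝ) : ℝ := ∫ y in Ioi (0:ℝ), (1 - U y)

/-- An admissible shear flow: smooth, monotone, `U(0) = 0`, `U → 1`,
`U''(0) ≠ 0`, finitely many inflexion points, and the decay conditions of the paper. -/
structure AdmissibleShearFlow (U : ℝ → ℝ) : Prop where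
  smooth : ContDiff ℝ (⊤ : ℕ∞) U
  mem_Ico : ∀ y, 0 ≤ y → U y ∈ Ico (0:ℝ) 1
  zero_val : U 0 = 0
  deriv_pos : ∀ y, 0 ≤ y → 0 < deriv U y
  tendsto_one : Tendsto U atTop (nhds 1)
  snd_deriv_zero_ne : iteratedDeriv 2 U 0 ≠ 0
  finite_inflexions : {y : ℝ | 0 < y ∧ iteratedDeriv 2 U y = 0}.Finite
  integrable_defect : IntegrableOn (fun y => 1 - U y) (Ioi (0:ℝ))
  derivs_bounded : ∀ j : ℕ, 1 ≤ j → j ≤ 3 →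
    ∃ M : ℝ, ∀ y, 0 ≤ y → |iteratedDeriv j U y| ≤ M
  decay_ratio₁ : Tendsto (fun y => (1 - U y) ^ 2 / deriv U y) atTop (nhds 0)
  decay_ratio₂ : Tendsto (fun y => y * (1 - U y)) atTop (nhds 0)
  decay_ratio₃ : IntegrableOn
    (fun y => (1 - U y) ^ 2 * iteratedDeriv 2 U y / (deriv U y) ^ 2) (Ioi (0:ℝ))
  kappa_decay : ∃ κ : ℝ, 0 < κ ∧ κ < 1/2 ∧ ∃ yκ > (0:ℝ), ∃ cκ > (0:ℝ),
    ∀ y, yκ ≤ y →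
      (1 - U y) ^ ((2:ℝ) - κ) * iteratedDeriv 2 U y ≤ -cκ * (deriv U y) ^ 3

/-- `φ` is a smooth solution of the eigenmode problem
`(μ - U_s)φ' + U_s'φ - (i/k)φ''' = F`, `φ(0) = 0`, `φ'(0) = 1`, `φ' → 0`, `φ → L`. -/
def IsEigSolution (U : ℝ → ℝ) (μ : ℂ) (k : ℝ) (L : ℂ) (φ : ℝ → ℂ) : Prop :=
  ContDiff ℝ (⊤ : ℕ∞) φ ∧
  (∀ y, 0 ≤ y →
    (μ - (U y : ℂ)) * deriv φ y + ((deriv U y : ℝ) : ℂ) * φ y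
      - Complex.I / (k : ℂ) * iteratedDeriv 3 φ y = (srcF U y : ℂ)) ∧
  φ 0 = 0 ∧ deriv φ 0 = 1 ∧
  Tendsto (deriv φ) atTop (nhds 0) ∧
  Tendsto φ atTop (nhds L)

/-- Same problem without the prescribed limit at infinity. -/
def IsBLSolution (U : ℝ → ℝ) (μ : ℂ) (k : ℝ) (φ : ℝ → ℂ) : Prop :=
  ContDiff ℝ (⊤ : ℕ∞) φ ∧
  (∀ y, 0 ≤ y →
    (μ - (U y : ℂ)) * deriv φ y + ((deriv U y : ℝ) : ℂ) * φ y
      - Complex.I / (k : ℂ) * iteratedDeriv 3 φ y = (srcF U y : ℂ)) ∧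
  φ 0 = 0 ∧ deriv φ 0 = 1 ∧ Tendsto (deriv φ) atTop (nhds 0)

/-- Cauchy principal value `PV ∫₀¹ h(u)/(u - a) du`. -/
def pvIntegral (h : ℝ → ℝ) (a : ℝ) : ℝ :=
  limUnder (nhdsWithin (0:ℝ) (Ioi 0))
    (fun ε => ∫ u in Ioo (0:ℝ) 1 \ Ioo (a - ε) (a + ε), h u / (u - a))

/-- Inverse of the shear flow on `[0, ∞)`. -/
def shearInv (U : ℝ → ℝ) (u : ℝ) : ℝ := Function.invFunOn U (Ici 0) u

/-- `g(u) = (1-u)² U''(U⁻¹(u)) / (U'(U⁻¹(u)))³`. -/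
def gfun (U : ℝ → ℝ) (u : ℝ) : ℝ :=
  (1 - u) ^ 2 * iteratedDeriv 2 U (shearInv U u) / (deriv U (shearInv U u)) ^ 3

/-- `G(a) = 1/(a U'(0)) + PV ∫₀¹ g(u)/(u-a) du + iπ g(a)`. -/
def Gfun (U : ℝ → ℝ) (a : ℝ) : ℂ :=
  ((1 / (a * deriv U 0) + pvIntegral (gfun U) a : ℝ) : ℂ)
    + Complex.I * ((Real.pi * gfun U a : ℝ) : ℂ)

/-- Crossing abscissa `χ(y) = Re G(U(y))`. -/
def chiAbscissa (U : ℝ → ℝ) (y : ℝ) : ℝ := (Gfun U (U y)).re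

/-- `ξ(γ)`: number of zeros of `U''` in `(0,∞)` with `χ(yᵢ) = γ`. -/
def xiEq (U : ℝ → ℝ) (γ : ℝ) : ℕ :=
  {y : ℝ | 0 < y ∧ iteratedDeriv 2 U y = 0 ∧ chiAbscissa U y = γ}.ncard

/-- `ξ₊(γ)`: zeros of `U''` with `χ(yᵢ) < γ`, `U'' < 0` on the left and `U'' > 0`
on the right. -/
def xiPlus (U : ℝ → ℝ) (γ : ℝ) : ℕ :=
  {y : ℝ | 0 < y ∧ iteratedDeriv 2 U y = 0 ∧ chiAbscissa U y < γ ∧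
    ∃ δ > (0:ℝ), (∀ z ∈ Ioo (y - δ) y, iteratedDeriv 2 U z < 0) ∧
      (∀ z ∈ Ioo y (y + δ), 0 < iteratedDeriv 2 U z)}.ncard

/-- `ξ₋(γ)`: zeros of `U''` with `χ(yᵢ) < γ`, `U'' > 0` on the left and `U'' < 0`
on the right. -/
def xiMinus (U : ℝ → ℝ) (γ : ℝ) : ℕ :=
  {y : ℝ | 0 < y ∧ iteratedDeriv 2 U y = 0 ∧ chiAbscissa U y < γ ∧
    ∃ δ > (0:ℝ), (∀ z ∈ Ioo (y - δ) y, 0 < iteratedDeriv 2 U z) ∧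
      (∀ z ∈ Ioo y (y + δ), iteratedDeriv 2 U z < 0)}.ncard

/-- `Φ_inv(μ) = (μ - 1) ∫₀^∞ F(y)/(μ - U(y))² dy`. -/
def PhiInv (U : ℝ → ℝ) (μ : ℂ) : ℂ :=
  (μ - 1) * ∫ y in Ioi (0:ℝ), (srcF U y : ℂ) / (μ - (U y : ℂ)) ^ 2

/-- A weight function `ω ≥ 1` with `C_ω < ∞`. -/
structure WeightFn (ω : ℝ → ℝ) : Prop where
  pos : ∀ y, 0 ≤ y → 0 < ω y
  contDiff : ContDiff ℝ 1 ω
  one_le : ∀ y, 0 ≤ y → 1 ≤ ω y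
  integrable_inv : IntegrableOn (fun y => 1 / ω y) (Ioi (0:ℝ))
  deriv_ratio_bdd : ∃ M : ℝ, ∀ y, 0 ≤ y → |deriv ω y / ω y| ≤ M
  log_ratio_bdd : ∃ M : ℝ, ∀ y, 0 ≤ y → Real.log (ω y) / (1 + y) ≤ M

/-- Weighted decay conditions: `(1-U_s) ∈ L²(ω)` and `(1+y)U_s^{(j)} ∈ L²(ω)`, `j = 1,2,3`. -/
def WeightedDecay (U ω : ℝ → ℝ) : Prop :=
  IntegrableOn (fun y => (1 - U y) ^ 2 * ω y) (Ioi (0:ℝ)) ∧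
  ∀ j : ℕ, 1 ≤ j → j ≤ 3 →
    IntegrableOn (fun y => ((1 + y) * iteratedDeriv j U y) ^ 2 * ω y) (Ioi (0:ℝ))

/-- Membership in the weighted space `L²(ω)`. -/
def MemL2w (ω : ℝ → ℝ) (f : ℝ → ℂ) : Prop :=
  IntegrableOn (fun y => ‖f y‖ ^ 2 * ω y) (Ioi (0:ℝ))

/-- The `L²(ω)` norm. -/
def wNorm (ω : ℝ → ℝ) (f : ℝ → ℂ) : ℝ :=
  Real.sqrt (∫ y in Ioi (0:ℝ), ‖f y‖ ^ 2 * ω y)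

/-- `φ` solves the homogeneous-boundary-conditions resolvent problem with forcing `f`. -/
def SolvesHom (U : ℝ → ℝ) (μ : ℂ) (k : ℝ) (f φ : ℝ → ℂ) : Prop :=
  ContDiff ℝ 2 φ ∧
  (∀ᵐ y ∂(volume.restrict (Ioi (0:ℝ))),
    (μ - (U y : ℂ)) * deriv φ y + ((deriv U y : ℝ) : ℂ) * φ y
      - Complex.I / (k : ℂ) * iteratedDeriv 3 φ y = f y) ∧
  φ 0 = 0 ∧ deriv φ 0 = 0 ∧ Tendsto (deriv φ) atTop (nhds 0)

/-- Parameterization on `[0,1]` of the contour `C_η`: the segment from `iη` to `1 + iη`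
followed by the upper half-circle of radius `1/2` centered at `1/2 + iη`. -/
def Ceta (η : ℝ) (t : ℝ) : ℂ :=
  if t ≤ 1/2 then ((2*t : ℝ) : ℂ) + (η : ℂ) * Complex.I
  else (1/2 : ℂ) + (η : ℂ) * Complex.I
    + (1/2 : ℂ) * Complex.exp (((Real.pi * (2*t - 1) : ℝ)) * Complex.I)

/-- Winding number `(1/2πi) ∮ dz/(z - p)` of a closed curve parameterized on `[0,1]`. -/
def windingNumber (c : ℝ → ℂ) (p : ℂ) : ℂ :=
  (((2 * Real.pi : ℝ) : ℂ) * Complex.I)⁻¹ * ∫ t in (0:ℝ)..1, deriv c t / (c t - p)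

/-- `q_μ(x) = |μ - x|⁴ - (2μ - 1 - x)(μ̄ - x)²`. -/
def qmu (μ : ℂ) (x : ℝ) : ℂ :=
  ((‖μ - (x:ℂ)‖ ^ 4 : ℝ) : ℂ) - (2*μ - 1 - (x:ℂ)) * ((starRingEnd ℂ) μ - (x:ℂ))^2

/-- `f(α) = -2iΔ_s/α + 1/√α`, principal square root (positive real part for `Re α > 0`). -/
def fIBL (Δ : ℝ) (α : ℂ) : ℂ := (-2 * Complex.I * (Δ:ℂ)) / α + 1 / (α ^ (1/2 : ℂ))


section hurwitz
set_option linter.unusedSectionVars false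
variable {E : Type*} [NormedAddCommGroup E] [NormedSpace ℂ E] [CompleteSpace E]

lemma resolv_isUnit (T : E →L[ℂ] E) (hT : ‖T‖ < 1) : IsUnit (1 - T) :=
  isUnit_one_sub_of_norm_lt_one hT

lemma resolv_eq (T : E →L[ℂ] E) (hT : ‖T‖ < 1) (b : E) :
    (Ring.inverse (1 - T)) b = T ((Ring.inverse (1 - T)) b) + b := by
  have h := Ring.mul_inverse_cancel _ (resolv_isUnit T hT)
  have h2 := congrArg (fun A : E →L[ℂ] E => A b) h
  simp only [mul_apply_eq_comp, sub_apply,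
    one_apply_eq_self] at h2
  rw [sub_eq_iff_eq_add] at h2
  rw [add_comm]; exact h2

lemma fix_bound (T : E →L[ℂ] E) (ρ : ℝ) (hρ : ρ < 1) (hT : ‖T‖ ≤ ρ) (x e : E)
    (hx : x = T x + e) : ‖x‖ ≤ (1 - ρ)⁻¹ * ‖e‖ := by
  have h1 : ‖x‖ ≤ ρ * ‖x‖ + ‖e‖ := by
    calc ‖x‖ = ‖T x + e‖ := by rw [← hx]
      _ ≤ ‖T x‖ + ‖e‖ := norm_add_le _ _
      _ ≤ ρ * ‖x‖ + ‖e‖ := by gcongr; exact T.le_of_opNorm_le hT x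
  have : 0 < 1 - ρ := by linarith
  rw [inv_mul_eq_div, le_div_iff₀ this]; linarith

lemma resolv_unique (T : E →L[ℂ] E) (hT : ‖T‖ < 1) (x b : E) (hx : x = T x + b) :
    x = (Ring.inverse (1 - T)) b := by
  have h := resolv_eq T hT b
  have : x - (Ring.inverse (1 - T)) b = T (x - (Ring.inverse (1 - T)) b) + 0 := by
    rw [map_sub, add_zero]
    nth_rewrite 1 [hx, h]; abel
  have := fix_bound T ‖T‖ hT le_rfl _ _ this
  simp at this
  exact sub_eq_zero.mp this

lemma resolv_diff (T : ℂ → E →L[ℂ] E) (b : E) (μ : ℂ) (hd : DifferentiableAt ℂ T μ)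
    (hT : ‖T μ‖ < 1) : DifferentiableAt ℂ (fun μ => (Ring.inverse (1 - T μ)) b) μ := by
  obtain ⟨u, hu⟩ := resolv_isUnit (T μ) hT
  have h1 : DifferentiableAt ℂ (Ring.inverse : (E →L[ℂ] E) → _) (1 - T μ) := by
    rw [← hu]; exact differentiableAt_inverse u.isUnit
  have h2 : DifferentiableAt ℂ (fun μ => 1 - T μ) μ := (differentiableAt_const _).sub hd
  have h3 := DifferentiableAt.comp μ h1 h2
  exact h3.clm_apply (differentiableAt_const b)

/-- uniformly bounded strongly convergent operators converge uniformly on compact sets -/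
lemma strong_unif (S : ℕ → E →L[ℂ] E) (M : ℝ) (hM : ∀ᶠ n in atTop, ‖S n‖ ≤ M)
    (hS : ∀ x, Tendsto (fun n => S n x) atTop (nhds x)) (K : Set E) (hK : IsCompact K)
    (ε : ℝ) (hε : 0 < ε) : ∀ᶠ n in atTop, ∀ x ∈ K, ‖S n x - x‖ ≤ ε := by
  have hM0 : 0 ≤ M := by
    obtain ⟨n, hn⟩ := hM.exists; exact (norm_nonneg _).trans hn
  set d := ε / (2 * (M + 1)) with hd
  have hd0 : 0 < d := by positivity
  obtain ⟨t, htK, htf, hcov⟩ := hK.finite_cover_balls hd0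
  have h1 : ∀ᶠ n in atTop, ∀ y ∈ t, ‖S n y - y‖ < ε / 2 := by
    rw [htf.eventually_all]
    intro y _
    have := (tendsto_iff_norm_sub_tendsto_zero.mp (hS y))
    exact this.eventually (gt_mem_nhds (by positivity))
  filter_upwards [h1, hM] with n hn hMn x hx
  have := hcov hx
  simp only [mem_iUnion, Metric.mem_ball, exists_prop] at this
  obtain ⟨y, hy, hxy⟩ := this
  rw [dist_eq_norm] at hxy
  have e : S n x - x = S n (x - y) - (x - y) + (S n y - y) := by rw [map_sub]; abel
  have h2 : ‖S n (x - y)‖ ≤ M * d := (ContinuousLinearMap.le_of_opNorm_le _ hMn _).trans (by gcongr)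
  have h3 : (M + 1) * d = ε / 2 := by rw [hd]; field_simp
  rw [e]
  calc _ ≤ ‖S n (x - y)‖ + ‖x - y‖ + ‖S n y - y‖ := by
        refine (norm_add_le _ _).trans ?_; gcongr; exact norm_sub_le _ _
    _ ≤ M * d + d + ε / 2 := by have := hn y hy; gcongr
    _ = ε := by linarith

lemma hurwitz_abstract (B : ℂ → E →L[ℂ] E) (hB : Differentiable ℂ B) (W : Set ℂ)
    (hWo : IsOpen W) (hWc : IsPreconnected W) (ρ : ℝ) (hρ0 : 0 ≤ ρ) (hρ : ρ < 1)
    (hBW : ∀ μ ∈ W, ‖B μ‖ ≤ ρ) (S : ℕ → E →L[ℂ] E)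
    (hSn : ∀ δ > 0, ∀ᶠ n in atTop, ‖S n‖ ≤ 1 + δ)
    (hS : ∀ x, Tendsto (fun n => S n x) atTop (nhds x))
    (β : ℕ → E) (hβ : Tendsto β atTop (nhds 0)) (b0 : E) (ℓ : E →L[ℂ] ℂ) (Δ : ℂ)
    (q0 : ℂ → E) (hq0 : ∀ μ ∈ W, q0 μ = B μ (q0 μ) + b0)
    (μ0 μ1 : ℂ) (hμ0 : μ0 ∈ W) (hμ1 : μ1 ∈ W) (h0 : ℓ (q0 μ0) = Δ) (h1 : ℓ (q0 μ1) ≠ Δ) :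
    ∀ᶠ n in atTop, ∃ μ ∈ W, ∃ q, q = S n (B μ q + b0) + β n ∧ ℓ q = Δ := by
  set f0 : ℂ → ℂ := fun μ => ℓ (q0 μ) - Δ with hf0
  have hq0d : DifferentiableOn ℂ q0 W := by
    intro μ hμ
    have e : q0 =ᶠ[nhds μ] fun μ => (Ring.inverse (1 - B μ)) b0 := by
      filter_upwards [hWo.mem_nhds hμ] with ν hν
      exact resolv_unique _ ((hBW ν hν).trans_lt hρ) _ _ (hq0 ν hν)
    exact ((resolv_diff B b0 μ (hB μ) ((hBW μ hμ).trans_lt hρ)).congr_of_eventuallyEq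
      e).differentiableWithinAt
  have hf0d : DifferentiableOn ℂ f0 W := by
    intro μ hμ
    exact ((ℓ.differentiableAt.comp_differentiableWithinAt μ (hq0d μ hμ))).sub_const _
  have hf0a : AnalyticOnNhd ℂ f0 W := hf0d.analyticOnNhd hWo
  have hne : ∀ᶠ μ in nhdsWithin μ0 {μ0}ᶜ, f0 μ ≠ 0 := by
    rcases (hf0a μ0 hμ0).eventually_eq_zero_or_eventually_ne_zero with h | h
    · exfalso
      have := hf0a.eqOn_zero_of_preconnected_of_eventuallyEq_zero hWc hμ0 h hμ1
      exact h1 (sub_eq_zero.mp this)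
    · exact h
  obtain ⟨r1, hr1, hr1W⟩ := Metric.isOpen_iff.mp hWo μ0 hμ0
  rw [eventually_nhdsWithin_iff, Metric.eventually_nhds_iff] at hne
  obtain ⟨r2, hr2, hne⟩ := hne
  set r := min r1 r2 / 2 with hr
  have hr0 : 0 < r := by positivity
  have hrr1 : r < r1 := by have := min_le_left r1 r2; linarith [min_le_left r1 r2, lt_min hr1 hr2]
  have hrr2 : r < r2 := by linarith [min_le_right r1 r2, lt_min hr1 hr2]
  have hcW : Metric.closedBall μ0 r ⊆ W :=
    (Metric.closedBall_subset_ball hrr1).trans hr1W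
  have hsne : ∀ μ ∈ Metric.sphere μ0 r, f0 μ ≠ 0 := by
    intro μ hμ
    have hd : dist μ μ0 = r := hμ
    apply hne (by rw [hd]; exact hrr2)
    intro h; simp at h; rw [h, dist_self] at hd; linarith
  have hcont : ContinuousOn f0 (Metric.closedBall μ0 r) := hf0d.continuousOn.mono hcW
  obtain ⟨m, hm0, hm⟩ : ∃ m > 0, ∀ μ ∈ Metric.sphere μ0 r, m ≤ ‖f0 μ‖ := by
    have hcs : IsCompact (Metric.sphere μ0 r) := isCompact_sphere _ _
    have hns : (Metric.sphere μ0 r).Nonempty := NormedSpace.sphere_nonempty.mpr hr0.le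
    obtain ⟨x, hx, hmin⟩ := hcs.exists_isMinOn hns
      ((hcont.mono Metric.sphere_subset_closedBall).norm)
    exact ⟨‖f0 x‖, norm_pos_iff.mpr (hsne x hx), fun μ hμ => hmin hμ⟩
  set ρ' := (1 + ρ) / 2 with hρ'
  have hρ'1 : ρ' < 1 := by linarith
  have hSρ : ∀ᶠ n in atTop, ‖S n‖ * ρ ≤ ρ' := by
    filter_upwards [hSn ((1 - ρ) / 2) (by linarith)] with n hn
    calc ‖S n‖ * ρ ≤ (1 + (1 - ρ) / 2) * ρ := by gcongr
      _ ≤ ρ' := by rw [hρ']; nlinarith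
  set ε := m * (1 - ρ') / (16 * (‖ℓ‖ + 1)) with hε
  have hε0 : 0 < ε := by
    have : 0 < 1 - ρ' := by linarith
    positivity
  have hK : IsCompact (q0 '' Metric.closedBall μ0 r) :=
    (isCompact_closedBall _ _).image_of_continuousOn (hq0d.continuousOn.mono hcW)
  have hu := strong_unif S 2 ((hSn 1 one_pos).mono (fun n hn => by linarith)) hS _ hK ε hε0
  have hβ' : ∀ᶠ n in atTop, ‖β n‖ < ε := by
    have := hβ.norm; rw [norm_zero] at this
    exact this.eventually (gt_mem_nhds hε0)
  filter_upwards [hSρ, hu, hβ'] with n hn hun hβn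
  set Tn : ℂ → E →L[ℂ] E := fun μ => (S n) ∘L (B μ) with hTn
  have hTnb : ∀ μ ∈ W, ‖Tn μ‖ ≤ ρ' := fun μ hμ =>
    (ContinuousLinearMap.opNorm_comp_le _ _).trans
      ((mul_le_mul_of_nonneg_left (hBW μ hμ) (norm_nonneg _)).trans hn)
  set qn : ℂ → E := fun μ => (Ring.inverse (1 - Tn μ)) (S n b0 + β n) with hqn
  have hqne : ∀ μ ∈ W, qn μ = S n (B μ (qn μ) + b0) + β n := by
    intro μ hμ
    have := resolv_eq (Tn μ) ((hTnb μ hμ).trans_lt hρ'1) (S n b0 + β n)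
    change qn μ = S n (B μ (qn μ)) + _ at this
    rw [map_add, add_assoc]; exact this
  have hTd : Differentiable ℂ Tn := fun μ =>
    (differentiableAt_const (S n)).clm_comp (hB μ)
  set fn : ℂ → ℂ := fun μ => ℓ (qn μ) - Δ with hfn
  have hfnd : DifferentiableOn ℂ fn W := by
    intro μ hμ
    have := resolv_diff Tn (S n b0 + β n) μ (hTd μ) ((hTnb μ hμ).trans_lt hρ'1)
    exact ((ℓ.differentiableAt.comp μ this).sub_const _).differentiableWithinAt
  have hclose : ∀ μ ∈ Metric.closedBall μ0 r, ‖fn μ - f0 μ‖ ≤ m / 8 := by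
    intro μ hμ
    have hμW := hcW hμ
    have e : qn μ - q0 μ = Tn μ (qn μ - q0 μ) + ((S n (q0 μ) - q0 μ) + β n) := by
      have e1 := hqne μ hμW
      have e2 : S n (q0 μ) = S n (B μ (q0 μ)) + S n b0 := by
        rw [← map_add, ← hq0 μ hμW]
      have e3 : Tn μ (qn μ - q0 μ) = S n (B μ (qn μ)) - S n (B μ (q0 μ)) := by
        simp [hTn]
      rw [e3, e2]; nth_rewrite 1 [e1]; rw [map_add]; abel
    have hb := fix_bound (Tn μ) ρ' hρ'1 (hTnb μ hμW) _ _ e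
    have hb2 : ‖(S n (q0 μ) - q0 μ) + β n‖ ≤ 2 * ε := by
      refine (norm_add_le _ _).trans ?_
      have := hun _ (mem_image_of_mem q0 hμ); linarith
    have e4 : fn μ - f0 μ = ℓ (qn μ - q0 μ) := by simp [hfn, hf0]
    have h1ρ : 0 < 1 - ρ' := by linarith
    rw [e4]
    calc _ ≤ ‖ℓ‖ * ‖qn μ - q0 μ‖ := ℓ.le_opNorm _
      _ ≤ (‖ℓ‖ + 1) * ((1 - ρ')⁻¹ * (2 * ε)) := by
          gcongr
          · linarith
          · exact hb.trans (by gcongr)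
      _ = m / 8 := by rw [hε]; field_simp; norm_num
  have hf00 : f0 μ0 = 0 := sub_eq_zero.mpr h0
  have hc0 := hclose μ0 (Metric.mem_closedBall_self hr0.le)
  rw [hf00, sub_zero] at hc0
  have hdc : DiffContOnCl ℂ fn (Metric.ball μ0 r) := by
    refine ⟨hfnd.mono (Metric.ball_subset_closedBall.trans hcW), ?_⟩
    rw [closure_ball _ hr0.ne']; exact hfnd.continuousOn.mono hcW
  have hsph : ∀ z ∈ Metric.sphere μ0 r, 3 * m / 4 ≤ ‖fn z - fn μ0‖ := by
    intro z hz
    have a1 := hm z hz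
    have a2 := hclose z (Metric.sphere_subset_closedBall hz)
    have a3 : ‖f0 z‖ ≤ ‖fn z - fn μ0‖ + ‖fn μ0‖ + ‖fn z - f0 z‖ := by
      have : f0 z = (fn z - fn μ0) + fn μ0 - (fn z - f0 z) := by ring
      nth_rewrite 1 [this]
      exact (norm_sub_le _ _).trans (by gcongr; exact norm_add_le _ _)
    linarith
  have hnc : ∃ᶠ z in nhds μ0, fn z ≠ fn μ0 := by
    intro hcon
    simp only [not_not] at hcon
    have han : AnalyticOnNhd ℂ fn W := hfnd.analyticOnNhd hWo
    have := han.eqOn_of_preconnected_of_eventuallyEq (g := fun _ => fn μ0)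
      (fun _ _ => analyticAt_const) hWc hμ0 hcon
    obtain ⟨z, hz⟩ : (Metric.sphere μ0 r).Nonempty := NormedSpace.sphere_nonempty.mpr hr0.le
    have h2 := hsph z hz
    rw [this (hcW (Metric.sphere_subset_closedBall hz)), sub_self, norm_zero] at h2
    linarith
  have := hdc.ball_subset_image_closedBall hr0 hsph hnc
  obtain ⟨μ, hμ, hz⟩ := this (show (0:ℂ) ∈ Metric.ball (fn μ0) (3 * m / 4 / 2) by
    rw [Metric.mem_ball, dist_eq_norm, zero_sub, norm_neg]; linarith)
  exact ⟨μ, hcW hμ, qn μ, hqne μ (hcW hμ), sub_eq_zero.mp hz⟩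
end hurwitz

set_option linter.unusedSectionVars false
set_option linter.unusedVariables false

namespace AdmissibleShearFlow

lemma hd0 {U : ℝ → ℝ} (hU : AdmissibleShearFlow U) (y : ℝ) : HasDerivAt U (deriv U y) y :=
  (hU.smooth.differentiable (by simp) y).hasDerivAt

lemma cd1 {U : ℝ → ℝ} (hU : AdmissibleShearFlow U) : ContDiff ℝ (⊤ : ℕ∞) (deriv U) := by
  have := hU.smooth
  exact (contDiff_infty_iff_deriv.mp this).2

lemma it2 {U : ℝ → ℝ} (hU : AdmissibleShearFlow U) : iteratedDeriv 2 U = deriv (deriv U) := by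
  rw [iteratedDeriv_succ, iteratedDeriv_one]

lemma cd2 {U : ℝ → ℝ} (hU : AdmissibleShearFlow U) : ContDiff ℝ (⊤ : ℕ∞) (iteratedDeriv 2 U) := by
  rw [hU.it2]; exact (contDiff_infty_iff_deriv.mp hU.cd1).2

lemma hd1 {U : ℝ → ℝ} (hU : AdmissibleShearFlow U) (y : ℝ) : HasDerivAt (deriv U) (iteratedDeriv 2 U y) y := by
  rw [hU.it2]; exact (hU.cd1.differentiable (by simp) y).hasDerivAt

lemma c0 {U : ℝ → ℝ} (hU : AdmissibleShearFlow U) : Continuous U := hU.smooth.continuous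
lemma c1 {U : ℝ → ℝ} (hU : AdmissibleShearFlow U) : Continuous (deriv U) := hU.cd1.continuous
lemma c2 {U : ℝ → ℝ} (hU : AdmissibleShearFlow U) : Continuous (iteratedDeriv 2 U) := hU.cd2.continuous

lemma strictMono {U : ℝ → ℝ} (hU : AdmissibleShearFlow U) : StrictMonoOn U (Ici 0) := by
  apply strictMonoOn_of_deriv_pos (convex_Ici 0) hU.c0.continuousOn
  intro x hx; rw [interior_Ici] at hx; exact hU.deriv_pos x (le_of_lt hx)

lemma U_pos {U : ℝ → ℝ} (hU : AdmissibleShearFlow U) {y : ℝ} (hy : 0 < y) : 0 < U y := by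
  have := hU.strictMono (self_mem_Ici) (le_of_lt hy : (0:ℝ) ≤ y) hy
  rwa [hU.zero_val] at this

lemma U_lt_one {U : ℝ → ℝ} (hU : AdmissibleShearFlow U) {y : ℝ} (hy : 0 ≤ y) : U y < 1 := (hU.mem_Ico y hy).2
lemma U_nonneg {U : ℝ → ℝ} (hU : AdmissibleShearFlow U) {y : ℝ} (hy : 0 ≤ y) : 0 ≤ U y := (hU.mem_Ico y hy).1

lemma exists_M {U : ℝ → ℝ} (hU : AdmissibleShearFlow U) : ∃ M > 0, ∀ y, 0 ≤ y → deriv U y ≤ M := by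
  obtain ⟨M, hM⟩ := hU.derivs_bounded 1 le_rfl (by norm_num)
  refine ⟨M, ?_, fun y hy => ?_⟩
  · have := hM 0 le_rfl
    rw [iteratedDeriv_one] at this
    exact (abs_pos.mpr (hU.deriv_pos 0 le_rfl).ne').trans_le this
  · have := hM y hy
    rw [iteratedDeriv_one] at this
    exact (le_abs_self _).trans this

lemma exists_neg {U : ℝ → ℝ} (hU : AdmissibleShearFlow U) : ∃ Y > 0, ∀ y, Y ≤ y → iteratedDeriv 2 U y < 0 := by
  obtain ⟨κ, h0, h1, Y, hY, c, hc, h⟩ := hU.kappa_decay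
  refine ⟨Y, hY, fun y hy => ?_⟩
  have hy0 : 0 ≤ y := hY.le.trans hy
  have := h y hy
  have h2 : 0 < c * deriv U y ^ 3 := mul_pos hc (pow_pos (hU.deriv_pos y hy0) 3)
  have h3 : 0 < (1 - U y) ^ ((2:ℝ) - κ) := Real.rpow_pos_of_pos (by linarith [hU.U_lt_one hy0]) _
  by_contra hcon
  push Not at hcon
  have := mul_nonneg h3.le hcon
  linarith

lemma int_U' {U : ℝ → ℝ} (hU : AdmissibleShearFlow U) : IntegrableOn (deriv U) (Ioi 0) :=
  integrableOn_Ioi_deriv_of_nonneg hU.c0.continuousWithinAt (fun y _ => hU.hd0 y)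
    (fun y hy => (hU.deriv_pos y (le_of_lt hy)).le) hU.tendsto_one

lemma int_yU' {U : ℝ → ℝ} (hU : AdmissibleShearFlow U) : IntegrableOn (fun y => y * deriv U y) (Ioi 0) := by
  have hI : ∀ y, HasDerivAt (fun y => ∫ s in (0:ℝ)..y, (1 - U s)) (1 - U y) y := by
    intro y
    exact intervalIntegral.integral_hasDerivAt_right
      ((continuous_const.sub hU.c0).intervalIntegrable _ _)
      ((continuous_const.sub hU.c0).stronglyMeasurableAtFilter _ _)
      ((continuous_const.sub hU.c0).continuousAt)
  have hP : ∀ y, HasDerivAt (fun y => -(y * (1 - U y)) + ∫ s in (0:ℝ)..y, (1 - U s))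
      (y * deriv U y) y := by
    intro y
    have := (((hasDerivAt_id y).mul ((hU.hd0 y).const_sub 1)).neg).add (hI y)
    refine this.congr_deriv ?_
    simp; ring
  refine integrableOn_Ioi_deriv_of_nonneg (hP 0).continuousAt.continuousWithinAt (fun y _ => hP y)
    (fun y hy => mul_nonneg (le_of_lt hy) (hU.deriv_pos y (le_of_lt hy)).le)
    (l := -0 + ∫ s in Ioi (0:ℝ), (1 - U s)) ?_
  refine Tendsto.add hU.decay_ratio₂.neg ?_
  exact intervalIntegral_tendsto_integral_Ioi 0 hU.integrable_defect tendsto_id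

lemma int_F {U : ℝ → ℝ} (hU : AdmissibleShearFlow U) : IntegrableOn (srcF U) (Ioi 0) := hU.integrable_defect.add hU.int_yU'

lemma cF {U : ℝ → ℝ} (hU : AdmissibleShearFlow U) : Continuous (srcF U) :=
  (continuous_const.sub hU.c0).add (continuous_id.mul hU.c1)

lemma F_contDiff {U : ℝ → ℝ} (hU : AdmissibleShearFlow U) : ContDiff ℝ (⊤ : ℕ∞) (srcF U) :=
  (contDiff_const.sub hU.smooth).add (contDiff_id.mul hU.cd1)

lemma im_le_norm_sub (μ : ℂ) (x : ℝ) : μ.im ≤ ‖μ - (x:ℂ)‖ := by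
  have := Complex.abs_im_le_norm (μ - (x:ℂ))
  simp at this
  exact (le_abs_self _).trans this

lemma sub_ne {μ : ℂ} (hμ : 0 < μ.im) (x : ℝ) : μ - (x:ℂ) ≠ 0 := by
  rw [← norm_pos_iff]; exact hμ.trans_le (im_le_norm_sub μ x)

/-- a product of an integrable function with a bounded continuous function is integrable -/
lemma int_mul_bdd {U : ℝ → ℝ} (hU : AdmissibleShearFlow U) {f : ℝ → ℂ} (hf : IntegrableOn f (Ioi 0)) {g : ℝ → ℂ} (hg : Continuous g)
    (C : ℝ) (hC : ∀ y, 0 < y → ‖g y‖ ≤ C) : IntegrableOn (fun y => g y * f y) (Ioi 0) := by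
  refine Integrable.bdd_mul (c := C) hf hg.aestronglyMeasurable ?_
  filter_upwards [ae_restrict_mem measurableSet_Ioi] with y hy using hC y hy

lemma c_inv {U : ℝ → ℝ} (hU : AdmissibleShearFlow U) {μ : ℂ} (hμ : 0 < μ.im) : Continuous (fun y => (μ - (U y : ℂ))⁻¹) :=
  (continuous_const.sub (Complex.continuous_ofReal.comp hU.c0)).inv₀ (fun y => sub_ne hμ _)

lemma norm_inv_le {μ : ℂ} (hμ : 0 < μ.im) (x : ℝ) : ‖(μ - (x : ℂ))⁻¹‖ ≤ μ.im⁻¹ := by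
  rw [norm_inv]; exact inv_anti₀ hμ (im_le_norm_sub μ x)

end AdmissibleShearFlow

/-- the density `γ` -/
def gam (U : ℝ → ℝ) (y : ℝ) : ℝ := (1 - U y) ^ 2 * iteratedDeriv 2 U y / (deriv U y) ^ 2

/-- the inviscid dispersion function -/
def Phi (U : ℝ → ℝ) (μ : ℂ) : ℂ :=
  1 / (μ * ((deriv U 0 : ℝ) : ℂ)) + ∫ y in Ioi (0:ℝ), (gam U y : ℂ) / ((U y : ℂ) - μ)

namespace AdmissibleShearFlow

lemma int_gam {U : ℝ → ℝ} (hU : AdmissibleShearFlow U) : IntegrableOn (fun y => (gam U y : ℂ)) (Ioi 0) := hU.decay_ratio₃.ofReal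

lemma int_gam_div {U : ℝ → ℝ} (hU : AdmissibleShearFlow U) {μ : ℂ} (hμ : 0 < μ.im) :
    IntegrableOn (fun y => (gam U y : ℂ) / ((U y : ℂ) - μ)) (Ioi 0) := by
  have := (hU.int_mul_bdd hU.int_gam (hU.c_inv hμ) μ.im⁻¹ (fun y _ => norm_inv_le hμ _)).neg
  refine this.congr (Eventually.of_forall fun y => ?_)
  simp only [Pi.neg_apply]
  have e : (U y : ℂ) - μ = -(μ - (U y : ℂ)) := by ring
  rw [e, div_neg, div_eq_inv_mul]

lemma int_zeta {U : ℝ → ℝ} (hU : AdmissibleShearFlow U) {μ : ℂ} (hμ : 0 < μ.im) :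
    IntegrableOn (fun y => 1 - ((μ - 1) / (μ - (U y : ℂ))) ^ 2) (Ioi 0) := by
  have hc : Continuous (fun y => (2 * μ - 1 - (U y : ℂ)) * ((μ - (U y : ℂ))⁻¹ * (μ - (U y : ℂ))⁻¹)) :=
    ((continuous_const.sub (Complex.continuous_ofReal.comp hU.c0))).mul
      ((hU.c_inv hμ).mul (hU.c_inv hμ))
  have h1 : IntegrableOn (fun y => ((1 - U y : ℝ) : ℂ)) (Ioi 0) := hU.integrable_defect.ofReal
  have := hU.int_mul_bdd h1 hc ((‖2 * μ - 1‖ + 1) * (μ.im⁻¹ * μ.im⁻¹)) (fun y hy => by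
    rw [norm_mul, norm_mul]
    gcongr
    · refine (norm_sub_le _ _).trans ?_
      gcongr
      rw [Complex.norm_real, Real.norm_eq_abs, abs_of_nonneg (hU.U_nonneg hy.le)]
      exact (hU.U_lt_one hy.le).le
    · exact norm_inv_le hμ _
    · exact norm_inv_le hμ _)
  refine this.congr (Eventually.of_forall fun y => ?_)
  have := sub_ne hμ (U y)
  simp only []
  push_cast
  field_simp
  ring

lemma Phi_eq_zeta {U : ℝ → ℝ} (hU : AdmissibleShearFlow U) {μ : ℂ} (hμ : 0 < μ.im) :
    Phi U μ = ∫ y in Ioi (0:ℝ), (1 - ((μ - 1) / (μ - (U y : ℂ))) ^ 2) := by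
  set Q : ℝ → ℂ := fun y => (1 - (U y : ℂ)) ^ 2 / (((U y : ℂ) - μ) * ((deriv U y : ℝ) : ℂ)) with hQ
  have hne : ∀ y, (U y : ℂ) - μ ≠ 0 := fun y => by
    rw [← neg_sub]; exact neg_ne_zero.mpr (sub_ne hμ _)
  have hu0 : ∀ y, HasDerivAt (fun y => (U y : ℂ)) ((deriv U y : ℝ) : ℂ) y := fun y => (hU.hd0 y).ofReal_comp
  have hu1 : ∀ y, HasDerivAt (fun y => ((deriv U y : ℝ) : ℂ)) ((iteratedDeriv 2 U y : ℝ) : ℂ) y :=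
    fun y => (hU.hd1 y).ofReal_comp
  have hpos : ∀ y, 0 ≤ y → ((deriv U y : ℝ) : ℂ) ≠ 0 := fun y hy => by
    exact_mod_cast (hU.deriv_pos y hy).ne'
  have hQd : ∀ y, 0 ≤ y → HasDerivAt Q ((1 - ((μ - 1) / (μ - (U y : ℂ))) ^ 2)
      - (gam U y : ℂ) / ((U y : ℂ) - μ)) y := by
    intro y hy
    have h := (((hu0 y).const_sub 1).pow 2).div (((hu0 y).sub_const μ).mul (hu1 y))
      (mul_ne_zero (hne y) (hpos y hy))
    refine h.congr_deriv ?_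
    have h1 := hne y; have h2 := hpos y hy; have h3 := sub_ne hμ (U y)
    simp only [gam]
    push_cast
    have e : μ - (U y : ℂ) = -((U y : ℂ) - μ) := by ring
    rw [e, div_neg, neg_sq]
    simp only [Pi.mul_apply, Pi.pow_apply]
    have e2 : μ - 1 = (U y : ℂ) - ((U y : ℂ) - μ) - 1 := by ring
    rw [e2]
    generalize (U y : ℂ) - μ = v at *
    field_simp
    ring
  have hlim : Tendsto Q atTop (nhds 0) := by
    have h1 : Tendsto (fun y => ‖((1 - U y) ^ 2 / deriv U y : ℝ)‖ * μ.im⁻¹) atTop (nhds 0) := by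
      have := (hU.decay_ratio₁.norm).mul_const (μ.im⁻¹)
      simpa using this
    refine squeeze_zero_norm (fun y => ?_) h1
    have e : Q y = (((1 - U y) ^ 2 / deriv U y : ℝ) : ℂ) * (-(μ - (U y:ℂ))⁻¹) := by
      rw [hQ]; push_cast
      rw [← inv_neg, neg_sub]
      simp only [div_eq_mul_inv, mul_inv]; ring
    rw [e, norm_mul, norm_neg, Complex.norm_real]
    gcongr
    exact norm_inv_le hμ _
  have hintg := (hU.int_zeta hμ).sub (hU.int_gam_div hμ)
  have h := integral_Ioi_of_hasDerivAt_of_tendsto (hQd 0 le_rfl).continuousAt.continuousWithinAt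
    (fun y hy => hQd y (le_of_lt hy)) hintg hlim
  rw [integral_sub (hU.int_zeta hμ) (hU.int_gam_div hμ)] at h
  rw [Phi]
  have hQ0 : Q 0 = - (1 / (μ * ((deriv U 0 : ℝ) : ℂ))) := by
    rw [hQ]; simp [hU.zero_val]
  rw [hQ0] at h
  linear_combination -h

lemma int_F_div {U : ℝ → ℝ} (hU : AdmissibleShearFlow U) {μ : ℂ} (hμ : 0 < μ.im) :
    IntegrableOn (fun y => (srcF U y : ℂ) / (μ - (U y : ℂ)) ^ 2) (Ioi 0) := by
  have := hU.int_mul_bdd (f := fun y => (srcF U y : ℂ)) hU.int_F.ofReal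
    ((hU.c_inv hμ).mul (hU.c_inv hμ)) (μ.im⁻¹ * μ.im⁻¹) (fun y _ => by
    show ‖(μ - (U y:ℂ))⁻¹ * (μ - (U y:ℂ))⁻¹‖ ≤ _
    rw [norm_mul]; gcongr
    · exact norm_inv_le hμ _
    · exact norm_inv_le hμ _)
  refine this.congr (Eventually.of_forall fun y => ?_)
  simp only [Pi.mul_apply]
  rw [div_eq_inv_mul, sq, mul_inv]

lemma Phi_eq_inv {U : ℝ → ℝ} (hU : AdmissibleShearFlow U) {μ : ℂ} (hμ : 0 < μ.im) : PhiInv U μ = Phi U μ := by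
  set Q : ℝ → ℂ := fun y => -((y : ℂ) * (1 - (U y : ℂ))) / (μ - (U y : ℂ)) with hQ
  have hu0 : ∀ y, HasDerivAt (fun y => (U y : ℂ)) ((deriv U y : ℝ) : ℂ) y := fun y => (hU.hd0 y).ofReal_comp
  have hQd : ∀ y, HasDerivAt Q ((μ - 1) * ((srcF U y : ℂ) / (μ - (U y : ℂ)) ^ 2)
      - (1 - ((μ - 1) / (μ - (U y : ℂ))) ^ 2)) y := by
    intro y
    have hid : HasDerivAt (fun y : ℝ => (y : ℂ)) 1 y := (hasDerivAt_id y).ofReal_comp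
    have h := ((hid.mul ((hu0 y).const_sub 1)).neg).div ((hu0 y).const_sub μ) (sub_ne hμ _)
    refine h.congr_deriv ?_
    have h3 := sub_ne hμ (U y)
    simp only [srcF, Pi.neg_apply, Pi.mul_apply]
    push_cast
    field_simp
    ring
  have hlim : Tendsto Q atTop (nhds 0) := by
    have h1 : Tendsto (fun y => ‖(y * (1 - U y) : ℝ)‖ * μ.im⁻¹) atTop (nhds 0) := by
      have := (hU.decay_ratio₂.norm).mul_const (μ.im⁻¹)
      simpa using this
    refine squeeze_zero_norm (fun y => ?_) h1
    have e : Q y = -((y * (1 - U y) : ℝ) : ℂ) * (μ - (U y:ℂ))⁻¹ := by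
      rw [hQ]; push_cast; rw [div_eq_mul_inv]
    rw [e, norm_mul, norm_neg, Complex.norm_real]
    gcongr
    exact norm_inv_le hμ _
  have hintg := ((hU.int_F_div hμ).const_mul (μ - 1)).sub (hU.int_zeta hμ)
  have h := integral_Ioi_of_hasDerivAt_of_tendsto (hQd 0).continuousAt.continuousWithinAt
    (fun y _ => hQd y) hintg hlim
  rw [integral_sub ((hU.int_F_div hμ).const_mul (μ - 1)) (hU.int_zeta hμ), integral_const_mul] at h
  rw [PhiInv, hU.Phi_eq_zeta hμ]
  have hQ0 : Q 0 = 0 := by rw [hQ]; simp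
  rw [hQ0] at h
  linear_combination h

/-- `Im Φ < 0` outside the half disc. -/
lemma Phi_im_neg {U : ℝ → ℝ} (hU : AdmissibleShearFlow U) {μ : ℂ} (hμ : 0 < μ.im) (h : μ.re ≤ 0 ∨ 1 ≤ μ.re ∨ 1 ≤ μ.im) :
    (Phi U μ).im < 0 := by
  rw [hU.Phi_eq_zeta hμ]
  have e : (∫ y in Ioi (0:ℝ), (1 - ((μ - 1) / (μ - (U y : ℂ))) ^ 2)).im
      = ∫ y in Ioi (0:ℝ), (1 - ((μ - 1) / (μ - (U y : ℂ))) ^ 2).im :=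
    (integral_im (hU.int_zeta hμ)).symm
  rw [e, ← neg_pos, ← integral_neg]
  have hpos : ∀ y, 0 < y → 0 < -(1 - ((μ - 1) / (μ - (U y : ℂ))) ^ 2).im := by
    intro y hy
    have h0 := hU.U_pos hy
    have h1 := hU.U_lt_one hy.le
    have hn : 0 < Complex.normSq (μ - (U y:ℂ)) := Complex.normSq_pos.mpr (sub_ne hμ _)
    have e1 : ((μ - 1) / (μ - (U y : ℂ))).re
        = ((μ.re - 1) * (μ.re - U y) + μ.im ^ 2) / Complex.normSq (μ - (U y:ℂ)) := by
      rw [Complex.div_re]; simp; ring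
    have e2 : ((μ - 1) / (μ - (U y : ℂ))).im
        = (μ.im * (1 - U y)) / Complex.normSq (μ - (U y:ℂ)) := by
      rw [Complex.div_im]; simp; ring
    have p1 : 0 < ((μ - 1) / (μ - (U y : ℂ))).re := by
      rw [e1]; apply div_pos _ hn
      rcases h with h | h | h
      · nlinarith [mul_nonneg (show 0 ≤ 1 - μ.re by linarith) (show 0 ≤ U y - μ.re by linarith), sq_nonneg μ.im, mul_pos hμ hμ]
      · nlinarith [mul_nonneg (show 0 ≤ μ.re - 1 by linarith) (show 0 ≤ μ.re - U y by linarith), mul_pos hμ hμ]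
      · nlinarith [sq_nonneg (2 * μ.re - 1 - U y)]
    have p2 : 0 < ((μ - 1) / (μ - (U y : ℂ))).im := by
      rw [e2]; apply div_pos _ hn
      exact mul_pos hμ (by linarith)
    rw [sq, Complex.sub_im, Complex.mul_im, Complex.one_im]
    nlinarith [mul_pos p1 p2]
  have hi : IntegrableOn (fun y => -(1 - ((μ - 1) / (μ - (U y : ℂ))) ^ 2).im) (Ioi 0) :=
    ((hU.int_zeta hμ).im).neg
  rw [setIntegral_pos_iff_support_of_nonneg_ae]
  · have : Function.support (fun y => -(1 - ((μ - 1) / (μ - (U y : ℂ))) ^ 2).im) ∩ Ioi 0 = Ioi 0 := by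
      apply inter_eq_right.mpr
      intro y hy; exact (hpos y hy).ne'
    rw [this]; simp
  · filter_upwards [ae_restrict_mem measurableSet_Ioi] with y hy using (hpos y hy).le
  · exact hi

end AdmissibleShearFlow

set_option linter.unusedVariables false

lemma sub_ne' {μ : ℂ} (hμ : 0 < μ.im) (x : ℝ) : (x:ℂ) - μ ≠ 0 := by
  rw [← neg_sub]; exact neg_ne_zero.mpr (AdmissibleShearFlow.sub_ne hμ x)

lemma slit_of_im_ne {z : ℂ} (h : z.im ≠ 0) : z ∈ Complex.slitPlane := Or.inr h

lemma cont_inv' {μ : ℂ} (hμ : 0 < μ.im) : Continuous (fun u : ℝ => ((u:ℂ) - μ)⁻¹) :=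
  (Complex.continuous_ofReal.sub continuous_const).inv₀ (fun u => sub_ne' hμ u)

lemma norm_inv_le' {μ : ℂ} (hμ : 0 < μ.im) (x : ℝ) : ‖((x : ℂ) - μ)⁻¹‖ ≤ μ.im⁻¹ := by
  rw [← neg_sub, inv_neg, norm_neg]; exact AdmissibleShearFlow.norm_inv_le hμ x

lemma log_int {μ : ℂ} (hμ : 0 < μ.im) {p q : ℝ} (hpq : p ≤ q) :
    ∫ u in Ioo p q, ((u:ℂ) - μ)⁻¹ = Complex.log (q - μ) - Complex.log (p - μ) := by
  rw [← integral_Ioc_eq_integral_Ioo, ← intervalIntegral.integral_of_le hpq]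
  refine intervalIntegral.integral_eq_sub_of_hasDerivAt (f := fun u : ℝ => Complex.log ((u:ℂ) - μ))
    (fun u _ => ?_) ((cont_inv' hμ).intervalIntegrable _ _)
  have h : HasDerivAt (fun u : ℝ => (u:ℂ) - μ) 1 u := ((hasDerivAt_id u).ofReal_comp).sub_const μ
  have := h.clog_real (slit_of_im_ne (by simp [hμ.ne']))
  simpa using this

lemma int_div' {g : ℝ → ℝ} {s : Set ℝ} (hg : IntegrableOn g s) {μ : ℂ} (hμ : 0 < μ.im) :
    IntegrableOn (fun u => (g u : ℂ) * ((u:ℂ) - μ)⁻¹) s := by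
  have := Integrable.bdd_mul (c := μ.im⁻¹) (Integrable.ofReal (𝕜 := ℂ) hg)
    (cont_inv' hμ).aestronglyMeasurable (Eventually.of_forall fun y => norm_inv_le' hμ y)
  exact this.congr (Eventually.of_forall fun y => mul_comm _ _)

/-- subtract a constant on a subinterval -/
lemma cauchy_split {g : ℝ → ℝ} (hg : IntegrableOn g (Ioo 0 1)) {p q : ℝ} (hp : 0 ≤ p) (hpq : p ≤ q)
    (hq : q ≤ 1) (t : ℝ) {μ : ℂ} (hμ : 0 < μ.im) :
    ∫ u in Ioo (0:ℝ) 1, (g u : ℂ) * ((u:ℂ) - μ)⁻¹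
      = (∫ u in Ioo (0:ℝ) 1, ((g u - (Ioo p q).indicator (fun _ => t) u : ℝ) : ℂ) * ((u:ℂ) - μ)⁻¹)
        + t * (Complex.log (q - μ) - Complex.log (p - μ)) := by
  have hi : IntegrableOn ((Ioo p q).indicator (fun _ => t)) (Ioo 0 1) := by
    refine IntegrableOn.indicator ?_ measurableSet_Ioo
    exact integrableOn_const (by simp)
  have h2 : ∫ u in Ioo (0:ℝ) 1, (((Ioo p q).indicator (fun _ => t) u : ℝ) : ℂ) * ((u:ℂ) - μ)⁻¹
      = t * (Complex.log (q - μ) - Complex.log (p - μ)) := by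
    rw [← log_int hμ hpq, ← integral_const_mul]
    have : ∀ u : ℝ, (((Ioo p q).indicator (fun _ => t) u : ℝ) : ℂ) * ((u:ℂ) - μ)⁻¹
        = (Ioo p q).indicator (fun u : ℝ => (t:ℂ) * ((u:ℂ) - μ)⁻¹) u := by
      intro u; by_cases hu : u ∈ Ioo p q <;> simp [hu]
    simp_rw [this]
    rw [setIntegral_indicator measurableSet_Ioo]
    congr 2
    exact inter_eq_right.mpr (Ioo_subset_Ioo hp hq)
  have h3 : IntegrableOn (fun u => g u - (Ioo p q).indicator (fun _ => t) u) (Ioo 0 1) := hg.sub hi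
  rw [← h2, ← integral_add (int_div' h3 hμ) (int_div' hi hμ)]
  congr 1; ext u; push_cast; ring

lemma plemelj_bound {g : ℝ → ℝ} {p q C : ℝ} 
    (hL : ∀ u ∈ Ioo p q, ∀ v ∈ Ioo p q, |g u - g v| ≤ C * |u - v|) (hC : 0 ≤ C)
    {ρ : ℝ} (hρ : 0 < ρ) {μ : ℂ} (hre : μ.re ∈ Ioo p q) (hfar : ∀ u ∈ Ioo (0:ℝ) 1, u ∉ Ioo p q → ρ ≤ |u - μ.re|)
    {u : ℝ} (hu : u ∈ Ioo (0:ℝ) 1) :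
    ‖((g u - (Ioo p q).indicator (fun _ => g μ.re) u : ℝ) : ℂ) * ((u:ℂ) - μ)⁻¹‖ ≤ C + |g u| * ρ⁻¹ := by
  have hle : |u - μ.re| ≤ ‖(u:ℂ) - μ‖ := by
    have := Complex.abs_re_le_norm ((u:ℂ) - μ); simpa using this
  rw [norm_mul, norm_inv, Complex.norm_real, Real.norm_eq_abs]
  by_cases h : u ∈ Ioo p q
  · rw [indicator_of_mem h]
    have h1 := hL u h _ hre
    have h2 : |g u - g μ.re| * ‖(u:ℂ) - μ‖⁻¹ ≤ C := by
      rcases eq_or_ne (‖(u:ℂ) - μ‖) 0 with h0 | h0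
      · rw [h0]; simpa using hC
      · rw [← div_eq_mul_inv, div_le_iff₀ (lt_of_le_of_ne (norm_nonneg _) h0.symm)]
        exact h1.trans (mul_le_mul_of_nonneg_left hle hC)
    have : 0 ≤ |g u| * ρ⁻¹ := by positivity
    linarith
  · rw [indicator_of_notMem h, sub_zero]
    have h1 := hfar u hu h
    have : ‖(u:ℂ) - μ‖⁻¹ ≤ ρ⁻¹ := inv_anti₀ hρ (h1.trans hle)
    have := mul_le_mul_of_nonneg_left this (abs_nonneg (g u))
    linarith

/-- Plemelj formula and existence of the principal value -/
lemma plemelj {g : ℝ → ℝ} (hg : IntegrableOn g (Ioo 0 1)) {a p q C r : ℝ} (hr : 0 < r)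
    (hpa : p = a - r) (hqa : q = a + r) (hp : 0 ≤ p) (hq : q ≤ 1) (hC : 0 ≤ C)
    (hL : ∀ u ∈ Ioo p q, ∀ v ∈ Ioo p q, |g u - g v| ≤ C * |u - v|) :
    Tendsto (fun μ : ℂ => ∫ u in Ioo (0:ℝ) 1, (g u : ℂ) * ((u:ℂ) - μ)⁻¹)
      (nhdsWithin (a:ℂ) {z | 0 < z.im})
      (nhds ((pvIntegral g a : ℂ) + Complex.I * ((Real.pi * g a : ℝ) : ℂ))) := by
  have haJ : a ∈ Ioo p q := ⟨by linarith, by linarith⟩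
  have hpq : p ≤ q := by linarith
  have hbd : IntegrableOn (fun u => C + |g u| * (r/2)⁻¹) (Ioo 0 1) :=
    (integrableOn_const (by simp)).add (hg.abs.mul_const _)
  have hmeas : ∀ t : ℝ, AEStronglyMeasurable (fun u => g u - (Ioo p q).indicator (fun _ => t) u)
      (volume.restrict (Ioo (0:ℝ) 1)) := fun t =>
    hg.aestronglyMeasurable.sub
      ((measurable_const.indicator measurableSet_Ioo).aestronglyMeasurable)
  set k : ℝ → ℝ := fun u => g u - (Ioo p q).indicator (fun _ => g a) u with hk
  set V : ℝ := ∫ u in Ioo (0:ℝ) 1, k u * (u - a)⁻¹ with hV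
  -- far estimate
  have hfar : ∀ x : ℝ, |x - a| < r/2 → ∀ u ∈ Ioo (0:ℝ) 1, u ∉ Ioo p q → r/2 ≤ |u - x| := by
    intro x hx u _ hu
    have : r ≤ |u - a| := by
      by_contra hc
      push Not at hc
      rw [abs_lt] at hc
      exact hu ⟨by linarith, by linarith⟩
    have := abs_sub_abs_le_abs_sub (u - a) (x - a)
    have e : u - a - (x - a) = u - x := by ring
    rw [e] at this; linarith
  -- principal value
  have hpv : pvIntegral g a = V := by
    apply Tendsto.limUnder_eq
    have hsym : ∀ ε ∈ Ioo 0 r, ∫ u in Ioo (0:ℝ) 1 \ Ioo (a - ε) (a + ε), g u / (u - a)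
        = ∫ u in Ioo (0:ℝ) 1, (Ioo (a-ε) (a+ε))ᶜ.indicator (fun u => k u * (u - a)⁻¹) u := by
      intro ε hε
      have e0 : Ioo (0:ℝ) 1 \ Ioo (a - ε) (a + ε) = Ioo (0:ℝ) 1 ∩ (Ioo (a-ε) (a+ε))ᶜ := rfl
      rw [setIntegral_indicator measurableSet_Ioo.compl, ← e0]
      set T := Ioo (0:ℝ) 1 \ Ioo (a - ε) (a + ε)
      have hT : MeasurableSet T := measurableSet_Ioo.diff measurableSet_Ioo
      have hz : ∫ u in T, (Ioo p q).indicator (fun _ => g a) u * (u - a)⁻¹ = 0 := by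
        rw [← integral_indicator hT]
        set w : ℝ → ℝ := T.indicator (fun u => (Ioo p q).indicator (fun _ => g a) u * (u - a)⁻¹)
        have hw : ∀ u, w (2 * a - u) = - w u := by
          intro u
          have h1 : u ∈ Ioo p q ↔ 2 * a - u ∈ Ioo p q := by
            subst hpa; subst hqa; simp only [mem_Ioo]; constructor <;> rintro ⟨h, h'⟩ <;> constructor <;> linarith
          have h2 : u ∈ Ioo (a-ε) (a+ε) ↔ 2 * a - u ∈ Ioo (a-ε) (a+ε) := by
            simp only [mem_Ioo]; constructor <;> rintro ⟨h, h'⟩ <;> constructor <;> linarith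
          have e : (2 * a - u - a)⁻¹ = - (u - a)⁻¹ := by rw [← inv_neg]; congr 1; ring
          by_cases hu : u ∈ Ioo p q
          · have hu' := h1.mp hu
            have m1 : u ∈ Ioo (0:ℝ) 1 := Ioo_subset_Ioo hp hq hu
            have m2 : 2 * a - u ∈ Ioo (0:ℝ) 1 := Ioo_subset_Ioo hp hq hu'
            by_cases hue : u ∈ Ioo (a-ε) (a+ε)
            · have hue' := h2.mp hue
              have n1 : u ∉ T := fun h => h.2 hue
              have n2 : 2 * a - u ∉ T := fun h => h.2 hue'
              simp [w, n1, n2]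
            · have n1 : u ∈ T := ⟨m1, hue⟩
              have n2 : 2 * a - u ∈ T := ⟨m2, fun h => hue (h2.mpr h)⟩
              simp only [w, indicator_of_mem n1, indicator_of_mem n2, indicator_of_mem hu, indicator_of_mem hu', e]
              ring
          · have hu' : 2 * a - u ∉ Ioo p q := fun h => hu (h1.mpr h)
            simp only [w, indicator, hu, hu']
            simp
        have h3 := integral_sub_left_eq_self w volume (2 * a)
        simp_rw [hw] at h3
        rw [integral_neg] at h3
        linarith
      have hgi : IntegrableOn (fun u => k u * (u - a)⁻¹) T := by
        have hki : IntegrableOn k T := by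
          refine IntegrableOn.mono_set ?_ sdiff_subset
          exact hg.sub ((integrableOn_const (by simp)).indicator measurableSet_Ioo)
        have : IntegrableOn (fun u => (u - a)⁻¹ * k u) T := by
          refine Integrable.bdd_mul (c := ε⁻¹) hki ?_ ?_
          · exact (measurable_id.sub_const a).inv.aestronglyMeasurable
          · filter_upwards [ae_restrict_mem hT] with u hu
            rw [norm_inv, Real.norm_eq_abs]
            refine inv_anti₀ hε.1 ?_
            by_contra hc
            push Not at hc
            rw [abs_lt] at hc
            exact hu.2 ⟨by linarith, by linarith⟩
        exact this.congr (Eventually.of_forall fun y => mul_comm _ _)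
      have hii : IntegrableOn (fun u => (Ioo p q).indicator (fun _ => g a) u * (u - a)⁻¹) T := by
        have hki : IntegrableOn ((Ioo p q).indicator (fun _ => g a)) T := by
          refine IntegrableOn.mono_set ?_ sdiff_subset
          exact ((integrableOn_const (by simp)).indicator measurableSet_Ioo)
        have : IntegrableOn (fun u => (u - a)⁻¹ * (Ioo p q).indicator (fun _ => g a) u) T := by
          refine Integrable.bdd_mul (c := ε⁻¹) hki ?_ ?_
          · exact (measurable_id.sub_const a).inv.aestronglyMeasurable
          · filter_upwards [ae_restrict_mem hT] with u hu
            rw [norm_inv, Real.norm_eq_abs]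
            refine inv_anti₀ hε.1 ?_
            by_contra hc
            push Not at hc
            rw [abs_lt] at hc
            exact hu.2 ⟨by linarith, by linarith⟩
        exact this.congr (Eventually.of_forall fun y => mul_comm _ _)
      have := integral_add hgi hii
      rw [hz, add_zero] at this
      rw [← this]
      congr 1; ext u; simp only [hk]; ring
    have hev : ∀ᶠ ε in nhdsWithin (0:ℝ) (Ioi 0), ε ∈ Ioo 0 r := Ioo_mem_nhdsGT hr
    refine Tendsto.congr' (f₁ := fun ε => ∫ u in Ioo (0:ℝ) 1, (Ioo (a-ε) (a+ε))ᶜ.indicator (fun u => k u * (u - a)⁻¹) u) ?_ ?_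
    · filter_upwards [hev] with ε hε using (hsym ε hε).symm
    · refine tendsto_integral_filter_of_dominated_convergence (fun u => C + |g u| * (r/2)⁻¹) ?_ ?_ hbd ?_
      · refine Eventually.of_forall fun ε => ?_
        refine AEStronglyMeasurable.indicator ?_ measurableSet_Ioo.compl
        exact (hmeas _).mul (measurable_id.sub_const a).inv.aestronglyMeasurable
      · refine Eventually.of_forall fun ε => ?_
        filter_upwards [ae_restrict_mem measurableSet_Ioo] with u hu
        refine (norm_indicator_le_norm_self _ _).trans ?_
        have := plemelj_bound hL hC (half_pos hr) (μ := (a:ℂ)) (by simpa using haJ) (by simpa using hfar a (by simp [hr])) hu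
        rw [Complex.ofReal_re, ← Complex.ofReal_sub, ← Complex.ofReal_inv, ← Complex.ofReal_mul, Complex.norm_real] at this
        exact this
      · have hna : ∀ᵐ u ∂(volume.restrict (Ioo (0:ℝ) 1)), u ≠ a :=
          ae_restrict_of_ae (by simp [ae_iff])
        filter_upwards [hna] with u hu
        refine tendsto_const_nhds.congr' ?_
        filter_upwards [Ioo_mem_nhdsGT (abs_pos.mpr (sub_ne_zero.mpr hu))] with ε hε
        rw [indicator_of_mem]
        intro h
        have : |u - a| < ε := abs_lt.mpr ⟨by linarith [h.1], by linarith [h.2]⟩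
        linarith [hε.2]
  rw [hpv]
  -- the Cauchy integral
  have hgc : ContinuousAt g a := by
    rw [Metric.continuousAt_iff]
    intro ε hε
    refine ⟨min r (ε / (C + 1)), lt_min hr (by positivity), fun {x} hx => ?_⟩
    rw [Real.dist_eq] at hx ⊢
    have h1 := lt_of_lt_of_le hx (min_le_left _ _)
    have h2 := lt_of_lt_of_le hx (min_le_right _ _)
    rw [abs_lt] at h1
    refine (hL x ⟨by linarith, by linarith⟩ a haJ).trans_lt ?_
    rw [lt_div_iff₀ (by positivity)] at h2
    nlinarith [abs_nonneg (x - a)]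
  have hre : Tendsto (fun μ : ℂ => μ.re) (nhdsWithin (a:ℂ) {z | 0 < z.im}) (nhds a) := by
    have := Complex.continuous_re.tendsto (a:ℂ)
    exact this.mono_left nhdsWithin_le_nhds
  have hgre : Tendsto (fun μ : ℂ => g μ.re) (nhdsWithin (a:ℂ) {z | 0 < z.im}) (nhds (g a)) :=
    hgc.tendsto.comp hre
  have hnear : ∀ᶠ μ : ℂ in nhdsWithin (a:ℂ) {z | 0 < z.im}, |μ.re - a| < r/2 := by
    have := (Metric.tendsto_nhds.mp hre) (r/2) (half_pos hr)
    simpa [Real.dist_eq] using this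
  have hH : ∀ᶠ μ : ℂ in nhdsWithin (a:ℂ) {z | 0 < z.im}, 0 < μ.im := self_mem_nhdsWithin
  have hid : Tendsto (fun μ : ℂ => μ) (nhdsWithin (a:ℂ) {z | 0 < z.im}) (nhds (a:ℂ)) :=
    tendsto_id.mono_left nhdsWithin_le_nhds
  refine Tendsto.congr' (f₁ := fun μ : ℂ => 
      (∫ u in Ioo (0:ℝ) 1, ((g u - (Ioo p q).indicator (fun _ => g μ.re) u : ℝ) : ℂ) * ((u:ℂ) - μ)⁻¹)
        + (g μ.re : ℂ) * (Complex.log (q - μ) - Complex.log (p - μ))) ?_ ?_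
  · filter_upwards [hH] with μ hμ using (cauchy_split hg hp hpq hq (g μ.re) hμ).symm
  refine Tendsto.add ?_ ?_
  · have hVc : ((V : ℝ) : ℂ) = ∫ u in Ioo (0:ℝ) 1, ((k u : ℝ) : ℂ) * ((u:ℂ) - a)⁻¹ := by
      rw [hV, ← integral_complex_ofReal]; push_cast; rfl
    rw [hVc]
    refine tendsto_integral_filter_of_dominated_convergence (fun u => C + |g u| * (r/2)⁻¹) ?_ ?_ hbd ?_
    · filter_upwards [hH] with μ hμ
      exact (Complex.continuous_ofReal.comp_aestronglyMeasurable (hmeas _)).mul (cont_inv' hμ).aestronglyMeasurable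
    · filter_upwards [hnear] with μ hμ
      filter_upwards [ae_restrict_mem measurableSet_Ioo] with u hu
      refine plemelj_bound hL hC (half_pos hr) ?_ (hfar _ hμ) hu
      rw [abs_lt] at hμ
      exact ⟨by linarith, by linarith⟩
    · have hna : ∀ᵐ u ∂(volume.restrict (Ioo (0:ℝ) 1)), u ≠ a :=
          ae_restrict_of_ae (by simp [ae_iff])
      filter_upwards [hna] with u hu
      refine Tendsto.mul ?_ ?_
      · refine (Complex.continuous_ofReal.tendsto _).comp ?_
        refine tendsto_const_nhds.sub ?_
        by_cases h : u ∈ Ioo p q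
        · simpa [h] using hgre
        · simpa [h] using tendsto_const_nhds
      · refine Tendsto.inv₀ (tendsto_const_nhds.sub hid) ?_
        rw [sub_ne_zero]; exact_mod_cast hu
  · have e : Complex.I * ((Real.pi * g a : ℝ) : ℂ) = (g a : ℂ) * ((Real.log r : ℂ) - ((Real.log r : ℂ) - Real.pi * Complex.I)) := by
      push_cast; ring
    rw [e]
    refine Tendsto.mul ((Complex.continuous_ofReal.tendsto _).comp hgre) (Tendsto.sub ?_ ?_)
    · have h1 : Tendsto (fun μ : ℂ => (q:ℂ) - μ) (nhdsWithin (a:ℂ) {z | 0 < z.im}) (nhds ((r:ℝ):ℂ)) := by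
        have := (tendsto_const_nhds (x := (q:ℂ))).sub hid
        convert this using 2
        rw [hqa]; push_cast; ring
      rw [Complex.ofReal_log hr.le]
      exact h1.clog (by left; simpa using hr)
    · have h1 : Tendsto (fun μ : ℂ => (p:ℂ) - μ) (nhdsWithin (a:ℂ) {z | 0 < z.im}) (nhdsWithin ((-r:ℝ):ℂ) {z | z.im < 0}) := by
        refine tendsto_nhdsWithin_iff.mpr ⟨?_, ?_⟩
        · have := (tendsto_const_nhds (x := (p:ℂ))).sub hid
          convert this using 2
          rw [hpa]; push_cast; ring
        · filter_upwards [hH] with μ hμ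
          simp [hμ]
      have h2 := Complex.tendsto_log_nhdsWithin_im_neg_of_re_neg_of_im_zero (z := ((-r:ℝ):ℂ)) (by simp [hr]) (by simp)
      have h3 := h2.comp h1
      rw [Complex.norm_real, Real.norm_eq_abs, abs_neg, abs_of_pos hr] at h3
      exact h3


set_option linter.unusedVariables false

lemma cauchy_near_zero {g : ℝ → ℝ} (hg : IntegrableOn g (Ioo 0 1)) {b C : ℝ} (hb : 0 < b) (hb1 : b ≤ 1)
    (hC : 0 ≤ C) (hL : ∀ u ∈ Ioo 0 b, ∀ v ∈ Ioo 0 b, |g u - g v| ≤ C * |u - v|) :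
    Tendsto (fun μ : ℂ => μ * ∫ u in Ioo (0:ℝ) 1, (g u : ℂ) * ((u:ℂ) - μ)⁻¹)
      (nhdsWithin 0 {z | 0 < z.im ∧ 0 < z.re}) (nhds 0) := by
  set l := nhdsWithin (0:ℂ) {z | 0 < z.im ∧ 0 < z.re} with hl
  have hH : ∀ᶠ μ : ℂ in l, 0 < μ.im ∧ 0 < μ.re := self_mem_nhdsWithin
  have hid : Tendsto (fun μ : ℂ => μ) l (nhds 0) := tendsto_id.mono_left nhdsWithin_le_nhds
  have hre : Tendsto (fun μ : ℂ => μ.re) l (nhds 0) := by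
    have := Complex.continuous_re.tendsto (0:ℂ)
    exact this.comp hid
  have hnear : ∀ᶠ μ : ℂ in l, μ.re < b/2 := hre.eventually_lt_const (half_pos hb)
  have hbd : IntegrableOn (fun u => C + |g u| * (b/2)⁻¹) (Ioo 0 1) :=
    (integrableOn_const (by simp)).add (hg.abs.mul_const _)
  set D1 := ∫ u in Ioo (0:ℝ) 1, (C + |g u| * (b/2)⁻¹)
  set D2 := |g (b/2)| + C * b
  have hD2 : ∀ u ∈ Ioo 0 b, |g u| ≤ D2 := by
    intro u hu
    have h1 := hL u hu (b/2) ⟨by linarith, by linarith⟩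
    have h2 : |u - b/2| ≤ b := by rw [abs_le]; constructor <;> linarith [hu.1, hu.2]
    have h3 := mul_le_mul_of_nonneg_left h2 hC
    have h4 := abs_sub_abs_le_abs_sub (g u) (g (b/2))
    simp only [D2]; linarith
  have key : ∀ᶠ μ : ℂ in l, ‖μ * ∫ u in Ioo (0:ℝ) 1, (g u : ℂ) * ((u:ℂ) - μ)⁻¹‖ ≤
      ‖μ‖ * D1 + D2 * (‖μ‖ * ‖Complex.log (b - μ)‖ + (|‖μ‖ * Real.log ‖μ‖| + ‖μ‖ * Real.pi)) := by
    filter_upwards [hH, hnear] with μ hμ hμ2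
    rw [cauchy_split hg le_rfl hb.le hb1 (g μ.re) hμ.1, norm_mul]
    have h1 : ‖∫ u in Ioo (0:ℝ) 1, ((g u - (Ioo 0 b).indicator (fun _ => g μ.re) u : ℝ) : ℂ) * ((u:ℂ) - μ)⁻¹‖ ≤ D1 := by
      refine norm_integral_le_of_norm_le hbd ?_
      filter_upwards [ae_restrict_mem measurableSet_Ioo] with u hu
      refine plemelj_bound hL hC (half_pos hb) ⟨hμ.2, by linarith⟩ (fun v hv hv2 => ?_) hu
      have : b ≤ v := by
        by_contra hc; exact hv2 ⟨hv.1, not_le.mp hc⟩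
      exact le_trans (by linarith) (le_abs_self _)
    have h2 : ‖Complex.log ((0:ℝ) - μ)‖ ≤ |Real.log ‖μ‖| + Real.pi := by
      refine (Complex.norm_le_abs_re_add_abs_im _).trans ?_
      have e : ((0:ℝ):ℂ) - μ = -μ := by simp
      rw [e, Complex.log_re, Complex.log_im, norm_neg]
      gcongr
      exact Complex.abs_arg_le_pi _
    have h3 := hD2 μ.re ⟨hμ.2, by linarith⟩
    have h4 : ‖(g μ.re : ℂ) * (Complex.log (b - μ) - Complex.log ((0:ℝ) - μ))‖
        ≤ D2 * (‖Complex.log (b - μ)‖ + (|Real.log ‖μ‖| + Real.pi)) := by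
      rw [norm_mul, Complex.norm_real, Real.norm_eq_abs]
      have h0 : 0 ≤ D2 := (abs_nonneg _).trans h3
      gcongr
      exact (norm_sub_le _ _).trans (by gcongr)
    calc ‖μ‖ * _ ≤ ‖μ‖ * (D1 + D2 * (‖Complex.log (b - μ)‖ + (|Real.log ‖μ‖| + Real.pi))) := by
          gcongr; exact (norm_add_le _ _).trans (add_le_add h1 h4)
      _ = _ := by rw [abs_mul, abs_norm]; ring
  refine squeeze_zero_norm' key ?_
  have hn : Tendsto (fun μ : ℂ => ‖μ‖) l (nhds 0) := by simpa using hid.norm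
  have t1 : Tendsto (fun μ : ℂ => ‖Complex.log (b - μ)‖) l (nhds ‖Complex.log (b - 0)‖) := by
    refine Tendsto.norm (Tendsto.clog (tendsto_const_nhds.sub hid) ?_)
    left; simpa using hb
  have t2 : Tendsto (fun μ : ℂ => |‖μ‖ * Real.log ‖μ‖|) l (nhds |0 * Real.log 0|) :=
    ((Real.continuous_mul_log.tendsto 0).comp hn).abs
  have := (hn.mul_const D1).add (((hn.mul t1).add (t2.add (hn.mul_const Real.pi))).const_mul D2)
  simpa using this

namespace AdmissibleShearFlow
variable {U : ℝ → ℝ}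

lemma inv_U (hU : AdmissibleShearFlow U) {y : ℝ} (hy : 0 ≤ y) : shearInv U (U y) = y :=
  hU.strictMono.injOn.leftInvOn_invFunOn hy

lemma image_U (hU : AdmissibleShearFlow U) : U '' (Ioi 0) = Ioo 0 1 := by
  ext u; constructor
  · rintro ⟨y, hy, rfl⟩
    exact ⟨hU.U_pos hy, hU.U_lt_one (le_of_lt hy)⟩
  · rintro ⟨h0, h1⟩
    obtain ⟨Y, hY⟩ := (hU.tendsto_one.eventually_const_lt h1).and (eventually_gt_atTop 0) |>.exists
    have := intermediate_value_Ioo (hY.2.le) hU.c0.continuousOn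
    obtain ⟨y, hy, e⟩ := this ⟨by rwa [hU.zero_val], hY.1⟩
    exact ⟨y, hy.1, e⟩

lemma g_U (hU : AdmissibleShearFlow U) {y : ℝ} (hy : 0 ≤ y) :
    gfun U (U y) = (1 - U y) ^ 2 * iteratedDeriv 2 U y / (deriv U y) ^ 3 := by
  rw [gfun, hU.inv_U hy]

lemma g_U' (hU : AdmissibleShearFlow U) {y : ℝ} (hy : 0 ≤ y) :
    |deriv U y| * gfun U (U y) = gam U y := by
  rw [hU.g_U hy, gam, abs_of_pos (hU.deriv_pos y hy)]
  have := (hU.deriv_pos y hy).ne'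
  field_simp

lemma int_g (hU : AdmissibleShearFlow U) : IntegrableOn (gfun U) (Ioo 0 1) := by
  rw [← hU.image_U, integrableOn_image_iff_integrableOn_abs_deriv_smul measurableSet_Ioi
    (fun y _ => (hU.hd0 y).hasDerivWithinAt) (hU.strictMono.injOn.mono Ioi_subset_Ici_self)]
  refine IntegrableOn.congr_fun hU.decay_ratio₃ (fun y hy => ?_) measurableSet_Ioi
  exact (hU.g_U' (le_of_lt hy)).symm

lemma Phi_g (hU : AdmissibleShearFlow U) (μ : ℂ) :
    Phi U μ = 1 / (μ * ((deriv U 0 : ℝ) : ℂ)) + ∫ u in Ioo (0:ℝ) 1, (gfun U u : ℂ) * ((u:ℂ) - μ)⁻¹ := by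
  rw [Phi]; congr 1
  rw [← hU.image_U, integral_image_eq_integral_abs_deriv_smul measurableSet_Ioi
    (fun y _ => (hU.hd0 y).hasDerivWithinAt) (hU.strictMono.injOn.mono Ioi_subset_Ici_self)]
  refine setIntegral_congr_fun measurableSet_Ioi (fun y hy => ?_)
  simp only [← hU.g_U' (le_of_lt hy), Complex.real_smul, div_eq_mul_inv]
  push_cast; ring

lemma g_lip (hU : AdmissibleShearFlow U) {b : ℝ} (hb : 0 < b) (hb1 : b < 1) :
    ∃ C, 0 ≤ C ∧ ∀ u ∈ Ioo 0 b, ∀ v ∈ Ioo 0 b, |gfun U u - gfun U v| ≤ C * |u - v| := by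
  have hbm : b ∈ U '' Ioi 0 := by rw [hU.image_U]; exact ⟨hb, hb1⟩
  obtain ⟨Y, hY, rfl⟩ := hbm
  have hY0 : 0 < Y := hY
  have hpos : ∀ y ∈ Icc 0 Y, deriv U y ≠ 0 := fun y hy => (hU.deriv_pos y hy.1).ne'
  have hcd : ContDiffOn ℝ 1 (fun y => (1 - U y) ^ 2 * iteratedDeriv 2 U y / (deriv U y) ^ 3) (Icc 0 Y) := by
    have h0 : ContDiff ℝ 1 U := hU.smooth.of_le (by exact_mod_cast le_top)
    have h1 : ContDiff ℝ 1 (deriv U) := hU.cd1.of_le (by exact_mod_cast le_top)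
    have h2 : ContDiff ℝ 1 (iteratedDeriv 2 U) := hU.cd2.of_le (by exact_mod_cast le_top)
    refine ContDiffOn.div (((contDiff_const.sub h0).pow 2).mul h2).contDiffOn (h1.pow 3).contDiffOn ?_
    intro y hy; exact pow_ne_zero 3 (hpos y hy)
  obtain ⟨K, hK⟩ := hcd.exists_lipschitzOnWith (by simp) (convex_Icc 0 Y) isCompact_Icc
  obtain ⟨y0, hy0, hmin⟩ := isCompact_Icc.exists_isMinOn (nonempty_Icc.mpr hY0.le) hU.c1.continuousOn
  set m := deriv U y0
  have hm : 0 < m := hU.deriv_pos y0 hy0.1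
  have hlow : ∀ y ∈ Icc 0 Y, ∀ z ∈ Icc 0 Y, m * |y - z| ≤ |U y - U z| := by
    have : ∀ y ∈ Icc 0 Y, ∀ z ∈ Icc 0 Y, z ≤ y → m * (y - z) ≤ U y - U z := by
      intro y hy z hz hzy
      refine (convex_Icc 0 Y).mul_sub_le_image_sub_of_le_deriv hU.c0.continuousOn
        (hU.smooth.differentiable (by simp)).differentiableOn (fun x hx => ?_) z hz y hy hzy
      exact hmin (interior_subset hx)
    intro y hy z hz
    rcases le_total z y with h | h
    · rw [abs_of_nonneg (sub_nonneg.mpr h)]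
      exact (this y hy z hz h).trans (le_abs_self _)
    · rw [abs_sub_comm, abs_sub_comm (U y), abs_of_nonneg (sub_nonneg.mpr h)]
      exact (this z hz y hy h).trans (le_abs_self _)
  refine ⟨K / m, by positivity, fun u hu v hv => ?_⟩
  have hsub : ∀ u ∈ Ioo 0 (U Y), ∃ y ∈ Icc 0 Y, U y = u := by
    intro u hu
    have hum : u ∈ U '' Ioi 0 := by rw [hU.image_U]; exact ⟨hu.1, hu.2.trans hb1⟩
    obtain ⟨y, hy, rfl⟩ := hum
    refine ⟨y, ⟨le_of_lt hy, ?_⟩, rfl⟩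
    exact ((hU.strictMono.lt_iff_lt (show y ∈ Ici 0 from le_of_lt (show 0 < y from hy)) (show Y ∈ Ici 0 from hY0.le)).mp hu.2).le
  obtain ⟨y, hy, rfl⟩ := hsub u hu
  obtain ⟨z, hz, rfl⟩ := hsub v hv
  rw [hU.g_U hy.1, hU.g_U hz.1]
  have h1 := hK.dist_le_mul y hy z hz
  rw [Real.dist_eq, Real.dist_eq] at h1
  refine h1.trans ?_
  rw [div_mul_eq_mul_div, mul_div_assoc]
  refine mul_le_mul_of_nonneg_left ?_ K.2
  rw [le_div_iff₀ hm, mul_comm]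
  exact hlow y hy z hz

/-- boundary values on `(0,1)` -/
lemma tendsto_G (hU : AdmissibleShearFlow U) {a : ℝ} (ha : a ∈ Ioo (0:ℝ) 1) :
    Tendsto (Phi U) (nhdsWithin (a:ℂ) {z | 0 < z.im}) (nhds (Gfun U a)) := by
  obtain ⟨C, hC, hL⟩ := hU.g_lip (b := (1 + a)/2) (by linarith [ha.1]) (by linarith [ha.2])
  set r := min a ((1 - a)/2)
  have hr : 0 < r := lt_min ha.1 (by linarith [ha.2])
  have hr1 : r ≤ a := min_le_left _ _
  have hr2 : r ≤ (1-a)/2 := min_le_right _ _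
  have h := plemelj hU.int_g hr (a := a) rfl rfl (by linarith) (by linarith [ha.2]) hC
    (fun u hu v hv => hL u ⟨by linarith [hu.1], by linarith [hu.2]⟩ v ⟨by linarith [hv.1], by linarith [hv.2]⟩)
  have e : Gfun U a = 1 / ((a:ℂ) * ((deriv U 0 : ℝ) : ℂ)) + ((pvIntegral (gfun U) a : ℂ) + Complex.I * ((Real.pi * gfun U a : ℝ) : ℂ)) := by
    rw [Gfun]; push_cast; ring
  rw [e]
  have hfun : Phi U = fun μ => 1 / (μ * ((deriv U 0 : ℝ) : ℂ)) + ∫ u in Ioo (0:ℝ) 1, (gfun U u : ℂ) * ((u:ℂ) - μ)⁻¹ :=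
    funext hU.Phi_g
  rw [hfun]
  refine Tendsto.add ?_ h
  refine Tendsto.div tendsto_const_nhds (Tendsto.mul (tendsto_id.mono_left nhdsWithin_le_nhds) tendsto_const_nhds) ?_
  refine mul_ne_zero ?_ ?_
  · exact_mod_cast ha.1.ne'
  · exact_mod_cast (hU.deriv_pos 0 le_rfl).ne'

/-- continuity in the upper half plane -/
lemma Phi_contAt (hU : AdmissibleShearFlow U) {μ : ℂ} (hμ : 0 < μ.im) : ContinuousAt (Phi U) μ := by
  have hfun : Phi U = fun μ => 1 / (μ * ((deriv U 0 : ℝ) : ℂ)) + ∫ u in Ioo (0:ℝ) 1, (gfun U u : ℂ) * ((u:ℂ) - μ)⁻¹ :=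
    funext hU.Phi_g
  rw [hfun]
  have hne : μ ≠ 0 := fun h => by simp [h] at hμ
  refine ContinuousAt.add ?_ ?_
  · refine ContinuousAt.div continuousAt_const (continuousAt_id.mul continuousAt_const) ?_
    refine mul_ne_zero hne ?_
    exact_mod_cast (hU.deriv_pos 0 le_rfl).ne'
  · have hev : ∀ᶠ ν in nhds μ, μ.im / 2 < ν.im :=
      (Complex.continuous_im.tendsto μ).eventually_const_lt (by linarith)
    refine continuousAt_of_dominated (bound := fun u => |gfun U u| * (μ.im/2)⁻¹) ?_ ?_ ?_ ?_
    · filter_upwards [hev] with ν hν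
      have hν' : 0 < ν.im := by linarith
      exact (int_div' hU.int_g hν').aestronglyMeasurable
    · filter_upwards [hev] with ν hν
      have hν' : 0 < ν.im := by linarith
      refine Eventually.of_forall fun u => ?_
      rw [norm_mul, Complex.norm_real, Real.norm_eq_abs]
      gcongr
      exact (norm_inv_le' hν' u).trans (inv_anti₀ (by linarith) hν.le)
    · exact hU.int_g.abs.mul_const _
    · refine Eventually.of_forall fun u => ?_
      refine continuousAt_const.mul (ContinuousAt.inv₀ (continuousAt_const.sub continuousAt_id) (sub_ne' hμ u))

lemma exists_small_deriv (hU : AdmissibleShearFlow U) {ε : ℝ} (hε : 0 < ε) (Y : ℝ) (hY : 0 < Y) :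
    ∃ R > Y, deriv U R < ε := by
  by_contra hc
  push Not at hc
  have := (convex_Ici Y).mul_sub_le_image_sub_of_le_deriv (C := ε) hU.c0.continuousOn
        (hU.smooth.differentiable (by simp)).differentiableOn (fun x hx => by
          rw [interior_Ici] at hx; exact hc x hx) Y self_mem_Ici (Y + 1/ε) (by simp; positivity) (by simp; positivity)
  have h1 := hU.U_lt_one (y := Y + 1/ε) (by positivity)
  have h2 := hU.U_nonneg hY.le
  have e : ε * (Y + 1/ε - Y) = 1 := by field_simp; ring
  rw [e] at this
  linarith

lemma near_one (hU : AdmissibleShearFlow U) :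
    ∃ δ > 0, ∀ μ : ℂ, 0 < μ.im → ‖μ - 1‖ < δ → (Phi U μ).im < 0 := by
  obtain ⟨Y, hY, hneg⟩ := hU.exists_neg
  set d := 1 - U Y
  have hd : 0 < d := by have := hU.U_lt_one hY.le; simp only [d]; linarith
  set I0 := ∫ y in Ioi (0:ℝ), |gam U y|
  have hI0 : 0 ≤ I0 := integral_nonneg fun y => abs_nonneg _
  set C1 := I0 * ((d/2)^2)⁻¹ with hC1
  have hC10 : 0 ≤ C1 := by positivity
  have hU'Y := hU.deriv_pos Y hY.le
  set A := 4 * C1 + 1 / deriv U Y + 1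
  have hA : 0 < A := by positivity
  obtain ⟨R, hR, hRs⟩ := hU.exists_small_deriv (ε := 1 / A) (by positivity) Y hY
  have hR0 : 0 < R := hY.trans hR
  have hU'R := hU.deriv_pos R hR0.le
  have hAR : A < 1 / deriv U R := by
    rw [lt_div_iff₀ hU'R]; rw [lt_div_iff₀ hA] at hRs; linarith
  refine ⟨min (d/2) (1 - U R), lt_min (half_pos hd) (by linarith [hU.U_lt_one hR0.le]), fun μ hμ hδ => ?_⟩
  have hδ1 := lt_of_lt_of_le hδ (min_le_left _ _)
  have hδ2 := lt_of_lt_of_le hδ (min_le_right _ _)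
  have e1 : (Phi U μ).im = -(μ.im / (Complex.normSq μ * deriv U 0))
      + μ.im * ∫ y in Ioi (0:ℝ), gam U y * (Complex.normSq ((U y:ℂ) - μ))⁻¹ := by
    rw [Phi, Complex.add_im]
    congr 1
    · rw [one_div, Complex.inv_im]
      simp only [Complex.mul_im, Complex.ofReal_im, Complex.ofReal_re, mul_zero, zero_add, Complex.normSq_mul, Complex.normSq_ofReal]
      have := (hU.deriv_pos 0 le_rfl).ne'
      have : Complex.normSq μ ≠ 0 := by rw [Ne, Complex.normSq_eq_zero]; intro h; simp [h] at hμ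
      field_simp
    · rw [← integral_const_mul]
      have := integral_im (hU.int_gam_div hμ)
      refine Eq.trans this.symm ?_
      congr 1; ext y
      show ((gam U y : ℂ) / ((U y:ℂ) - μ)).im = _
      rw [Complex.div_im]
      simp
      ring
  have hpos0 := hU.deriv_pos 0 le_rfl
  have hnsq : 0 < Complex.normSq μ := Complex.normSq_pos.mpr (fun h => by simp [h] at hμ)
  have hintg : IntegrableOn (fun y => gam U y * (Complex.normSq ((U y:ℂ) - μ))⁻¹) (Ioi 0) := by
    have h1 := (hU.int_gam_div hμ).im
    refine (h1.const_mul (μ.im⁻¹)).congr (Eventually.of_forall fun y => ?_)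
    show μ.im⁻¹ * ((gam U y : ℂ) / ((U y:ℂ) - μ)).im = _
    rw [Complex.div_im]
    simp
    field_simp
  have key : ∫ y in Ioi (0:ℝ), gam U y * (Complex.normSq ((U y:ℂ) - μ))⁻¹ ≤ 0 := by
    have s1 : Ioi (0:ℝ) = Ioc 0 Y ∪ Ioi Y := (Ioc_union_Ioi_eq_Ioi hY.le).symm
    have s2 : Ioi Y = Ioc Y R ∪ Ioi R := (Ioc_union_Ioi_eq_Ioi hR.le).symm
    have i1 : IntegrableOn (fun y => gam U y * (Complex.normSq ((U y:ℂ) - μ))⁻¹) (Ioc 0 Y) := hintg.mono_set Ioc_subset_Ioi_self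
    have i2 : IntegrableOn (fun y => gam U y * (Complex.normSq ((U y:ℂ) - μ))⁻¹) (Ioi Y) := hintg.mono_set (Ioi_subset_Ioi hY.le)
    have i3 : IntegrableOn (fun y => gam U y * (Complex.normSq ((U y:ℂ) - μ))⁻¹) (Ioc Y R) := i2.mono_set Ioc_subset_Ioi_self
    have i4 : IntegrableOn (fun y => gam U y * (Complex.normSq ((U y:ℂ) - μ))⁻¹) (Ioi R) := i2.mono_set (Ioi_subset_Ioi hR.le)
    rw [s1, setIntegral_union (Ioc_disjoint_Ioi le_rfl) measurableSet_Ioi i1 i2, s2,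
      setIntegral_union (Ioc_disjoint_Ioi le_rfl) measurableSet_Ioi i3 i4]
    have gneg : ∀ y, Y ≤ y → gam U y ≤ 0 := fun y hy => by
      rw [gam]
      exact div_nonpos_of_nonpos_of_nonneg (mul_nonpos_of_nonneg_of_nonpos (sq_nonneg _) (hneg y hy).le) (sq_nonneg _)
    have hmono := hU.strictMono.monotoneOn
    have b1 : ∫ y in Ioc 0 Y, gam U y * (Complex.normSq ((U y:ℂ) - μ))⁻¹ ≤ C1 := by
      have ig : IntegrableOn (fun y => |gam U y|) (Ioi 0) := hU.decay_ratio₃.abs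
      calc _ ≤ ∫ y in Ioc 0 Y, |gam U y| * ((d/2)^2)⁻¹ := by
            refine setIntegral_mono_on i1 ((ig.mono_set Ioc_subset_Ioi_self).mul_const _) measurableSet_Ioc (fun y hy => ?_)
            have hy1 : U y ≤ U Y := hmono hy.1.le hY.le hy.2
            have h3 : d / 2 ≤ ‖(U y:ℂ) - μ‖ := by
              have t1 : ‖(U y : ℂ) - 1‖ ≤ ‖(U y:ℂ) - μ‖ + ‖μ - 1‖ := by
                have := norm_add_le ((U y:ℂ) - μ) (μ - 1); simpa using this
              have t2 : ‖(U y : ℂ) - 1‖ = 1 - U y := by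
                rw [← Complex.ofReal_one, ← Complex.ofReal_sub, Complex.norm_real, Real.norm_eq_abs, abs_sub_comm,
                  abs_of_nonneg (by linarith [hU.U_lt_one hy.1.le])]
              rw [t2] at t1
              simp only [d] at hδ1 ⊢
              linarith
            have h4 : (Complex.normSq ((U y:ℂ) - μ))⁻¹ ≤ ((d/2)^2)⁻¹ := by
              rw [Complex.normSq_eq_norm_sq]
              exact inv_anti₀ (by positivity) (pow_le_pow_left₀ (by positivity) h3 2)
            calc _ ≤ |gam U y| * (Complex.normSq ((U y:ℂ) - μ))⁻¹ :=
                  mul_le_mul_of_nonneg_right (le_abs_self _) (inv_nonneg.mpr (Complex.normSq_nonneg _))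
              _ ≤ _ := mul_le_mul_of_nonneg_left h4 (abs_nonneg _)
        _ = (∫ y in Ioc 0 Y, |gam U y|) * ((d/2)^2)⁻¹ := integral_mul_const _ _
        _ ≤ C1 := by
            rw [hC1]; gcongr
            exact setIntegral_mono_set ig (Eventually.of_forall fun y => abs_nonneg _) (Eventually.of_forall Ioc_subset_Ioi_self)
    have b3 : ∫ y in Ioi R, gam U y * (Complex.normSq ((U y:ℂ) - μ))⁻¹ ≤ 0 := by
      refine setIntegral_nonpos measurableSet_Ioi (fun y hy => ?_)
      exact mul_nonpos_of_nonpos_of_nonneg (gneg y (hR.le.trans (le_of_lt hy))) (inv_nonneg.mpr (Complex.normSq_nonneg _))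
    have hder : ∀ y ∈ uIcc Y R, HasDerivAt (fun y => -(1/4) * (deriv U y)⁻¹) (1/4 * (iteratedDeriv 2 U y / (deriv U y)^2)) y := by
      intro y hy
      rw [uIcc_of_le hR.le] at hy
      have hp := (hU.deriv_pos y (hY.le.trans hy.1)).ne'
      refine (((hU.hd1 y).inv hp).const_mul (-(1/4))).congr_deriv ?_
      ring
    have hcont : IntervalIntegrable (fun y => 1/4 * (iteratedDeriv 2 U y / (deriv U y)^2)) volume Y R := by
      refine ContinuousOn.intervalIntegrable ?_
      rw [uIcc_of_le hR.le]
      refine continuousOn_const.mul (hU.c2.continuousOn.div (hU.c1.pow 2).continuousOn (fun y hy => ?_))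
      exact pow_ne_zero 2 (hU.deriv_pos y (hY.le.trans hy.1)).ne'
    have b2 : ∫ y in Ioc Y R, gam U y * (Complex.normSq ((U y:ℂ) - μ))⁻¹ ≤ -(1/4) * (1 / deriv U R - 1 / deriv U Y) := by
      have hFTC := intervalIntegral.integral_eq_sub_of_hasDerivAt hder hcont
      rw [intervalIntegral.integral_of_le hR.le] at hFTC
      calc _ ≤ ∫ y in Ioc Y R, 1/4 * (iteratedDeriv 2 U y / (deriv U y)^2) := by
            refine setIntegral_mono_on i3 hcont.1 measurableSet_Ioc (fun y hy => ?_)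
            have hy0 : 0 < y := hY.trans hy.1
            have hyR : U y ≤ U R := hmono hy0.le hR0.le hy.2
            have hU1 := hU.U_lt_one hy0.le
            have h3 : ‖(U y:ℂ) - μ‖ ≤ 2 * (1 - U y) := by
              have t1 : ‖(U y : ℂ) - μ‖ ≤ ‖(U y:ℂ) - 1‖ + ‖μ - 1‖ := by
                have := norm_sub_le ((U y:ℂ) - 1) (μ - 1); simpa using this
              have t2 : ‖(U y : ℂ) - 1‖ = 1 - U y := by
                rw [← Complex.ofReal_one, ← Complex.ofReal_sub, Complex.norm_real, Real.norm_eq_abs, abs_sub_comm,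
                  abs_of_nonneg (by linarith)]
              linarith
            have h4 : ((2 * (1 - U y))^2)⁻¹ ≤ (Complex.normSq ((U y:ℂ) - μ))⁻¹ := by
              rw [Complex.normSq_eq_norm_sq]
              refine inv_anti₀ (pow_pos (norm_pos_iff.mpr (sub_ne' hμ _)) 2) (pow_le_pow_left₀ (norm_nonneg _) h3 2)
            have h5 := mul_le_mul_of_nonpos_left h4 (gneg y hy.1.le)
            refine h5.trans (le_of_eq ?_)
            rw [gam]
            have hp := (hU.deriv_pos y hy0.le).ne'
            have : (1 - U y) ≠ 0 := by linarith
            field_simp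
            norm_num
        _ = _ := by rw [hFTC]; ring
    simp only [A] at hAR
    linarith
  rw [e1]
  have : 0 < μ.im / (Complex.normSq μ * deriv U 0) := by positivity
  have := mul_nonpos_of_nonneg_of_nonpos hμ.le key
  linarith

end AdmissibleShearFlow

set_option linter.unusedVariables false

def HH : Set ℂ := {z | 0 < z.im}
def XX : Set ℂ := {z | 0 < z.im ∨ (z.im = 0 ∧ 0 < z.re ∧ z.re < 1)}
def fX (U : ℝ → ℝ) : ℂ → ℂ := extendFrom HH (fun μ => Phi U μ - ((deltaS U : ℝ) : ℂ))

lemma closure_HH {z : ℂ} (hz : 0 ≤ z.im) : z ∈ closure HH := by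
  have : closure {z : ℂ | 0 < z.im} = {z | 0 ≤ z.im} := Complex.closure_setOf_lt_im 0
  rw [HH, this]; exact hz

lemma XX_sub : XX ⊆ closure HH := by
  rintro z (h | h)
  · exact subset_closure h
  · exact closure_HH h.1.ge

lemma XX_convex : Convex ℝ XX := by
  rw [convex_iff_forall_pos]
  rintro x hx y hy a b ha hb hab
  simp only [XX, mem_setOf_eq, Complex.add_im, Complex.add_re, Complex.real_smul, Complex.mul_im, Complex.mul_re,
    Complex.ofReal_re, Complex.ofReal_im, zero_mul, add_zero, sub_zero] at *
  rcases hx with hx | ⟨hx, hx1, hx2⟩ <;> rcases hy with hy | ⟨hy, hy1, hy2⟩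
  · left; positivity
  · left; rw [hy]; simp; positivity
  · left; rw [hx]; simp; positivity
  · right; rw [hx, hy]; refine ⟨by simp, by positivity, ?_⟩
    have := mul_lt_mul_of_pos_left hx2 ha
    have := mul_lt_mul_of_pos_left hy2 hb
    linarith

/-- continuous logarithm on a convex set -/
lemma exists_log {X : Set ℂ} (hX : Convex ℝ X) {f : ℂ → ℂ} (hf : ContinuousOn f X)
    (hne : ∀ x ∈ X, f x ≠ 0) {p : ℂ} (hp : p ∈ X) :
    ∃ L : ℂ → ℂ, ContinuousOn L X ∧ ∀ x ∈ X, Complex.exp (L x) = f x := by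
  classical
  let c : unitInterval × X → X := fun q => ⟨AffineMap.lineMap p (q.2 : ℂ) (q.1 : ℝ),
    hX.lineMap_mem hp q.2.2 q.1.2⟩
  have hc : Continuous c := by
    refine Continuous.subtype_mk ?_ _
    simp only [AffineMap.lineMap_apply]
    fun_prop
  let H : C(unitInterval × X, {z : ℂ // z ≠ 0}) :=
    ⟨fun q => ⟨f (c q), hne _ (c q).2⟩, by
      refine Continuous.subtype_mk ?_ _
      exact (continuousOn_iff_continuous_restrict.mp hf).comp hc⟩
  let f0 : C(X, ℂ) := ContinuousMap.const _ (Complex.log (f p))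
  have H0 : ∀ a, H (0, a) = (⟨_, (f0 a).exp_ne_zero⟩ : {z : ℂ // z ≠ 0}) := by
    intro a
    apply Subtype.ext
    simp [H, c, f0, Complex.exp_log (hne p hp)]
  let G := Complex.isCoveringMap_exp.liftHomotopy H f0 H0
  have hG : ∀ q, Complex.exp (G q) = f (c q) := by
    intro q
    have := congr_fun (Complex.isCoveringMap_exp.liftHomotopy_lifts H f0 H0) q
    exact congrArg Subtype.val this
  refine ⟨fun x => if h : x ∈ X then G (1, ⟨x, h⟩) else 0, ?_, ?_⟩
  · rw [continuousOn_iff_continuous_restrict]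
    have : Continuous (fun x : X => G (1, x)) := G.continuous.comp (by fun_prop)
    convert this using 1
    ext x; simp
  · intro x hx
    simp only [hx, dif_pos]
    rw [hG]; simp [c]

/-- abstract counting of jumps -/
lemma jump_count (Z : Finset ℝ) (d j : ℝ → ℤ) (hj : ∀ y, y ∉ Z → j y = 0)
    (h : ∀ y > 0, ∃ A : ℤ, ∃ ε > 0, (∀ z ∈ Ioo (y - ε) y, 0 < z → d z = A) ∧ (∀ z ∈ Ioo y (y + ε), d z = A + j y)
      ∧ (y ∉ Z → d y = A)) {y1 y2 : ℝ} (h1 : 0 < y1) (h2 : 0 < y2) (hz1 : ∀ p ∈ Z, y1 < p) (hz2 : ∀ p ∈ Z, p < y2) :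
    d y2 - d y1 = ∑ p ∈ Z, j p := by
  choose! A ε hε hl hr hd using h
  set r : ℝ → ℤ := fun y => A y - ∑ p ∈ Z with p < y, j p with hrdef
  have hA1 : ∀ y > 0, ∀ z ∈ Ioo (y - ε y) y, 0 < z → A z = A y := by
    intro y hy z hz hz0
    have e1 := hl y hy
    have e2 := hl z hz0
    have hw : max (max (z - ε z) (y - ε y)) 0 < z := max_lt (max_lt (by linarith [hε z hz0]) hz.1) hz0
    obtain ⟨w, hw1, hw2⟩ := exists_between hw
    rw [max_lt_iff, max_lt_iff] at hw1
    rw [← e1 w ⟨hw1.1.2, hw2.trans hz.2⟩ hw1.2, ← e2 w ⟨hw1.1.1, hw2⟩ hw1.2]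
  have hA2 : ∀ y > 0, ∀ z ∈ Ioo y (y + ε y), A z = A y + j y := by
    intro y hy z hz
    have hz0 : 0 < z := hy.trans hz.1
    have e1 := hr y hy
    have e2 := hl z hz0
    have hw : max (z - ε z) y < z := max_lt (by linarith [hε z hz0]) hz.1
    obtain ⟨w, hw1, hw2⟩ := exists_between hw
    rw [max_lt_iff] at hw1
    rw [← e1 w ⟨hw1.2, hw2.trans hz.2⟩, ← e2 w ⟨hw1.1, hw2⟩ (hy.trans hw1.2)]
  have hloc : ∀ y > 0, ∀ᶠ z in nhds y, r z = r y := by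
    intro y hy
    have hZ : ∀ᶠ z in nhds y, z ∉ Z.erase y → True := by simp
    have hfin : ∀ᶠ ρ in nhdsWithin (0:ℝ) (Ioi 0), ∀ p ∈ Z.erase y, ρ < |p - y| := by
      rw [Filter.eventually_all_finset]
      intro p hp
      have hpy : p ≠ y := (Finset.mem_erase.mp hp).1
      filter_upwards [Ioo_mem_nhdsGT (abs_pos.mpr (sub_ne_zero.mpr hpy))] with ρ hρ using hρ.2
    obtain ⟨ρ, hρ1, hρ2⟩ := (hfin.and (Ioo_mem_nhdsGT (show 0 < min y (ε y) from lt_min hy (hε y hy)))).exists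
    have hρy := lt_of_lt_of_le hρ2.2 (min_le_left _ _)
    have hρe := lt_of_lt_of_le hρ2.2 (min_le_right _ _)
    filter_upwards [Ioo_mem_nhds (show y - ρ < y by linarith [hρ2.1]) (show y < y + ρ by linarith [hρ2.1])] with z hz
    rcases lt_trichotomy z y with hzy | rfl | hzy
    · have e : (Z.filter (· < z)) = (Z.filter (· < y)) := by
        apply Finset.filter_congr
        intro p hp
        constructor
        · intro h; exact h.trans hzy
        · intro h
          have := hρ1 p (Finset.mem_erase.mpr ⟨h.ne, hp⟩)
          rw [abs_of_neg (by linarith)] at this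
          linarith [hz.1]
      simp only [hrdef, e, hA1 y hy z ⟨by linarith [hz.1], hzy⟩ (by linarith [hz.1])]
    · rfl
    · have e0 := hA2 y hy z ⟨hzy, by linarith [hz.2]⟩
      have e : ∑ p ∈ Z with p < z, j p = ∑ p ∈ Z with p < y, j p + j y := by
        by_cases hyZ : y ∈ Z
        · have : (Z.filter (· < z)) = insert y (Z.filter (· < y)) := by
            ext p
            simp only [Finset.mem_filter, Finset.mem_insert]
            constructor
            · rintro ⟨hp, hpz⟩
              by_cases hpy : p = y
              · exact Or.inl hpy
              · right; refine ⟨hp, ?_⟩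
                have := hρ1 p (Finset.mem_erase.mpr ⟨hpy, hp⟩)
                by_contra hc
                push Not at hc
                rw [abs_of_nonneg (by linarith)] at this
                linarith [hz.2]
            · rintro (rfl | ⟨hp, h⟩)
              · exact ⟨hyZ, hzy⟩
              · exact ⟨hp, h.trans hzy⟩
          rw [this, Finset.sum_insert (by simp)]; ring
        · rw [hj y hyZ, add_zero]
          congr 1
          apply Finset.filter_congr
          intro p hp
          have hpy : p ≠ y := fun h => hyZ (h ▸ hp)
          constructor
          · intro h
            have := hρ1 p (Finset.mem_erase.mpr ⟨hpy, hp⟩)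
            by_contra hc
            push Not at hc
            rw [abs_of_nonneg (by linarith)] at this
            linarith [hz.2]
          · intro h; exact h.trans hzy
      simp only [hrdef, e, e0]; ring
  have hcont : ContinuousOn r (Ioi 0) := by
    intro y hy
    refine ContinuousAt.continuousWithinAt ?_
    exact (continuousAt_const (y := r y)).congr ((hloc y hy).mono fun z hz => hz.symm)
  have hconst := isPreconnected_Ioi.constant hcont (show y1 ∈ Ioi (0:ℝ) from h1) (show y2 ∈ Ioi (0:ℝ) from h2)
  have n1 : y1 ∉ Z := fun h => lt_irrefl _ (hz1 _ h)
  have n2 : y2 ∉ Z := fun h => lt_irrefl _ (hz2 _ h)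
  simp only [hrdef] at hconst
  rw [Finset.filter_true_of_mem (s := Z) (fun p hp => hz2 p hp),
    Finset.filter_false_of_mem (s := Z) (fun p hp => (hz1 p hp).le.not_gt)] at hconst
  rw [hd y1 h1 n1, hd y2 h2 n2]
  simp at hconst
  linarith

namespace AdmissibleShearFlow
variable {U : ℝ → ℝ}

lemma tendsto_fX (hU : AdmissibleShearFlow U) {a : ℝ} (ha : a ∈ Ioo (0:ℝ) 1) :
    Tendsto (fun μ => Phi U μ - ((deltaS U : ℝ) : ℂ)) (nhdsWithin (a:ℂ) HH) (nhds (Gfun U a - ((deltaS U : ℝ) : ℂ))) :=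
  (hU.tendsto_G ha).sub tendsto_const_nhds

lemma fX_real (hU : AdmissibleShearFlow U) {a : ℝ} (ha : a ∈ Ioo (0:ℝ) 1) :
    fX U a = Gfun U a - ((deltaS U : ℝ) : ℂ) :=
  extendFrom_eq (closure_HH (by simp)) (hU.tendsto_fX ha)

lemma fX_H (hU : AdmissibleShearFlow U) {μ : ℂ} (hμ : 0 < μ.im) : fX U μ = Phi U μ - ((deltaS U : ℝ) : ℂ) :=
  extendFrom_eq (closure_HH hμ.le) (((hU.Phi_contAt hμ).sub continuousAt_const).tendsto.mono_left nhdsWithin_le_nhds)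

lemma mem_XX_real {z : ℂ} (h : z.im = 0 ∧ 0 < z.re ∧ z.re < 1) : ∃ a : ℝ, a ∈ Ioo (0:ℝ) 1 ∧ z = (a:ℂ) :=
  ⟨z.re, h.2, by apply Complex.ext <;> simp [h.1]⟩

lemma fX_cont (hU : AdmissibleShearFlow U) : ContinuousOn (fX U) XX := by
  refine continuousOn_extendFrom XX_sub ?_
  rintro z (hz | hz)
  · exact ⟨_, ((hU.Phi_contAt hz).sub continuousAt_const).tendsto.mono_left nhdsWithin_le_nhds⟩
  · obtain ⟨a, ha, rfl⟩ := mem_XX_real hz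
    exact ⟨_, hU.tendsto_fX ha⟩

lemma fX_outer (hU : AdmissibleShearFlow U) {μ : ℂ} (hμ : 0 < μ.im) (h : μ.re ≤ 0 ∨ 1 ≤ μ.re ∨ 1 ≤ μ.im) :
    (fX U μ).im < 0 := by
  rw [hU.fX_H hμ]; simpa using hU.Phi_im_neg hμ h

lemma fX_real_im (hU : AdmissibleShearFlow U) {y : ℝ} (hy : 0 < y) :
    (fX U (U y)).im = Real.pi * ((1 - U y) ^ 2 / (deriv U y) ^ 3) * iteratedDeriv 2 U y := by
  rw [hU.fX_real ⟨hU.U_pos hy, hU.U_lt_one hy.le⟩, Gfun, hU.g_U hy.le]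
  simp only [Complex.sub_im, Complex.add_im, Complex.ofReal_im, Complex.mul_im, Complex.I_re, Complex.I_im, Complex.ofReal_re]
  ring

lemma fX_real_re (hU : AdmissibleShearFlow U) {y : ℝ} (hy : 0 < y) :
    (fX U (U y)).re = chiAbscissa U y - deltaS U := by
  rw [hU.fX_real ⟨hU.U_pos hy, hU.U_lt_one hy.le⟩, chiAbscissa]
  simp

lemma fac_pos (hU : AdmissibleShearFlow U) {y : ℝ} (hy : 0 < y) :
    0 < Real.pi * ((1 - U y) ^ 2 / (deriv U y) ^ 3) := by
  have h1 := hU.U_lt_one hy.le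
  have h2 := hU.deriv_pos y hy.le
  have : 0 < 1 - U y := by linarith
  have := Real.pi_pos
  positivity

lemma fX_near_one (hU : AdmissibleShearFlow U) : ∃ δ > 0, ∀ μ ∈ XX, ‖μ - 1‖ < δ → (fX U μ).im < 0 := by
  obtain ⟨δ1, hδ1, h1⟩ := hU.near_one
  obtain ⟨Y, hY, hneg⟩ := hU.exists_neg
  have hYY := hU.U_lt_one hY.le
  refine ⟨min δ1 (1 - U Y), lt_min hδ1 (by linarith), ?_⟩
  intro μ hμ hd
  have hd1 := lt_of_lt_of_le hd (min_le_left _ _)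
  have hd2 := lt_of_lt_of_le hd (min_le_right _ _)
  rcases hμ with h | h
  · rw [hU.fX_H h]; simpa using h1 μ h hd1
  · obtain ⟨a, ha, rfl⟩ := mem_XX_real h
    have ham : a ∈ U '' Ioi 0 := by rw [hU.image_U]; exact ha
    obtain ⟨y, hy, rfl⟩ := ham
    have hy0 : 0 < y := hy
    rw [hU.fX_real_im hy0]
    refine mul_neg_of_pos_of_neg (hU.fac_pos hy0) (hneg y ?_)
    have hn : ‖(U y : ℂ) - 1‖ = 1 - U y := by
      rw [← Complex.ofReal_one, ← Complex.ofReal_sub, Complex.norm_real, Real.norm_eq_abs, abs_sub_comm,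
        abs_of_nonneg (by linarith [hU.U_lt_one hy0.le])]
    rw [hn] at hd2
    by_contra hc
    push Not at hc
    have := hU.strictMono (show y ∈ Ici 0 from hy0.le) (show Y ∈ Ici 0 from hY.le) hc
    linarith

lemma fX_near_zero (hU : AdmissibleShearFlow U) : ∃ δ > 0, ∀ μ ∈ XX, ‖μ‖ < δ → fX U μ ∈ Complex.slitPlane := by
  obtain ⟨C, hC, hL⟩ := hU.g_lip (b := 1/2) (by norm_num) (by norm_num)
  have h := cauchy_near_zero hU.int_g (b := 1/2) (by norm_num) (by norm_num) hC hL
  have hm := hU.deriv_pos 0 le_rfl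
  set m := deriv U 0
  have ht : Tendsto (fun μ : ℂ => (m:ℂ) * (μ * (Phi U μ - ((deltaS U : ℝ) : ℂ))))
      (nhdsWithin 0 {z | 0 < z.im ∧ 0 < z.re}) (nhds 1) := by
    have hid : Tendsto (fun μ : ℂ => μ) (nhdsWithin 0 {z | 0 < z.im ∧ 0 < z.re}) (nhds 0) :=
      tendsto_id.mono_left nhdsWithin_le_nhds
    have h2 := ((tendsto_const_nhds (x := (1:ℂ))).add (h.const_mul (m:ℂ))).sub
      ((hid.mul_const ((deltaS U : ℝ) : ℂ)).const_mul (m:ℂ))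
    simp only [mul_zero, zero_mul, add_zero, sub_zero] at h2
    refine h2.congr' ?_
    filter_upwards [self_mem_nhdsWithin] with μ hμ
    have hne : μ ≠ 0 := fun h => by simp [h] at hμ
    have hmne : (m:ℂ) ≠ 0 := by exact_mod_cast hm.ne'
    rw [hU.Phi_g μ]
    have e : (m:ℂ) * (μ * (1 / (μ * (m:ℂ)))) = 1 := by field_simp
    linear_combination -e
  have hev := (Metric.tendsto_nhds.mp ht) (1/2) (by norm_num)
  rw [eventually_nhdsWithin_iff, Metric.eventually_nhds_iff] at hev
  obtain ⟨δ, hδ, hball⟩ := hev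
  have final : ∀ μ f : ℂ, 0 < μ.re → ‖(m:ℂ) * (μ * f) - 1‖ ≤ 1/2 → f ∈ Complex.slitPlane := by
    intro μ f hre hb
    by_contra hc
    rw [Complex.mem_slitPlane_iff] at hc
    push Not at hc
    have h1 := Complex.abs_re_le_norm ((m:ℂ) * (μ * f) - 1)
    have h2 := (abs_le.mp (h1.trans hb)).1
    simp [Complex.mul_re, hc.2] at h2
    have : m * (μ.re * f.re) ≤ 0 := mul_nonpos_of_nonneg_of_nonpos hm.le (mul_nonpos_of_nonneg_of_nonpos hre.le hc.1)
    linarith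
  refine ⟨δ, hδ, ?_⟩
  rintro μ (hμ | hμ) hn
  · by_cases hre : 0 < μ.re
    · rw [hU.fX_H hμ]
      refine final μ _ hre ?_
      have := hball (by simpa using hn) ⟨hμ, hre⟩
      rw [dist_eq_norm] at this
      exact this.le
    · right; exact (hU.fX_outer hμ (Or.inl (not_lt.mp hre))).ne
  · obtain ⟨a, ha, rfl⟩ := mem_XX_real hμ
    rw [hU.fX_real ha]
    refine final (a:ℂ) _ (by simpa using ha.1) ?_
    have hid : Tendsto (fun μ : ℂ => μ) (nhdsWithin (a:ℂ) HH) (nhds (a:ℂ)) :=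
      tendsto_id.mono_left nhdsWithin_le_nhds
    haveI : (nhdsWithin (a:ℂ) HH).NeBot := mem_closure_iff_nhdsWithin_neBot.mp (closure_HH (by simp))
    have t := ((((hid.mul (hU.tendsto_fX ha)).const_mul (m:ℂ)).sub_const 1).norm)
    refine le_of_tendsto t ?_
    have e1 : ∀ᶠ μ : ℂ in nhdsWithin (a:ℂ) HH, ‖μ‖ < δ := hid.norm.eventually_lt_const hn
    have e2 : ∀ᶠ μ : ℂ in nhdsWithin (a:ℂ) HH, 0 < μ.re :=
      ((Complex.continuous_re.tendsto _).comp hid).eventually_const_lt (by simpa using ha.1)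
    filter_upwards [e1, e2, self_mem_nhdsWithin] with ν h1 h2 h3
    have := hball (by simpa using h1) ⟨h3, h2⟩
    rw [dist_eq_norm] at this
    exact this.le

end AdmissibleShearFlow

set_option linter.unusedVariables false

lemma int_const_on {S : Set ℂ} (hS : IsPreconnected S) {n : ℂ → ℤ} {h : ℂ → ℝ} (hh : ContinuousOn h S)
    (e : ∀ x ∈ S, (n x : ℝ) = h x) {x y : ℂ} (hx : x ∈ S) (hy : y ∈ S) : n x = n y := by
  have c : ContinuousOn (fun x => (n x : ℝ)) S := hh.congr e
  have c2 : ContinuousOn n S := Int.isClosedEmbedding_coe_real.isInducing.continuousOn_iff.mpr c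
  exact hS.constant_of_mapsTo (T := univ) (isDiscrete_univ_iff.mpr inferInstance) c2 (mapsTo_univ _ _) hx hy

lemma exists_DE {X : Set ℂ} {f L : ℂ → ℂ} (hf : ContinuousOn f X) (hL : ContinuousOn L X)
    (hne : ∀ x ∈ X, f x ≠ 0) (hLf : ∀ x ∈ X, Complex.exp (L x) = f x) :
    ∃ D E : ℂ → ℤ,
      (∀ S ⊆ X, IsPreconnected S → (∀ x ∈ S, f x ∈ Complex.slitPlane) → ∀ x ∈ S, ∀ y ∈ S, D x = D y) ∧
      (∀ S ⊆ X, IsPreconnected S → (∀ x ∈ S, - f x ∈ Complex.slitPlane) → ∀ x ∈ S, ∀ y ∈ S, E x = E y) ∧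
      (∀ x ∈ X, 0 < (f x).im → E x = D x) ∧ (∀ x ∈ X, (f x).im < 0 → E x = D x - 1) := by
  classical
  have hD : ∀ x, ∃ n : ℤ, x ∈ X → L x = Complex.log (f x) + n * (2 * Real.pi * Complex.I) := by
    intro x
    by_cases hx : x ∈ X
    · obtain ⟨n, hn⟩ := Complex.exp_eq_exp_iff_exists_int.mp
        ((hLf x hx).trans (Complex.exp_log (hne x hx)).symm)
      exact ⟨n, fun _ => hn⟩
    · exact ⟨0, fun h => absurd h hx⟩
  have hE : ∀ x, ∃ n : ℤ, x ∈ X → L x = Complex.log (- f x) + Real.pi * Complex.I + n * (2 * Real.pi * Complex.I) := by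
    intro x
    by_cases hx : x ∈ X
    · obtain ⟨n, hn⟩ := Complex.exp_eq_exp_iff_exists_int.mp
        (show Complex.exp (L x) = Complex.exp (Complex.log (- f x) + Real.pi * Complex.I) by
          rw [Complex.exp_add, Complex.exp_log (neg_ne_zero.mpr (hne x hx)), Complex.exp_pi_mul_I, hLf x hx]; ring)
      exact ⟨n, fun _ => hn⟩
    · exact ⟨0, fun h => absurd h hx⟩
  choose D hD using hD
  choose E hE using hE
  have hpi := Real.pi_pos
  refine ⟨D, E, ?_, ?_, ?_, ?_⟩
  · intro S hSX hS hsl x hx y hy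
    refine int_const_on hS (h := fun x => ((L x).im - (Complex.log (f x)).im) / (2 * Real.pi)) ?_ ?_ hx hy
    · refine ContinuousOn.div_const (ContinuousOn.sub ?_ ?_) _
      · exact Complex.continuous_im.comp_continuousOn (hL.mono hSX)
      · exact Complex.continuous_im.comp_continuousOn ((hf.mono hSX).clog hsl)
    · intro z hz
      have := congrArg Complex.im (hD z (hSX hz))
      rw [this]; simp
  · intro S hSX hS hsl x hx y hy
    refine int_const_on hS (h := fun x => ((L x).im - (Complex.log (- f x)).im - Real.pi) / (2 * Real.pi)) ?_ ?_ hx hy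
    · refine ContinuousOn.div_const (ContinuousOn.sub (ContinuousOn.sub ?_ ?_) continuousOn_const) _
      · exact Complex.continuous_im.comp_continuousOn (hL.mono hSX)
      · exact Complex.continuous_im.comp_continuousOn ((hf.mono hSX).neg.clog hsl)
    · intro z hz
      have := congrArg Complex.im (hE z (hSX hz))
      rw [this]; simp
      field_simp
      ring
  · intro x hx him
    have h1 := congrArg Complex.im (hD x hx)
    have h2 := congrArg Complex.im (hE x hx)
    rw [h1] at h2
    simp [Complex.log_im, Complex.arg_neg_eq_arg_sub_pi_of_im_pos him] at h2
    exact h2.symm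
  · intro x hx him
    have h1 := congrArg Complex.im (hD x hx)
    have h2 := congrArg Complex.im (hE x hx)
    rw [h1] at h2
    simp [Complex.log_im, Complex.arg_neg_eq_arg_add_pi_of_im_neg him] at h2
    have h3 : (E x : ℝ) = D x - 1 := by
      have : 2 * Real.pi * ((E x : ℝ) - (D x - 1)) = 0 := by linarith
      rcases mul_eq_zero.mp this with h | h <;> linarith
    exact_mod_cast h3

lemma sign_const {S : Set ℝ} (hS : IsPreconnected S) {h : ℝ → ℝ} (hc : ContinuousOn h S)
    (hne : ∀ x ∈ S, h x ≠ 0) : (∀ x ∈ S, 0 < h x) ∨ (∀ x ∈ S, h x < 0) := by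
  by_contra hcon
  push Not at hcon
  obtain ⟨⟨a, ha, ha2⟩, ⟨b, hb, hb2⟩⟩ := hcon
  obtain ⟨z, hz, hz0⟩ := hS.intermediate_value ha hb hc (show (0:ℝ) ∈ Icc (h a) (h b) from ⟨ha2, hb2⟩)
  exact hne z hz hz0

namespace AdmissibleShearFlow
variable {U : ℝ → ℝ}

lemma signs_near (hU : AdmissibleShearFlow U) {y : ℝ} (hy : 0 < y) : ∃ ε > 0, ε ≤ y ∧
    ((∀ z ∈ Ioo (y - ε) y, 0 < iteratedDeriv 2 U z) ∨ (∀ z ∈ Ioo (y - ε) y, iteratedDeriv 2 U z < 0)) ∧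
    ((∀ z ∈ Ioo y (y + ε), 0 < iteratedDeriv 2 U z) ∨ (∀ z ∈ Ioo y (y + ε), iteratedDeriv 2 U z < 0)) := by
  have hfin := hU.finite_inflexions.subset (sdiff_subset (t := {y}))
  have hop := hfin.isClosed.isOpen_compl
  obtain ⟨ε, hε, hb⟩ := Metric.isOpen_iff.mp hop y (by simp)
  have key : ∀ z, 0 < z → z ≠ y → |z - y| < ε → iteratedDeriv 2 U z ≠ 0 := by
    intro z hz hzy hd h0
    have := hb (show z ∈ Metric.ball y ε by rw [Metric.mem_ball, Real.dist_eq]; exact hd)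
    exact this ⟨⟨hz, h0⟩, hzy⟩
  refine ⟨min ε y, lt_min hε hy, min_le_right _ _, ?_, ?_⟩
  · refine sign_const isPreconnected_Ioo hU.c2.continuousOn ?_
    rintro z ⟨h1, h2⟩
    have := min_le_left ε y
    have := min_le_right ε y
    exact key z (by linarith) h2.ne (by rw [abs_lt]; constructor <;> linarith)
  · refine sign_const isPreconnected_Ioo hU.c2.continuousOn ?_
    rintro z ⟨h1, h2⟩
    have := min_le_left ε y
    have := min_le_right ε y
    exact key z (by linarith) h1.ne' (by rw [abs_lt]; constructor <;> linarith)

lemma U_mem_XX (hU : AdmissibleShearFlow U) {y : ℝ} (hy : 0 < y) : (U y : ℂ) ∈ XX :=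
  Or.inr ⟨by simp, by simpa using hU.U_pos hy, by simpa using hU.U_lt_one hy.le⟩

lemma fXU_cont (hU : AdmissibleShearFlow U) : ContinuousOn (fun y : ℝ => fX U (U y)) (Ioi 0) :=
  hU.fX_cont.comp (Complex.continuous_ofReal.comp hU.c0).continuousOn (fun y hy => hU.U_mem_XX hy)

lemma image_pre (hU : AdmissibleShearFlow U) {a b : ℝ} : IsPreconnected ((fun y : ℝ => (U y : ℂ)) '' (Ioo a b)) :=
  isPreconnected_Ioo.image _ (Complex.continuous_ofReal.comp hU.c0).continuousOn

theorem exists_root (hU : AdmissibleShearFlow U) (hξ : xiEq U (deltaS U) = 0)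
    (hξpm : xiPlus U (deltaS U) < xiMinus U (deltaS U)) :
    ∃ μ0 : ℂ, 0 < μ0.im ∧ Phi U μ0 = ((deltaS U : ℝ) : ℂ) := by
  classical
  by_contra hcon
  push Not at hcon
  have hfinZ := hU.finite_inflexions
  have hne : ∀ x ∈ XX, fX U x ≠ 0 := by
    rintro x (hx | hx)
    · rw [hU.fX_H hx]; exact sub_ne_zero.mpr (hcon x hx)
    · obtain ⟨a, ha, rfl⟩ := mem_XX_real hx
      have ham : a ∈ U '' Ioi 0 := by rw [hU.image_U]; exact ha
      obtain ⟨y, hy, rfl⟩ := ham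
      have hy0 : 0 < y := hy
      intro h0
      have him := hU.fX_real_im hy0
      have hre := hU.fX_real_re hy0
      rw [h0] at him hre
      have h2 : iteratedDeriv 2 U y = 0 := by
        simpa [(hU.fac_pos hy0).ne'] using (mul_eq_zero.mp him.symm).resolve_left (hU.fac_pos hy0).ne'
      have h3 : chiAbscissa U y = deltaS U := by simp at hre; linarith
      rw [xiEq, Set.ncard_eq_zero (hfinZ.subset (fun z hz => ⟨hz.1, hz.2.1⟩))] at hξ
      have : y ∈ (∅ : Set ℝ) := by rw [← hξ]; exact ⟨hy0, h2, h3⟩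
      exact this
  have hp : Complex.I ∈ XX := Or.inl (by simp)
  obtain ⟨L, hLc, hL⟩ := exists_log XX_convex hU.fX_cont hne hp
  obtain ⟨D, E, hD, hE, hpos, hneg⟩ := exists_DE hU.fX_cont hLc hne hL
  set MM : Set ℝ := {y : ℝ | 0 < y ∧ iteratedDeriv 2 U y = 0 ∧ chiAbscissa U y < deltaS U ∧
    ∃ δ > (0:ℝ), (∀ z ∈ Ioo (y - δ) y, 0 < iteratedDeriv 2 U z) ∧
      (∀ z ∈ Ioo y (y + δ), iteratedDeriv 2 U z < 0)} with hMM
  set PP : Set ℝ := {y : ℝ | 0 < y ∧ iteratedDeriv 2 U y = 0 ∧ chiAbscissa U y < deltaS U ∧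
    ∃ δ > (0:ℝ), (∀ z ∈ Ioo (y - δ) y, iteratedDeriv 2 U z < 0) ∧
      (∀ z ∈ Ioo y (y + δ), 0 < iteratedDeriv 2 U z)} with hPP
  have hMc : MM.ncard = xiMinus U (deltaS U) := rfl
  have hPc : PP.ncard = xiPlus U (deltaS U) := rfl
  set Z : Finset ℝ := hfinZ.toFinset with hZ
  have hZm : ∀ y, y ∈ Z ↔ 0 < y ∧ iteratedDeriv 2 U y = 0 := by intro y; simp [hZ]
  have hMZ : MM ⊆ (Z : Set ℝ) := fun y hy => (hZm y).mpr ⟨hy.1, hy.2.1⟩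
  have hPZ : PP ⊆ (Z : Set ℝ) := fun y hy => (hZm y).mpr ⟨hy.1, hy.2.1⟩
  set j : ℝ → ℤ := fun y => (if y ∈ MM then 1 else 0) - (if y ∈ PP then 1 else 0) with hj
  have hsum : ∑ p ∈ Z, j p = (MM.ncard : ℤ) - PP.ncard := by
    have aux : ∀ A : Set ℝ, A ⊆ (Z : Set ℝ) → ∑ p ∈ Z, (if p ∈ A then (1:ℤ) else 0) = A.ncard := by
      intro A hA
      rw [Finset.sum_boole]
      have : A = ((Z.filter (· ∈ A) : Finset ℝ) : Set ℝ) := by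
        ext y; simp; exact fun h => hA h
      conv_rhs => rw [this, Set.ncard_coe_finset]
    have a := aux _ hMZ
    have b := aux _ hPZ
    rw [hj, Finset.sum_sub_distrib]
    convert congrArg₂ (· - ·) a b
  have imneg_slit : ∀ x, (fX U x).im < 0 → fX U x ∈ Complex.slitPlane := fun x h => Or.inr h.ne
  have him_iff : ∀ y, 0 < y → (0 < iteratedDeriv 2 U y → 0 < (fX U (U y)).im) ∧
      (iteratedDeriv 2 U y < 0 → (fX U (U y)).im < 0) := by
    intro y hy
    rw [hU.fX_real_im hy]
    exact ⟨fun h => mul_pos (hU.fac_pos hy) h, fun h => mul_neg_of_pos_of_neg (hU.fac_pos hy) h⟩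
  have hloc : ∀ y > 0, ∃ A : ℤ, ∃ ε > 0, (∀ z ∈ Ioo (y-ε) y, 0 < z → D (U z) = A) ∧
      (∀ z ∈ Ioo y (y+ε), D (U z) = A + j y) ∧ (y ∉ Z → D (U y) = A) := by
    intro y hy
    have hca : ContinuousAt (fun y : ℝ => fX U (U y)) y := hU.fXU_cont.continuousAt (Ioi_mem_nhds hy)
    by_cases hs : fX U (U y) ∈ Complex.slitPlane
    · have hev := hca.eventually (Complex.isOpen_slitPlane.mem_nhds hs)
      obtain ⟨ε, hε, hb⟩ := Metric.eventually_nhds_iff.mp hev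
      set ε' := min ε y
      have hε' : 0 < ε' := lt_min hε hy
      have l1 : ε' ≤ ε := min_le_left _ _
      have l2 : ε' ≤ y := min_le_right _ _
      have hconst := hD ((fun y : ℝ => (U y : ℂ)) '' (Ioo (y - ε') (y + ε')))
        (by rintro _ ⟨z, hz, rfl⟩; exact hU.U_mem_XX (by linarith [hz.1])) hU.image_pre
        (by
          rintro _ ⟨z, hz, rfl⟩
          refine hb ?_
          rw [Real.dist_eq, abs_lt]; constructor <;> linarith [hz.1, hz.2])
      have hj0 : j y = 0 := by
        have hcase : iteratedDeriv 2 U y = 0 → chiAbscissa U y < deltaS U → False := by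
          intro h1 h2
          rcases Complex.mem_slitPlane_iff.mp hs with h | h
          · rw [hU.fX_real_re hy] at h; linarith
          · rw [hU.fX_real_im hy, h1] at h; simp at h
        have h1 : y ∉ MM := fun h => hcase h.2.1 h.2.2.1
        have h2 : y ∉ PP := fun h => hcase h.2.1 h.2.2.1
        simp [hj, h1, h2]
      refine ⟨D (U y), ε', hε', ?_, ?_, fun _ => rfl⟩
      · intro z hz _
        exact hconst _ ⟨z, ⟨hz.1, by linarith [hz.2]⟩, rfl⟩ _ ⟨y, ⟨by linarith, by linarith⟩, rfl⟩
      · intro z hz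
        rw [hj0, add_zero]
        exact hconst _ ⟨z, ⟨by linarith [hz.1], hz.2⟩, rfl⟩ _ ⟨y, ⟨by linarith, by linarith⟩, rfl⟩
    · have hs' := hs
      rw [Complex.mem_slitPlane_iff] at hs'
      push Not at hs'
      obtain ⟨hre, him⟩ := hs'
      have hre' : (fX U (U y)).re < 0 := by
        refine lt_of_le_of_ne hre ?_
        intro h
        exact hne _ (hU.U_mem_XX hy) (Complex.ext h him)
      have h2z : iteratedDeriv 2 U y = 0 := by
        rw [hU.fX_real_im hy] at him
        exact (mul_eq_zero.mp him).resolve_left (hU.fac_pos hy).ne'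
      have hchi : chiAbscissa U y < deltaS U := by rw [hU.fX_real_re hy] at hre'; linarith
      have hyZ : y ∈ Z := (hZm y).mpr ⟨hy, h2z⟩
      have hev := hca.neg.eventually (Complex.isOpen_slitPlane.mem_nhds (show -fX U (U y) ∈ _ from Or.inl (by simpa using hre')))
      obtain ⟨ε1, hε1, hb⟩ := Metric.eventually_nhds_iff.mp hev
      obtain ⟨ε2, hε2, hεy2, hl, hr⟩ := hU.signs_near hy
      set ε' := min ε1 ε2
      have hε' : 0 < ε' := lt_min hε1 hε2
      have l1 : ε' ≤ ε1 := min_le_left _ _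
      have l2 : ε' ≤ ε2 := min_le_right _ _
      have hconst := hE ((fun y : ℝ => (U y : ℂ)) '' (Ioo (y - ε') (y + ε')))
        (by rintro _ ⟨z, hz, rfl⟩; exact hU.U_mem_XX (by linarith [hz.1])) hU.image_pre
        (by
          rintro _ ⟨z, hz, rfl⟩
          refine hb ?_
          rw [Real.dist_eq, abs_lt]; constructor <;> linarith [hz.1, hz.2])
      have hEc : ∀ z ∈ Ioo (y - ε') (y + ε'), E (U z) = E (U y) := fun z hz =>
        hconst _ ⟨z, hz, rfl⟩ _ ⟨y, ⟨by linarith, by linarith⟩, rfl⟩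
      have hDp : ∀ z ∈ Ioo (y - ε') (y + ε'), 0 < iteratedDeriv 2 U z → D (U z) = E (U y) := by
        intro z hz h
        have hz0 : 0 < z := by linarith [hz.1]
        rw [← hEc z hz, hpos _ (hU.U_mem_XX hz0) ((him_iff z hz0).1 h)]
      have hDn : ∀ z ∈ Ioo (y - ε') (y + ε'), iteratedDeriv 2 U z < 0 → D (U z) = E (U y) + 1 := by
        intro z hz h
        have hz0 : 0 < z := by linarith [hz.1]
        rw [← hEc z hz, hneg _ (hU.U_mem_XX hz0) ((him_iff z hz0).2 h)]; ring
      have wl : ∀ δ > (0:ℝ), ∃ z, z ∈ Ioo (y - δ) y ∧ z ∈ Ioo (y - ε2) y := fun δ hδ =>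
        ⟨y - min δ ε2 / 2, by
          have := min_le_left δ ε2
          have := min_le_right δ ε2
          have : 0 < min δ ε2 := lt_min hδ hε2
          constructor <;> constructor <;> linarith⟩
      have wr : ∀ δ > (0:ℝ), ∃ z, z ∈ Ioo y (y + δ) ∧ z ∈ Ioo y (y + ε2) := fun δ hδ =>
        ⟨y + min δ ε2 / 2, by
          have := min_le_left δ ε2
          have := min_le_right δ ε2
          have : 0 < min δ ε2 := lt_min hδ hε2
          constructor <;> constructor <;> linarith⟩
      have nonM1 : (∀ z ∈ Ioo (y - ε2) y, iteratedDeriv 2 U z < 0) → y ∉ MM := by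
        rintro h ⟨_, _, _, δ, hδ, h1, h2⟩
        obtain ⟨z, hz1, hz2⟩ := wl δ hδ
        linarith [h z hz2, h1 z hz1]
      have nonP1 : (∀ z ∈ Ioo (y - ε2) y, 0 < iteratedDeriv 2 U z) → y ∉ PP := by
        rintro h ⟨_, _, _, δ, hδ, h1, h2⟩
        obtain ⟨z, hz1, hz2⟩ := wl δ hδ
        linarith [h z hz2, h1 z hz1]
      have nonM2 : (∀ z ∈ Ioo y (y + ε2), 0 < iteratedDeriv 2 U z) → y ∉ MM := by
        rintro h ⟨_, _, _, δ, hδ, h1, h2⟩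
        obtain ⟨z, hz1, hz2⟩ := wr δ hδ
        linarith [h z hz2, h2 z hz1]
      have nonP2 : (∀ z ∈ Ioo y (y + ε2), iteratedDeriv 2 U z < 0) → y ∉ PP := by
        rintro h ⟨_, _, _, δ, hδ, h1, h2⟩
        obtain ⟨z, hz1, hz2⟩ := wr δ hδ
        linarith [h z hz2, h2 z hz1]
      have inl : ∀ z ∈ Ioo (y - ε') y, z ∈ Ioo (y - ε') (y + ε') ∧ z ∈ Ioo (y - ε2) y := fun z hz =>
        ⟨⟨hz.1, by linarith [hz.2]⟩, ⟨by linarith [hz.1], hz.2⟩⟩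
      have inr : ∀ z ∈ Ioo y (y + ε'), z ∈ Ioo (y - ε') (y + ε') ∧ z ∈ Ioo y (y + ε2) := fun z hz =>
        ⟨⟨by linarith [hz.1], hz.2⟩, ⟨hz.1, by linarith [hz.2]⟩⟩
      rcases hl with hl | hl <;> rcases hr with hr | hr
      · refine ⟨E (U y), ε', hε', fun z hz _ => hDp z (inl z hz).1 (hl z (inl z hz).2), fun z hz => ?_, fun h => absurd hyZ h⟩
        rw [hDp z (inr z hz).1 (hr z (inr z hz).2)]
        simp [hj, nonM2 hr, nonP1 hl]
      · refine ⟨E (U y), ε', hε', fun z hz _ => hDp z (inl z hz).1 (hl z (inl z hz).2), fun z hz => ?_, fun h => absurd hyZ h⟩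
        rw [hDn z (inr z hz).1 (hr z (inr z hz).2)]
        have : y ∈ MM := ⟨hy, h2z, hchi, ε2, hε2, hl, hr⟩
        simp [hj, this, nonP1 hl]
      · refine ⟨E (U y) + 1, ε', hε', fun z hz _ => hDn z (inl z hz).1 (hl z (inl z hz).2), fun z hz => ?_, fun h => absurd hyZ h⟩
        rw [hDp z (inr z hz).1 (hr z (inr z hz).2)]
        have : y ∈ PP := ⟨hy, h2z, hchi, ε2, hε2, hl, hr⟩
        simp [hj, this, nonM1 hl]
      · refine ⟨E (U y) + 1, ε', hε', fun z hz _ => hDn z (inl z hz).1 (hl z (inl z hz).2), fun z hz => ?_, fun h => absurd hyZ h⟩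
        rw [hDn z (inr z hz).1 (hr z (inr z hz).2)]
        simp [hj, nonM1 hl, nonP2 hr]
  -- chain around
  obtain ⟨δ0, hδ0, h0⟩ := hU.fX_near_zero
  obtain ⟨δ1, hδ1, h1⟩ := hU.fX_near_one
  have step : ∀ S : Set ℂ, Convex ℝ S → (∀ x ∈ S, x ∈ XX ∧ fX U x ∈ Complex.slitPlane) →
      ∀ x ∈ S, ∀ y ∈ S, D x = D y := fun S hS h x hx y hy =>
    hD S (fun z hz => (h z hz).1) hS.isPreconnected (fun z hz => (h z hz).2) x hx y hy
  have cH : Convex ℝ HH := convex_halfSpace_im_gt 0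
  have c1 := step (Metric.ball 0 δ0 ∩ XX) ((convex_ball _ _).inter XX_convex)
    (fun x hx => ⟨hx.2, h0 x hx.2 (by simpa using hx.1)⟩)
  have c2 := step ({z | z.re ≤ 0} ∩ HH) ((convex_halfSpace_re_le 0).inter cH)
    (fun x hx => ⟨Or.inl hx.2, imneg_slit _ (hU.fX_outer hx.2 (Or.inl hx.1))⟩)
  have c3 := step ({z | 1 ≤ z.im}) (convex_halfSpace_im_ge 1)
    (fun x hx => by
      have hx' : 1 ≤ x.im := hx
      have : 0 < x.im := by linarith
      exact ⟨Or.inl this, imneg_slit _ (hU.fX_outer this (Or.inr (Or.inr hx')))⟩)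
  have c4 := step ({z | 1 ≤ z.re} ∩ HH) ((convex_halfSpace_re_ge 1).inter cH)
    (fun x hx => ⟨Or.inl hx.2, imneg_slit _ (hU.fX_outer hx.2 (Or.inr (Or.inl hx.1)))⟩)
  have c5 := step (Metric.ball 1 δ1 ∩ XX) ((convex_ball _ _).inter XX_convex)
    (fun x hx => ⟨hx.2, imneg_slit _ (h1 x hx.2 (by simpa [dist_eq_norm] using hx.1))⟩)
  -- endpoints
  have ev2 : ∀ᶠ y in atTop, ‖(U y : ℂ) - 1‖ < δ1 := by
    have : Tendsto (fun y => (U y : ℂ) - 1) atTop (nhds 0) := by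
      have := ((Complex.continuous_ofReal.tendsto 1).comp hU.tendsto_one).sub_const (1:ℂ)
      simpa using this
    simpa using this.norm.eventually_lt_const (by simpa using hδ1)
  have ev2' : ∀ᶠ y in atTop, ∀ p ∈ Z, p < y := by
    rw [Filter.eventually_all_finset]
    intro p _
    exact eventually_gt_atTop p
  obtain ⟨y2, hy2, hy2Z, hy20⟩ := (ev2.and (ev2'.and (eventually_gt_atTop 0))).exists
  have ev1 : ∀ᶠ y in nhdsWithin (0:ℝ) (Ioi 0), ‖(U y : ℂ)‖ < δ0 := by
    have : Tendsto (fun y => (U y : ℂ)) (nhds 0) (nhds 0) := by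
      have := (Complex.continuous_ofReal.comp hU.c0).tendsto 0
      simpa [hU.zero_val, Function.comp_def] using this
    have := this.norm.eventually_lt_const (u := δ0) (by simpa using hδ0)
    exact this.filter_mono nhdsWithin_le_nhds
  have ev1' : ∀ᶠ y in nhdsWithin (0:ℝ) (Ioi 0), ∀ p ∈ Z, y < p := by
    rw [Filter.eventually_all_finset]
    intro p hp
    exact (Iio_mem_nhds ((hZm p).mp hp).1 |> (nhdsWithin_le_nhds ·))
  obtain ⟨y1, hy1, hy1Z, hy10⟩ := (ev1.and (ev1'.and self_mem_nhdsWithin)).exists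
  have hy10' : 0 < y1 := hy10
  have hjc := jump_count Z (fun y => D (U y)) j
    (fun y hy => by
      have a1 : y ∉ MM := fun h => hy (hMZ h)
      have a2 : y ∉ PP := fun h => hy (hPZ h)
      simp [hj, a1, a2]) hloc hy10' hy20 hy1Z hy2Z
  have n0 : ‖Complex.I * ((δ0/2 : ℝ) : ℂ)‖ < δ0 := by
    rw [norm_mul, Complex.norm_I, Complex.norm_real, Real.norm_eq_abs, abs_of_pos (by positivity)]; linarith
  have n1 : ‖Complex.I * ((δ1/2 : ℝ) : ℂ)‖ < δ1 := by
    rw [norm_mul, Complex.norm_I, Complex.norm_real, Real.norm_eq_abs, abs_of_pos (by positivity)]; linarith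
  have im0 : 0 < (Complex.I * ((δ0/2 : ℝ) : ℂ)).im := by simp; exact hδ0
  have im1 : 0 < (1 + Complex.I * ((δ1/2 : ℝ) : ℂ)).im := by simp; exact hδ1
  have e1 := c1 (U y1) ⟨by simpa using hy1, hU.U_mem_XX hy10'⟩ (Complex.I * ((δ0/2 : ℝ) : ℂ)) ⟨by simpa using n0, Or.inl im0⟩
  have e2 := c2 (Complex.I * ((δ0/2 : ℝ) : ℂ)) ⟨by simp, im0⟩ Complex.I ⟨by simp, by simp [HH]⟩
  have e3 := c3 Complex.I (by simp) (1 + Complex.I) (by simp)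
  have e4 := c4 (1 + Complex.I) ⟨by simp, by simp [HH]⟩ (1 + Complex.I * ((δ1/2 : ℝ) : ℂ)) ⟨by simp, im1⟩
  have e5 := c5 (1 + Complex.I * ((δ1/2 : ℝ) : ℂ)) ⟨by simpa [dist_eq_norm] using n1, Or.inl im1⟩ (U y2)
    ⟨by simpa [dist_eq_norm] using hy2, hU.U_mem_XX hy20⟩
  have : D (U y1) = D (U y2) := e1.trans (e2.trans (e3.trans (e4.trans e5)))
  rw [hsum] at hjc
  simp only [this, sub_self] at hjc
  omega

end AdmissibleShearFlow

set_option linter.unusedVariables false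

/-- Lebesgue measure on the half line -/
abbrev nuH : Measure ℝ := volume.restrict (Ioi (0:ℝ))
abbrev E1 : Type := Lp ℂ 1 nuH

/-- a linear-on-representatives rule yields a CLM on `L¹` -/
lemma exists_clm_of_rule (R : E1 → ℝ → ℂ) (hR : ∀ f, Integrable (R f) nuH)
    (hadd : ∀ f g, R (f + g) =ᵐ[nuH] R f + R g) (hsmul : ∀ (a : ℂ) f, R (a • f) =ᵐ[nuH] a • R f)
    {C : ℝ} (hC : 0 ≤ C) (hb : ∀ f : E1, ∫⁻ y, ‖R f y‖ₑ ∂nuH ≤ ENNReal.ofReal C * ∫⁻ y, ‖f y‖ₑ ∂nuH) :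
    ∃ T : E1 →L[ℂ] E1, ‖T‖ ≤ C ∧ ∀ f : E1, (T f : ℝ → ℂ) =ᵐ[nuH] R f := by
  let T0 : E1 →ₗ[ℂ] E1 :=
    { toFun := fun f => (hR f).toL1 (R f)
      map_add' := by
        intro f g
        rw [← Integrable.toL1_add, Integrable.toL1_eq_toL1_iff]
        exact hadd f g
      map_smul' := by
        intro a f
        rw [RingHom.id_apply, ← Integrable.toL1_smul, Integrable.toL1_eq_toL1_iff]
        exact hsmul a f }
  have hT0 : ∀ f, ‖T0 f‖ ≤ C * ‖f‖ := by
    intro f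
    have h1 : ENNReal.ofReal ‖T0 f‖ ≤ ENNReal.ofReal (C * ‖f‖) := by
      rw [ENNReal.ofReal_mul hC, L1.ofReal_norm_eq_lintegral, L1.ofReal_norm_eq_lintegral]
      refine le_trans (le_of_eq ?_) (hb f)
      refine lintegral_congr_ae ?_
      filter_upwards [(hR f).coeFn_toL1] with y hy
      show ‖((hR f).toL1 (R f) : ℝ → ℂ) y‖ₑ = _
      rw [hy]
    exact (ENNReal.ofReal_le_ofReal_iff (by positivity)).mp h1
  exact ⟨T0.mkContinuous C hT0, LinearMap.mkContinuous_norm_le _ hC _, fun f => (hR f).coeFn_toL1⟩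

/-- kernel operators -/
lemma exists_kernel_op {k : ℝ × ℝ → ℝ} (hk : Measurable k) {C : ℝ} (hC : 0 ≤ C)
    (hb : ∀ s, 0 < s → ∫⁻ y, ‖k (y, s)‖ₑ ∂nuH ≤ ENNReal.ofReal C) :
    ∃ T : E1 →L[ℂ] E1, ‖T‖ ≤ C ∧ ∀ f : E1, (T f : ℝ → ℂ) =ᵐ[nuH] fun y => ∫ s, (k (y, s) : ℂ) * f s ∂nuH := by
  have hm : ∀ f : E1, AEStronglyMeasurable (fun z : ℝ × ℝ => (k z : ℂ) * f z.2) (nuH.prod nuH) := fun f =>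
    (Complex.measurable_ofReal.comp hk).aestronglyMeasurable.mul (Lp.aestronglyMeasurable f).comp_snd
  have hl : ∀ f : E1, ∫⁻ z, ‖(k z : ℂ) * f z.2‖ₑ ∂(nuH.prod nuH) ≤ ENNReal.ofReal C * ∫⁻ y, ‖f y‖ₑ ∂nuH := by
    intro f
    rw [lintegral_prod_symm _ (hm f).enorm]
    calc ∫⁻ s, ∫⁻ y, ‖(k (y, s) : ℂ) * f s‖ₑ ∂nuH ∂nuH
        ≤ ∫⁻ s, ENNReal.ofReal C * ‖f s‖ₑ ∂nuH := by
          refine lintegral_mono_ae ?_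
          filter_upwards [ae_restrict_mem measurableSet_Ioi] with s hs
          simp only [enorm_mul]
          rw [lintegral_mul_const _ (by
            exact (Complex.measurable_ofReal.comp (hk.comp (measurable_id.prodMk measurable_const))).enorm)]
          gcongr
          simpa [← ofReal_norm] using hb s hs
      _ = _ := lintegral_const_mul' _ _ ENNReal.ofReal_ne_top
  have hfin : ∀ f : E1, ∫⁻ y, ‖f y‖ₑ ∂nuH < ⊤ := fun f => (L1.integrable_coeFn f).2
  have hi : ∀ f : E1, Integrable (fun z : ℝ × ℝ => (k z : ℂ) * f z.2) (nuH.prod nuH) := fun f =>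
    ⟨hm f, (hl f).trans_lt (ENNReal.mul_lt_top ENNReal.ofReal_lt_top (hfin f))⟩
  refine exists_clm_of_rule (fun f y => ∫ s, (k (y, s) : ℂ) * f s ∂nuH) (fun f => (hi f).integral_prod_left) ?_ ?_ hC ?_
  · intro f g
    filter_upwards [(hi f).prod_right_ae, (hi g).prod_right_ae] with y h1 h2
    rw [Pi.add_apply, ← integral_add h1 h2]
    refine integral_congr_ae ?_
    filter_upwards [Lp.coeFn_add f g] with s hs
    rw [hs, Pi.add_apply, mul_add]
  · intro a f
    refine Eventually.of_forall fun y => ?_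
    simp only [Pi.smul_apply]
    rw [← integral_smul]
    refine integral_congr_ae ?_
    filter_upwards [Lp.coeFn_smul a f] with s hs
    rw [hs, Pi.smul_apply, smul_eq_mul, smul_eq_mul]; ring
  · intro f
    refine le_trans ?_ (hl f)
    rw [lintegral_prod _ (hm f).enorm]
    exact lintegral_mono fun y => enorm_integral_le_lintegral_enorm _

/-- multiplication operators -/
lemma exists_mul_op {m : ℝ → ℂ} (hm : Measurable m) {C : ℝ} (hC : 0 ≤ C) (hb : ∀ s, 0 < s → ‖m s‖ ≤ C) :
    ∃ T : E1 →L[ℂ] E1, ‖T‖ ≤ C ∧ ∀ f : E1, (T f : ℝ → ℂ) =ᵐ[nuH] fun y => m y * f y := by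
  refine exists_clm_of_rule (fun f y => m y * f y) (fun f => ?_) ?_ ?_ hC ?_
  · exact (L1.integrable_coeFn f).bdd_mul hm.aestronglyMeasurable
      (by filter_upwards [ae_restrict_mem measurableSet_Ioi] with s hs using hb s hs)
  · intro f g
    filter_upwards [Lp.coeFn_add f g] with s hs
    rw [hs, Pi.add_apply, Pi.add_apply, mul_add]
  · intro a f
    filter_upwards [Lp.coeFn_smul a f] with s hs
    rw [hs, Pi.smul_apply, Pi.smul_apply, smul_eq_mul, smul_eq_mul]; ring
  · intro f
    rw [← lintegral_const_mul' _ _ ENNReal.ofReal_ne_top]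
    refine lintegral_mono_ae ?_
    filter_upwards [ae_restrict_mem measurableSet_Ioi] with s hs
    rw [enorm_mul]
    gcongr
    rw [← ofReal_norm]
    exact ENNReal.ofReal_le_ofReal (hb s hs)

lemma exists_integral_clm : ∃ I : E1 →L[ℂ] ℂ, ∀ f : E1, I f = ∫ y, f y ∂nuH := by
  refine ⟨LinearMap.mkContinuous ⟨⟨fun f => ∫ y, f y ∂nuH, ?_⟩, ?_⟩ 1 ?_, fun f => rfl⟩
  · intro f g
    rw [← integral_add (L1.integrable_coeFn f) (L1.integrable_coeFn g)]
    exact integral_congr_ae (Lp.coeFn_add f g)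
  · intro a f
    simp only [RingHom.id_apply]
    rw [← integral_smul]
    exact integral_congr_ae (Lp.coeFn_smul a f)
  · intro f
    rw [one_mul, L1.norm_eq_integral_norm]
    exact norm_integral_le_integral_norm _

/-! exponential kernels -/
lemma int_exp_abs {a : ℝ} (ha : 0 < a) : Integrable (fun t : ℝ => Real.exp (-a * |t|)) ∧
    ∫ t : ℝ, Real.exp (-a * |t|) = 2 / a := by
  have h1 : ∫ t : ℝ, Real.exp (-a * |t|) = 2 / a := by
    rw [integral_comp_abs (f := fun t => Real.exp (-a * t)), integral_exp_mul_Ioi (by linarith)]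
    simp; ring
  refine ⟨?_, h1⟩
  by_contra hc
  rw [integral_undef hc] at h1
  have : 0 < 2 / a := by positivity
  linarith

lemma int_exp_abs' {a : ℝ} (ha : 0 < a) (y : ℝ) : Integrable (fun s : ℝ => Real.exp (-a * |y - s|)) ∧
    ∫ s : ℝ, Real.exp (-a * |y - s|) = 2 / a := by
  obtain ⟨h1, h2⟩ := int_exp_abs ha
  refine ⟨h1.comp_sub_left y, ?_⟩
  rw [← h2]
  exact integral_sub_left_eq_self (fun t => Real.exp (-a * |t|)) volume y

/-- The Green kernel of `1 - ∂²/κ²` on the half line -/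
def gk (κ : ℝ) (y s : ℝ) : ℝ := κ / 2 * (Real.exp (-κ * |y - s|) - Real.exp (-κ * (y + s)))

lemma gk_nonneg {κ y s : ℝ} (hκ : 0 < κ) (hy : 0 ≤ y) (hs : 0 ≤ s) : 0 ≤ gk κ y s := by
  unfold gk
  have : |y - s| ≤ y + s := by rw [abs_le]; constructor <;> linarith
  have : Real.exp (-κ * (y + s)) ≤ Real.exp (-κ * |y - s|) := by
    apply Real.exp_le_exp.mpr; nlinarith
  have : 0 ≤ Real.exp (-κ * |y - s|) - Real.exp (-κ * (y + s)) := by linarith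
  positivity

lemma gk_le {κ y s : ℝ} (hκ : 0 < κ) : gk κ y s ≤ κ / 2 * Real.exp (-κ * |y - s|) := by
  unfold gk
  have := Real.exp_pos (-κ * (y + s))
  have : 0 < κ / 2 := by linarith
  nlinarith

lemma gk_cont (κ : ℝ) : Continuous (fun z : ℝ × ℝ => gk κ z.1 z.2) := by unfold gk; fun_prop


set_option linter.unusedVariables false

namespace AdmissibleShearFlow
variable {U : ℝ → ℝ}

lemma U_lip (hU : AdmissibleShearFlow U) {M : ℝ} (hM : ∀ y, 0 ≤ y → deriv U y ≤ M) {y s : ℝ} (hy : 0 ≤ y) (hs : 0 ≤ s) :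
    |U y - U s| ≤ M * |y - s| := by
  have := (convex_Ici (0:ℝ)).norm_image_sub_le_of_norm_deriv_le (f := U) (C := M) (fun x _ => (hU.hd0 x).differentiableAt)
    (fun x hx => by rw [Real.norm_eq_abs, abs_of_pos (hU.deriv_pos x hx)]; exact hM x hx) hs hy
  simpa using this

/-- the weighted Green kernel -/
def wk (U : ℝ → ℝ) (N κ : ℝ) (z : ℝ × ℝ) : ℝ := gk κ z.1 z.2 * Real.exp (-N * (U z.1 - U z.2))

lemma wk_cont (hU : AdmissibleShearFlow U) (N κ : ℝ) : Continuous (wk U N κ) := by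
  have := hU.c0
  unfold wk
  exact (gk_cont κ).mul (by fun_prop)

lemma wk_bound (hU : AdmissibleShearFlow U) {M : ℝ} (hM : ∀ y, 0 ≤ y → deriv U y ≤ M) {N κ : ℝ} (hN : 0 ≤ N)
    (hκ : 0 < κ) {y s : ℝ} (hy : 0 ≤ y) (hs : 0 ≤ s) :
    |wk U N κ (y, s)| ≤ κ / 2 * Real.exp (-(κ - N * M) * |s - y|) := by
  have h1 := gk_nonneg hκ hy hs
  have h2 := gk_le (y := y) (s := s) hκ
  have h3 := hU.U_lip hM hy hs
  unfold wk
  simp only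
  rw [abs_of_nonneg (by positivity)]
  calc gk κ y s * Real.exp (-N * (U y - U s)) ≤ (κ / 2 * Real.exp (-κ * |y - s|)) * Real.exp (N * M * |y - s|) := by
        refine mul_le_mul h2 (Real.exp_le_exp.mpr ?_) (Real.exp_pos _).le (by positivity)
        have := mul_le_mul_of_nonneg_left (neg_le_of_abs_le h3) hN
        linarith
    _ = _ := by
        rw [mul_assoc, ← Real.exp_add, abs_sub_comm]; ring_nf

lemma exists_S (hU : AdmissibleShearFlow U) {M : ℝ} (hM : ∀ y, 0 ≤ y → deriv U y ≤ M) {N κ : ℝ} (hN : 0 ≤ N)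
    (hκ : 0 < κ) (hNM : N * M < κ) : ∃ S : E1 →L[ℂ] E1, ‖S‖ ≤ κ / (κ - N * M) ∧
      ∀ f : E1, (S f : ℝ → ℂ) =ᵐ[nuH] fun y => ∫ s, (wk U N κ (y, s) : ℂ) * f s ∂nuH := by
  have hd : 0 < κ - N * M := by linarith
  refine exists_kernel_op (hU.wk_cont N κ).measurable (by positivity) ?_
  intro s hs
  obtain ⟨i1, i2⟩ := int_exp_abs' hd s
  calc ∫⁻ y, ‖wk U N κ (y, s)‖ₑ ∂nuH ≤ ∫⁻ y, ENNReal.ofReal (κ / 2 * Real.exp (-(κ - N * M) * |s - y|)) ∂nuH := by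
        refine lintegral_mono_ae ?_
        filter_upwards [ae_restrict_mem measurableSet_Ioi] with y hy
        rw [← ofReal_norm]
        exact ENNReal.ofReal_le_ofReal (hU.wk_bound hM hN hκ (le_of_lt hy) hs.le)
    _ ≤ ∫⁻ y, ENNReal.ofReal (κ / 2 * Real.exp (-(κ - N * M) * |s - y|)) := setLIntegral_le_lintegral _ _
    _ = ENNReal.ofReal (∫ y, κ / 2 * Real.exp (-(κ - N * M) * |s - y|)) := by
        rw [ofReal_integral_eq_lintegral_ofReal (i1.const_mul _) (Eventually.of_forall fun y => by positivity)]
    _ = _ := by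
        rw [integral_const_mul, i2]; congr 1; field_simp

/-- pointwise convergence of the Green operator -/
lemma gk_pointwise {κ : ℕ → ℝ} (hκ : Tendsto κ atTop atTop) {G : ℝ → ℂ} (hG : Continuous G) (hc : HasCompactSupport G)
    {y : ℝ} (hy : 0 < y) : Tendsto (fun n => ∫ s, (gk (κ n) y s : ℂ) * G s ∂nuH) atTop (nhds (G y)) := by
  have hφ0 : ∀ x : ℝ, 0 ≤ 1 / 2 * Real.exp (-1 * |x|) := fun x => by positivity
  have hφ1 : ∫ x : ℝ, 1 / 2 * Real.exp (-1 * |x|) = 1 := by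
    rw [integral_const_mul, (int_exp_abs one_pos).2]; norm_num
  have hφ2 : Tendsto (fun x : ℝ => ‖x‖ ^ Module.finrank ℝ ℝ * (1 / 2 * Real.exp (-1 * |x|))) (Bornology.cobounded ℝ) (nhds 0) := by
    have h1 : Tendsto (fun x : ℝ => 1 / 2 * (x ^ 1 * Real.exp (-x))) atTop (nhds 0) := by
      have := (Real.tendsto_pow_mul_exp_neg_atTop_nhds_zero 1).const_mul (1/2)
      rwa [mul_zero] at this
    have h2 := h1.comp (tendsto_norm_cobounded_atTop (E := ℝ))
    refine h2.congr fun x => ?_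
    simp; ring
  have hGi : Integrable G := hG.integrable_of_hasCompactSupport hc
  have hHi : Integrable ((Ioi (0:ℝ)).indicator G) := hGi.indicator measurableSet_Ioi
  have hHc : ContinuousAt ((Ioi (0:ℝ)).indicator G) y := by
    refine hG.continuousAt.congr ?_
    filter_upwards [Ioi_mem_nhds hy] with z hz
    rw [indicator_of_mem hz]
  have key := (tendsto_integral_comp_smul_smul_of_integrable' (μ := volume) hφ0 hφ1 hφ2 hHi hHc).comp hκ
  rw [indicator_of_mem (show y ∈ Ioi (0:ℝ) from hy)] at key
  obtain ⟨A, hA⟩ := hc.exists_bound_of_continuous hG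
  have second : Tendsto (fun n => (Real.exp (-(κ n) * y) : ℂ) * ∫ s, ((κ n / 2 * Real.exp (-(κ n) * s) : ℝ) : ℂ) * G s ∂nuH)
      atTop (nhds 0) := by
    have hbd : ∀ᶠ n in atTop, ‖(Real.exp (-(κ n) * y) : ℂ) * ∫ s, ((κ n / 2 * Real.exp (-(κ n) * s) : ℝ) : ℂ) * G s ∂nuH‖
        ≤ Real.exp (-(κ n) * y) * (A / 2) := by
      filter_upwards [hκ.eventually_gt_atTop 0] with n hn
      rw [norm_mul, Complex.norm_real, Real.norm_of_nonneg (Real.exp_pos _).le]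
      gcongr
      have hintg : IntegrableOn (fun s => κ n / 2 * Real.exp (-(κ n) * s) * A) (Ioi 0) :=
        ((integrableOn_exp_mul_Ioi (by linarith) 0).const_mul _).mul_const _
      refine (norm_integral_le_of_norm_le hintg (Eventually.of_forall fun s => ?_)).trans ?_
      · rw [norm_mul, Complex.norm_real, Real.norm_of_nonneg (by positivity)]
        gcongr
        exact hA s
      · rw [integral_mul_const, integral_const_mul, integral_exp_mul_Ioi (by linarith)]
        apply le_of_eq
        simp
        field_simp
    refine squeeze_zero_norm' hbd ?_
    have : Tendsto (fun n => -(κ n) * y) atTop atBot := (tendsto_neg_atTop_atBot.comp hκ).atBot_mul_const hy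
    simpa using (Real.tendsto_exp_atBot.comp this).mul_const (A/2)
  have := key.sub second
  rw [sub_zero] at this
  refine this.congr' ?_
  filter_upwards [hκ.eventually_gt_atTop 0] with n hn
  simp only [Function.comp]
  rw [← integral_const_mul]
  have e1 : (∫ x, (κ n ^ Module.finrank ℝ ℝ * (1 / 2 * Real.exp (-1 * |κ n • (y - x)|))) • (Ioi (0:ℝ)).indicator G x)
      = ∫ s, ((κ n / 2 * Real.exp (-(κ n) * |y - s|) : ℝ) : ℂ) * G s ∂nuH := by
    rw [← integral_indicator measurableSet_Ioi]
    refine integral_congr_ae (Eventually.of_forall fun x => ?_)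
    by_cases hx : x ∈ Ioi (0:ℝ)
    · simp only [indicator_of_mem hx, Module.finrank_self, pow_one, smul_eq_mul, abs_mul, abs_of_pos hn]
      rw [Complex.real_smul]
      congr 2
      rw [show -κ n * |y - x| = -1 * (κ n * |y - x|) by ring]; ring
    · simp [indicator_of_notMem hx]
  rw [e1, ← integral_sub]
  · refine integral_congr_ae (Eventually.of_forall fun s => ?_)
    simp only [gk]
    rw [show -κ n * (y + s) = -κ n * y + -κ n * s by ring, Real.exp_add]
    push_cast
    ring
  · have : Integrable (fun s => ((κ n / 2 * Real.exp (-(κ n) * |y - s|) : ℝ) : ℂ) * G s) volume := by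
      refine Continuous.integrable_of_hasCompactSupport (by fun_prop) ?_
      exact hc.mul_left
    exact this.restrict
  · have : Integrable (fun s => (Real.exp (-(κ n) * y) : ℂ) * (((κ n / 2 * Real.exp (-(κ n) * s) : ℝ) : ℂ) * G s)) volume := by
      refine Continuous.integrable_of_hasCompactSupport (by fun_prop) ?_
      exact hc.mul_left.mul_left
    exact this.restrict

lemma gk_dom {κ : ℝ} (hκ : 2 ≤ κ) {G : ℝ → ℂ} {A : ℝ} (hA : ∀ s, ‖G s‖ ≤ A * Real.exp (-s))
    {y : ℝ} (hy : 0 < y) : ‖∫ s, (gk κ y s : ℂ) * G s ∂nuH‖ ≤ 2 * A * Real.exp (-y) := by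
  have hA0 : 0 ≤ A := by
    have := (norm_nonneg _).trans (hA 0)
    simpa using this
  have hκ1 : 0 < κ - 1 := by linarith
  obtain ⟨i1, i2⟩ := int_exp_abs' hκ1 y
  have hintg := (i1.const_mul (κ / 2)).mul_const (A * Real.exp (-y))
  refine (norm_integral_le_of_norm_le hintg.restrict ?_).trans ?_
  · filter_upwards [ae_restrict_mem measurableSet_Ioi] with s hs
    have hs0 : 0 < s := hs
    rw [norm_mul, Complex.norm_real, Real.norm_of_nonneg (gk_nonneg (by linarith) hy.le hs0.le)]
    calc gk κ y s * ‖G s‖ ≤ (κ / 2 * Real.exp (-κ * |y - s|)) * (A * (Real.exp (-y) * Real.exp |y - s|)) := by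
          refine mul_le_mul (gk_le (by linarith)) ((hA s).trans ?_) (norm_nonneg _) (by positivity)
          rw [← Real.exp_add]
          gcongr
          linarith [le_abs_self (y - s)]
      _ = _ := by
          rw [show -(κ - 1) * |y - s| = -κ * |y - s| + |y - s| by ring, Real.exp_add]; ring
  · refine (setIntegral_le_integral hintg (Eventually.of_forall fun s => ?_)).trans ?_
    · simp only [Pi.zero_apply]; positivity
    rw [integral_mul_const, integral_const_mul, i2]
    have : κ / 2 * (2 / (κ - 1)) ≤ 2 := by
      rw [div_mul_div_comm, div_le_iff₀ (by positivity)]; linarith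
    calc _ ≤ 2 * (A * Real.exp (-y)) := by gcongr
      _ = _ := by ring

end AdmissibleShearFlow

set_option linter.unusedVariables false

namespace AdmissibleShearFlow
variable {U : ℝ → ℝ}

lemma S_strong (hU : AdmissibleShearFlow U) {N : ℝ} {κ : ℕ → ℝ} (hκ : Tendsto κ atTop atTop)
    {S : ℕ → E1 →L[ℂ] E1} (hSn : ∀ᶠ n in atTop, ‖S n‖ ≤ 2)
    (hS : ∀ᶠ n in atTop, ∀ f : E1, (S n f : ℝ → ℂ) =ᵐ[nuH] fun y => ∫ s, (wk U N (κ n) (y, s) : ℂ) * f s ∂nuH)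
    (q : E1) : Tendsto (fun n => S n q) atTop (nhds q) := by
  have hc0 := hU.c0
  -- first for continuous compactly supported functions
  have step : ∀ g : ℝ → ℂ, HasCompactSupport g → Continuous g → ∀ gi : Integrable g nuH,
      Tendsto (fun n => S n (gi.toL1 g)) atTop (nhds (gi.toL1 g)) := by
    intro g hgc hg gi
    set G : ℝ → ℂ := fun s => ((Real.exp (N * U s) : ℝ) : ℂ) * g s with hGdef
    have hGc : Continuous G := by fun_prop
    have hGs : HasCompactSupport G := hgc.mul_left
    obtain ⟨A, hA⟩ := (show HasCompactSupport (fun s => ((Real.exp s : ℝ) : ℂ) * G s) from hGs.mul_left).exists_bound_of_continuous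
      (by fun_prop)
    have hA' : ∀ s, ‖G s‖ ≤ A * Real.exp (-s) := by
      intro s
      have := hA s
      rw [norm_mul, Complex.norm_real, Real.norm_of_nonneg (Real.exp_pos _).le] at this
      rw [Real.exp_neg, ← div_eq_mul_inv, le_div_iff₀ (Real.exp_pos _)]
      linarith
    have hA0 : 0 ≤ A := (norm_nonneg _).trans (hA 0)
    have hform : ∀ᶠ n in atTop, ‖S n (gi.toL1 g) - gi.toL1 g‖ =
        ∫ y, ‖((Real.exp (-N * U y) : ℝ) : ℂ) * ((∫ s, (gk (κ n) y s : ℂ) * G s ∂nuH) - G y)‖ ∂nuH := by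
      filter_upwards [hS] with n hn
      rw [L1.norm_eq_integral_norm]
      refine integral_congr_ae ?_
      filter_upwards [Lp.coeFn_sub (S n (gi.toL1 g)) (gi.toL1 g), hn (gi.toL1 g), gi.coeFn_toL1] with y h1 h2 h3
      rw [h1, Pi.sub_apply, h2, h3]
      congr 1
      rw [mul_sub, ← integral_const_mul]
      congr 1
      · refine integral_congr_ae ?_
        filter_upwards [gi.coeFn_toL1] with s hs
        rw [hs, hGdef]
        simp only [wk]
        rw [show -N * (U y - U s) = -N * U y + N * U s by ring, Real.exp_add]
        push_cast; ring
      · rw [hGdef]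
        simp only
        rw [← mul_assoc, ← Complex.ofReal_mul, ← Real.exp_add]
        simp
    rw [tendsto_iff_norm_sub_tendsto_zero]
    refine Tendsto.congr' (EventuallyEq.symm hform) ?_
    have hlim : Tendsto (fun n => ∫ y, ‖((Real.exp (-N * U y) : ℝ) : ℂ) * ((∫ s, (gk (κ n) y s : ℂ) * G s ∂nuH) - G y)‖ ∂nuH)
        atTop (nhds (∫ y, (0:ℝ) ∂nuH)) := by
      refine tendsto_integral_filter_of_dominated_convergence
        (fun y => Real.exp |N| * (2 * A * Real.exp (-y) + A * Real.exp (-y))) ?_ ?_ ?_ ?_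
      · refine Eventually.of_forall fun n => ?_
        refine AEStronglyMeasurable.norm ?_
        refine AEStronglyMeasurable.mul (by fun_prop) (AEStronglyMeasurable.sub ?_ (by fun_prop))
        have : StronglyMeasurable (fun z : ℝ × ℝ => (gk (κ n) z.1 z.2 : ℂ) * G z.2) := by
          refine Continuous.stronglyMeasurable ?_
          exact (Complex.continuous_ofReal.comp (gk_cont (κ n))).mul (by fun_prop)
        exact this.integral_prod_right.aestronglyMeasurable
      · filter_upwards [hκ.eventually_ge_atTop 2] with n hn
        filter_upwards [ae_restrict_mem measurableSet_Ioi] with y hy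
        rw [norm_norm, norm_mul, Complex.norm_real, Real.norm_of_nonneg (Real.exp_pos _).le]
        refine mul_le_mul (Real.exp_le_exp.mpr ?_) ((norm_sub_le _ _).trans (add_le_add (gk_dom hn hA' hy) (hA' y)))
          (norm_nonneg _) (Real.exp_pos _).le
        have h1 := hU.U_nonneg (le_of_lt hy)
        have h2 := (hU.U_lt_one (le_of_lt hy)).le
        nlinarith [neg_abs_le N, abs_nonneg N]
      · have : IntegrableOn (fun y : ℝ => Real.exp (-1 * y)) (Ioi 0) := integrableOn_exp_mul_Ioi (by norm_num) 0
        have h2 : Integrable (fun y : ℝ => Real.exp (-y)) nuH := by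
          simp only [neg_mul, one_mul] at this
          exact this
        exact ((h2.const_mul _).add (h2.const_mul _)).const_mul _
      · filter_upwards [ae_restrict_mem measurableSet_Ioi] with y hy
        have := ((gk_pointwise hκ hGc hGs hy).sub_const (G y)).const_mul ((Real.exp (-N * U y) : ℝ) : ℂ)
        simpa using this.norm
    simpa using hlim
  rw [Metric.tendsto_atTop']
  intro ε hε
  obtain ⟨g, hgc, hge, hg, gi⟩ := (L1.integrable_coeFn q).exists_hasCompactSupport_integral_sub_le (show 0 < ε / 8 by positivity)
  have h1 := (Metric.tendsto_nhds.mp (step g hgc hg gi)) (ε/8) (by positivity)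
  have hd : ‖q - gi.toL1 g‖ ≤ ε / 8 := by
    rw [L1.norm_eq_integral_norm]
    refine le_trans (le_of_eq ?_) hge
    refine integral_congr_ae ?_
    filter_upwards [Lp.coeFn_sub q (gi.toL1 g), gi.coeFn_toL1] with y h1 h3
    rw [h1, Pi.sub_apply, h3]
  obtain ⟨n0, hn0⟩ := (hSn.and h1).exists_forall_of_atTop
  refine ⟨n0, fun n hn => ?_⟩
  obtain ⟨hs2, hs1⟩ := hn0 n hn.le
  rw [dist_eq_norm] at hs1 ⊢
  have e : S n q - q = S n (q - gi.toL1 g) + (S n (gi.toL1 g) - gi.toL1 g) - (q - gi.toL1 g) := by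
    rw [map_sub]; abel
  rw [e]
  have := (S n).le_opNorm (q - gi.toL1 g)
  have : ‖S n (q - gi.toL1 g)‖ ≤ 2 * (ε / 8) := this.trans (mul_le_mul hs2 hd (norm_nonneg _) (by norm_num))
  have t1 := norm_sub_le (S n (q - gi.toL1 g) + (S n (gi.toL1 g) - gi.toL1 g)) (q - gi.toL1 g)
  have t2 := norm_add_le (S n (q - gi.toL1 g)) (S n (gi.toL1 g) - gi.toL1 g)
  linarith

/-- the nonlocal operator -/
def kk (U : ℝ → ℝ) (N : ℝ) (z : ℝ × ℝ) : ℝ :=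
  if z.2 < z.1 then deriv U z.1 * Real.exp (-N * (U z.1 - U z.2)) else 0

lemma exists_K (hU : AdmissibleShearFlow U) {N : ℝ} (hN : 0 < N) : ∃ T : E1 →L[ℂ] E1, ‖T‖ ≤ 1 / N ∧
      ∀ f : E1, (T f : ℝ → ℂ) =ᵐ[nuH] fun y => ∫ s, (kk U N (y, s) : ℂ) * f s ∂nuH := by
  have hc0 := hU.c0
  have hc1 := hU.c1
  refine exists_kernel_op ?_ (by positivity) ?_
  · refine Measurable.ite (measurableSet_lt measurable_snd measurable_fst) ?_ measurable_const
    refine Continuous.measurable ?_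
    fun_prop
  · intro s hs
    have hnn : ∀ y ∈ Ioi s, 0 ≤ deriv U y * Real.exp (-N * (U y - U s)) := fun y hy =>
      mul_nonneg (hU.deriv_pos y (hs.le.trans (le_of_lt hy))).le (Real.exp_pos _).le
    have hder : ∀ y ∈ Ici s, HasDerivAt (fun y => -(1 / N) * Real.exp (-N * (U y - U s)))
        (deriv U y * Real.exp (-N * (U y - U s))) y := by
      intro y hy
      have := ((((hU.hd0 y).sub_const (U s)).const_mul (-N)).exp).const_mul (-(1/N))
      refine this.congr_deriv ?_
      field_simp
    have hlim : Tendsto (fun y => -(1 / N) * Real.exp (-N * (U y - U s))) atTop (nhds (-(1 / N) * Real.exp (-N * (1 - U s)))) := by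
      have := ((hU.tendsto_one.sub_const (U s)).const_mul (-N))
      exact ((Real.continuous_exp.tendsto _).comp this).const_mul _
    have hi := integrableOn_Ioi_deriv_of_nonneg' hder hnn hlim
    have hv := integral_Ioi_of_hasDerivAt_of_nonneg' hder hnn hlim
    have : ∫⁻ y, ‖kk U N (y, s)‖ₑ ∂nuH ≤ ∫⁻ y in Ioi s, ENNReal.ofReal (deriv U y * Real.exp (-N * (U y - U s))) := by
      refine (setLIntegral_le_lintegral _ _).trans ?_
      rw [← lintegral_indicator measurableSet_Ioi]
      refine lintegral_mono fun y => ?_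
      by_cases hy : y ∈ Ioi s
      · rw [indicator_of_mem hy, ← ofReal_norm]
        apply ENNReal.ofReal_le_ofReal
        simp only [kk]
        rw [if_pos (show s < y from hy), Real.norm_of_nonneg (hnn y hy)]
      · rw [indicator_of_notMem hy]
        simp only [kk]
        rw [if_neg (show ¬ s < y from hy)]; simp
    refine this.trans ?_
    rw [← ofReal_integral_eq_lintegral_ofReal hi ((ae_restrict_mem measurableSet_Ioi).mono hnn), hv]
    apply ENNReal.ofReal_le_ofReal
    have := Real.exp_pos (-N * (1 - U s))
    have : 0 ≤ 1 / N * Real.exp (-N * (1 - U s)) := by positivity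
    simp
    simpa using this

end AdmissibleShearFlow

set_option linter.unusedVariables false

namespace AdmissibleShearFlow
variable {U : ℝ → ℝ}

lemma inviscid (hU : AdmissibleShearFlow U) {μ : ℂ} (hμ : 0 < μ.im) : ∃ v : ℝ → ℂ, Continuous v ∧
    Integrable v nuH ∧ (∀ y, (μ - (U y : ℂ)) * v y + ((deriv U y : ℝ) : ℂ) * (∫ s in (0:ℝ)..y, v s) = (srcF U y : ℂ)) ∧
    ∫ y, v y ∂nuH = PhiInv U μ := by
  have hc0 := hU.c0
  have hc1 := hU.c1
  have hcF := hU.cF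
  have hne : ∀ y, μ - (U y : ℂ) ≠ 0 := fun y => sub_ne hμ _
  set h : ℝ → ℂ := fun y => (srcF U y : ℂ) / (μ - (U y : ℂ)) ^ 2 with hh
  have hhc : Continuous h := by
    refine Continuous.div (by fun_prop) (by fun_prop) (fun y => pow_ne_zero 2 (hne y))
  have hhi : IntegrableOn h (Ioi 0) := hU.int_F_div hμ
  set P : ℝ → ℂ := fun y => ∫ s in (0:ℝ)..y, h s with hP
  have hPd : ∀ y, HasDerivAt P (h y) y := fun y => intervalIntegral.integral_hasDerivAt_right
    (hhc.intervalIntegrable _ _) (hhc.stronglyMeasurableAtFilter _ _) hhc.continuousAt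
  have hPc : Continuous P := continuous_iff_continuousAt.mpr fun y => (hPd y).continuousAt
  have hPlim : Tendsto P atTop (nhds (∫ y in Ioi 0, h y)) :=
    intervalIntegral_tendsto_integral_Ioi 0 hhi tendsto_id
  set v : ℝ → ℂ := fun y => (μ - (U y : ℂ)) * h y - ((deriv U y : ℝ) : ℂ) * P y with hv
  have hvc : Continuous v := by fun_prop
  have hφd : ∀ y, HasDerivAt (fun y => (μ - (U y : ℂ)) * P y) (v y) y := by
    intro y
    have := (((hU.hd0 y).ofReal_comp).const_sub μ).mul (hPd y)
    refine this.congr_deriv ?_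
    simp only [hv]; ring
  have hintg : ∀ y, ∫ s in (0:ℝ)..y, v s = (μ - (U y : ℂ)) * P y := by
    intro y
    rw [intervalIntegral.integral_eq_sub_of_hasDerivAt (fun x _ => hφd x) (hvc.intervalIntegrable _ _)]
    simp [hP]
  have hPb : ∀ y, 0 < y → ‖P y‖ ≤ ∫ y in Ioi 0, ‖h y‖ := by
    intro y hy
    rw [hP]
    simp only
    rw [intervalIntegral.integral_of_le hy.le]
    refine (norm_integral_le_integral_norm _).trans ?_
    refine setIntegral_mono_set hhi.norm (Eventually.of_forall fun _ => norm_nonneg _) ?_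
    exact (Ioc_subset_Ioi_self).eventuallyLE
  have hvi : Integrable v nuH := by
    refine Integrable.sub ?_ ?_
    · refine hhi.bdd_mul (c := ‖μ‖ + 1) (by fun_prop) ?_
      filter_upwards [ae_restrict_mem measurableSet_Ioi] with y hy
      refine (norm_sub_le _ _).trans ?_
      rw [Complex.norm_real, Real.norm_of_nonneg (hU.U_nonneg (le_of_lt hy))]
      linarith [hU.U_lt_one (le_of_lt hy)]
    · refine Integrable.mul_bdd (c := ∫ y in Ioi 0, ‖h y‖) hU.int_U'.ofReal (by fun_prop) ?_
      filter_upwards [ae_restrict_mem measurableSet_Ioi] with y hy using hPb y hy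
  refine ⟨v, hvc, hvi, ?_, ?_⟩
  · intro y
    rw [hintg y]
    simp only [hv, hh]
    have := hne y
    field_simp
    ring
  · have hl : Tendsto (fun y => (μ - (U y : ℂ)) * P y) atTop (nhds ((μ - 1) * ∫ y in Ioi 0, h y)) := by
      refine Tendsto.mul ?_ hPlim
      have := ((Complex.continuous_ofReal.tendsto 1).comp hU.tendsto_one).const_sub μ
      simpa using this
    have := integral_Ioi_of_hasDerivAt_of_tendsto' (a := 0) (fun x _ => hφd x) hvi hl
    rw [this, PhiInv]
    have hP0 : P 0 = 0 := by simp [hP]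
    rw [hP0, mul_zero, sub_zero]

lemma kk_int (hU : AdmissibleShearFlow U) {N : ℝ} {f v : ℝ → ℂ}
    (hf : f =ᵐ[nuH] fun y => ((Real.exp (-N * U y) : ℝ) : ℂ) * v y) {y : ℝ} (hy : 0 < y) :
    ∫ s, (kk U N (y, s) : ℂ) * f s ∂nuH = ((Real.exp (-N * U y) : ℝ) : ℂ) * (((deriv U y : ℝ) : ℂ) * ∫ s in (0:ℝ)..y, v s) := by
  rw [intervalIntegral.integral_of_le hy.le, integral_Ioc_eq_integral_Ioo, ← mul_assoc, ← integral_const_mul,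
    show Ioo 0 y = Iio y ∩ Ioi 0 by ext; simp [and_comm], ← Measure.restrict_restrict measurableSet_Iio,
    ← integral_indicator measurableSet_Iio]
  refine integral_congr_ae ?_
  filter_upwards [hf] with s hs
  by_cases h : s ∈ Iio y
  · rw [indicator_of_mem h, hs]
    simp only [kk]
    rw [if_pos (show s < y from h), show -N * (U y - U s) = -N * U y + -(-N * U s) by ring, Real.exp_add, Real.exp_neg (-N * U s)]
    push_cast
    have := Complex.exp_ne_zero (-N * U s)
    field_simp
  · rw [indicator_of_notMem h]
    simp only [kk]
    rw [if_neg (show ¬ s < y from h)]; simp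

/-- right-hand side of the fixed point problem -/
def fvis (U : ℝ → ℝ) (μ : ℂ) (c : ℝ) (v : ℝ → ℂ) (s : ℝ) : ℂ :=
  v s + Complex.I / c * ((μ - (U s : ℂ)) * v s + ((deriv U s : ℝ) : ℂ) * (∫ t in (0:ℝ)..s, v t) - (srcF U s : ℂ))

lemma exists_B (hU : AdmissibleShearFlow U) {N c r : ℝ} (hN : 0 < N) (hc : 0 < c) (hr : 0 < r) :
    ∃ B : ℂ → E1 →L[ℂ] E1, Differentiable ℂ B ∧
      (∀ μ, ‖μ - Complex.I * c‖ ≤ r → ‖μ - (1 + Complex.I * c)‖ ≤ r → ‖B μ‖ ≤ r / c + 1 / (N * c)) ∧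
      ∃ b0 : E1, ∀ μ (f : E1) (v : ℝ → ℂ), (f : ℝ → ℂ) =ᵐ[nuH] (fun y => ((Real.exp (-N * U y) : ℝ) : ℂ) * v y) →
        ((B μ f + b0 : E1) : ℝ → ℂ) =ᵐ[nuH] fun y => ((Real.exp (-N * U y) : ℝ) : ℂ) * fvis U μ c v y := by
  have hc0 := hU.c0
  obtain ⟨MU, hMU1, hMU⟩ := exists_mul_op (m := fun y => (U y : ℂ)) (by fun_prop) (C := 1) (by norm_num)
    (fun s hs => by
      rw [Complex.norm_real, Real.norm_of_nonneg (hU.U_nonneg hs.le)]; exact (hU.U_lt_one hs.le).le)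
  obtain ⟨K, hK1, hK⟩ := hU.exists_K hN
  have hcc : (c : ℂ) ≠ 0 := by exact_mod_cast hc.ne'
  set B1 : ℂ → E1 →L[ℂ] E1 := fun μ => (1 + Complex.I * μ / c) • ContinuousLinearMap.id ℂ E1 - (Complex.I / c) • MU with hB1
  have hB1f : ∀ μ (f : E1), (B1 μ f : ℝ → ℂ) =ᵐ[nuH] fun y => f y + Complex.I / c * ((μ - (U y : ℂ)) * f y) := by
    intro μ f
    have e : B1 μ f = (1 + Complex.I * μ / c) • f - (Complex.I / c) • MU f := by simp [hB1]
    rw [e]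
    filter_upwards [Lp.coeFn_sub ((1 + Complex.I * μ / c) • f) ((Complex.I / c) • MU f), Lp.coeFn_smul (1 + Complex.I * μ / c) f,
      Lp.coeFn_smul (Complex.I / c) (MU f), hMU f] with y h1 h2 h3 h4
    rw [h1, Pi.sub_apply, h2, h3, Pi.smul_apply, Pi.smul_apply, h4, smul_eq_mul, smul_eq_mul]
    field_simp
    ring
  refine ⟨fun μ => B1 μ + (Complex.I / c) • K, ?_, ?_, ?_⟩
  · simp only [hB1]; fun_prop
  · intro μ h1 h2
    have n1 : ‖B1 μ‖ ≤ r / c := by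
      refine ContinuousLinearMap.opNorm_le_bound _ (by positivity) fun f => ?_
      refine Lp.norm_le_mul_norm_of_ae_le_mul ?_
      filter_upwards [hB1f μ f, ae_restrict_mem measurableSet_Ioi] with y hy hy0
      rw [hy]
      have u0 := hU.U_nonneg (le_of_lt hy0)
      have u1 := (hU.U_lt_one (le_of_lt hy0)).le
      have e : f y + Complex.I / c * ((μ - (U y : ℂ)) * f y) =
          Complex.I / c * (((1 - U y : ℝ) : ℂ) * (μ - Complex.I * c) + ((U y : ℝ) : ℂ) * (μ - (1 + Complex.I * c))) * f y := by
        push_cast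
        field_simp
        ring_nf
        rw [Complex.I_sq]; ring
      rw [e, norm_mul]
      gcongr
      rw [norm_mul, norm_div, Complex.norm_I, Complex.norm_real, Real.norm_of_nonneg hc.le]
      have : ‖((1 - U y : ℝ) : ℂ) * (μ - Complex.I * c) + ((U y : ℝ) : ℂ) * (μ - (1 + Complex.I * c))‖ ≤ r := by
        refine (norm_add_le _ _).trans ?_
        rw [norm_mul, norm_mul, Complex.norm_real, Complex.norm_real, Real.norm_of_nonneg u0, Real.norm_of_nonneg (by linarith)]
        calc _ ≤ (1 - U y) * r + U y * r := by
              have : 0 ≤ 1 - U y := by linarith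
              gcongr
          _ = r := by ring
      calc _ ≤ 1 / c * r := by gcongr
        _ = _ := by ring
    refine (norm_add_le _ _).trans (add_le_add n1 ?_)
    rw [norm_smul, norm_div, Complex.norm_I, Complex.norm_real, Real.norm_of_nonneg hc.le]
    calc _ ≤ 1 / c * (1 / N) := by gcongr
      _ = _ := by field_simp
  · have hcF := hU.cF
    have hbi : Integrable (fun y => ((Real.exp (-N * U y) : ℝ) : ℂ) * (Complex.I / c * (-(srcF U y : ℂ)))) nuH := by
      refine Integrable.bdd_mul (c := 1) ((hU.int_F.ofReal.neg).const_mul _) (by fun_prop) ?_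
      filter_upwards [ae_restrict_mem measurableSet_Ioi] with y hy
      rw [Complex.norm_real, Real.norm_of_nonneg (Real.exp_pos _).le, Real.exp_le_one_iff]
      have := hU.U_nonneg (le_of_lt hy)
      nlinarith
    refine ⟨hbi.toL1 _, ?_⟩
    intro μ f v hf
    have e : (B1 μ + (Complex.I / c) • K) f = B1 μ f + (Complex.I / c) • K f := rfl
    rw [e]
    filter_upwards [Lp.coeFn_add (B1 μ f + (Complex.I / c) • K f) (hbi.toL1 _), Lp.coeFn_add (B1 μ f) ((Complex.I / c) • K f),
      Lp.coeFn_smul (Complex.I / c) (K f), hK f, hB1f μ f, hbi.coeFn_toL1, hf, ae_restrict_mem measurableSet_Ioi]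
      with y h1 h2 h3 h4 h5 h6 h7 hy
    rw [h1, Pi.add_apply, h2, Pi.add_apply, h3, Pi.smul_apply, h4, h5, h6, h7, hU.kk_int hf hy, smul_eq_mul, fvis]
    ring

end AdmissibleShearFlow

set_option linter.unusedVariables false

namespace AdmissibleShearFlow
variable {U : ℝ → ℝ}

theorem viscous_L1 (hU : AdmissibleShearFlow U) {μ0 : ℂ} (hμ0 : 0 < μ0.im) (hroot : Phi U μ0 = ((deltaS U : ℝ) : ℂ)) :
    ∃ c > 0, ∃ η > 0, ∀ᶠ k : ℕ in atTop, ∃ μ : ℂ, η ≤ μ.im ∧ ∃ v : ℝ → ℂ, Integrable v nuH ∧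
      Integrable (fvis U μ c v) nuH ∧
      (∀ᵐ y ∂nuH, v y = (∫ s, (gk (Real.sqrt (c * k)) y s : ℂ) * fvis U μ c v s ∂nuH)
        + ((Real.exp (-Real.sqrt (c * k) * y) : ℝ) : ℂ)) ∧
      ∫ y, v y ∂nuH = ((deltaS U : ℝ) : ℂ) := by
  classical
  have hc0 := hU.c0
  obtain ⟨M, hM0, hM⟩ := hU.exists_M
  set y0 := μ0.im with hy0
  set x0 := μ0.re with hx0
  set c : ℝ := 1 + y0 + (x0 ^ 2 + (x0 - 1) ^ 2 + y0 ^ 2) / y0 with hc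
  have hq : 0 ≤ (x0 ^ 2 + (x0 - 1) ^ 2 + y0 ^ 2) / y0 := by positivity
  have hc1 : 1 + y0 ≤ c := by linarith
  have hcpos : 0 < c := by linarith
  have hcy : x0 ^ 2 + (x0 - 1) ^ 2 + y0 ^ 2 < c * y0 := by
    have : c * y0 = (1 + y0) * y0 + (x0 ^ 2 + (x0 - 1) ^ 2 + y0 ^ 2) := by
      rw [hc]; field_simp
    nlinarith
  set r : ℝ := c - y0 / 2 with hr
  have hrpos : 1 < r := by linarith
  set N : ℝ := 4 / y0 with hN
  have hNpos : 0 < N := by positivity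
  obtain ⟨B, hBd, hBn, b0, hBf⟩ := hU.exists_B hNpos hcpos (show 0 < r by linarith)
  set W : Set ℂ := Metric.ball (Complex.I * c) r ∩ Metric.ball (1 + Complex.I * c) r with hW
  have hWim : ∀ μ ∈ W, y0 / 2 < μ.im := by
    intro μ hμ
    have h1 := hμ.1
    rw [Metric.mem_ball, dist_eq_norm] at h1
    have h2 := (abs_le.mp ((Complex.abs_im_le_norm _).trans h1.le)).1
    have h3 := (Complex.abs_im_le_norm (μ - Complex.I * c)).trans_lt h1
    simp at h3
    have := (abs_lt.mp h3).1
    linarith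
  have hWo : IsOpen W := Metric.isOpen_ball.inter Metric.isOpen_ball
  have hWc : IsPreconnected W := ((convex_ball _ _).inter (convex_ball _ _)).isPreconnected
  set ρ : ℝ := r / c + 1 / (N * c) with hρ
  have hρ0 : 0 ≤ ρ := by positivity
  have hρ1 : ρ < 1 := by
    have : ρ = 1 - y0 / (4 * c) := by rw [hρ, hr, hN]; field_simp; ring
    rw [this]
    have : 0 < y0 / (4 * c) := by positivity
    linarith
  have hBW : ∀ μ ∈ W, ‖B μ‖ ≤ ρ := by
    intro μ hμ
    exact hBn μ (by simpa [dist_eq_norm] using (Metric.mem_ball.mp hμ.1).le) (by simpa [dist_eq_norm] using (Metric.mem_ball.mp hμ.2).le)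
  have nrm : ∀ a b : ℝ, a ^ 2 + b ^ 2 < r ^ 2 → ∀ z : ℂ, z.re = a → z.im = b → ‖z‖ < r := by
    intro a b hab z h1 h2
    rw [← abs_of_pos (show 0 < r by linarith), ← abs_of_nonneg (norm_nonneg z), ← sq_lt_sq, ← Complex.normSq_eq_norm_sq, Complex.normSq_apply, h1, h2]
    linarith
  have hmemW0 : μ0 ∈ W := by
    constructor
    · rw [Metric.mem_ball, dist_eq_norm]
      refine nrm x0 (y0 - c) ?_ _ (by simp [hx0]) (by simp [hy0])
      rw [hr]; nlinarith [sq_nonneg (x0 - 1), sq_nonneg y0]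
    · rw [Metric.mem_ball, dist_eq_norm]
      refine nrm (x0 - 1) (y0 - c) ?_ _ (by simp [hx0]) (by simp [hy0])
      rw [hr]; nlinarith [sq_nonneg x0, sq_nonneg y0]
  have hmemW1 : Complex.I * c ∈ W := by
    constructor
    · rw [Metric.mem_ball, dist_self]; linarith
    · rw [Metric.mem_ball, dist_eq_norm]
      simp; exact hrpos
  -- weights
  have wpos : ∀ y : ℝ, ((Real.exp (-N * U y) : ℝ) : ℂ) ≠ 0 := fun y => by
    exact_mod_cast (Real.exp_pos _).ne'
  have wle : ∀ y : ℝ, 0 < y → ‖((Real.exp (-N * U y) : ℝ) : ℂ)‖ ≤ 1 := by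
    intro y hy
    rw [Complex.norm_real, Real.norm_of_nonneg (Real.exp_pos _).le, Real.exp_le_one_iff]
    nlinarith [hU.U_nonneg hy.le]
  have wcancel : ∀ y : ℝ, ((Real.exp (N * U y) : ℝ) : ℂ) * ((Real.exp (-N * U y) : ℝ) : ℂ) = 1 := by
    intro y
    rw [← Complex.ofReal_mul, ← Real.exp_add]; simp
  -- S
  set κ : ℕ → ℝ := fun k => Real.sqrt (c * k) with hκ
  have hκt : Tendsto κ atTop atTop :=
    Real.tendsto_sqrt_atTop.comp ((tendsto_natCast_atTop_atTop).const_mul_atTop hcpos)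
  have hNM : 0 < N * M := by positivity
  have hSex : ∀ n, ∃ S : E1 →L[ℂ] E1, N * M < κ n → ‖S‖ ≤ κ n / (κ n - N * M) ∧
      ∀ f : E1, (S f : ℝ → ℂ) =ᵐ[nuH] fun y => ∫ s, (wk U N (κ n) (y, s) : ℂ) * f s ∂nuH := by
    intro n
    by_cases h : N * M < κ n
    · obtain ⟨S, hS⟩ := hU.exists_S hM hNpos.le (hNM.trans h) h
      exact ⟨S, fun _ => hS⟩
    · exact ⟨0, fun h' => absurd h' h⟩
  choose S hS using hSex
  have hSn : ∀ δ > 0, ∀ᶠ n in atTop, ‖S n‖ ≤ 1 + δ := by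
    intro δ hδ
    filter_upwards [hκt.eventually_gt_atTop (N * M), hκt.eventually_ge_atTop (N * M + N * M / δ)] with n h1 h2
    refine (hS n h1).1.trans ?_
    rw [div_le_iff₀ (by linarith)]
    have : N * M / δ * δ = N * M := by field_simp
    nlinarith
  have hSs : ∀ x, Tendsto (fun n => S n x) atTop (nhds x) := by
    refine hU.S_strong (N := N) hκt ?_ ?_
    · filter_upwards [hSn 1 one_pos] with n hn
      linarith
    · filter_upwards [hκt.eventually_gt_atTop (N * M)] with n hn using (hS n hn).2
  -- β
  have hβex : ∀ n, ∃ β : E1, 0 < κ n → ‖β‖ ≤ 1 / κ n ∧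
      (β : ℝ → ℂ) =ᵐ[nuH] fun y => ((Real.exp (-N * U y) : ℝ) : ℂ) * ((Real.exp (-(κ n) * y) : ℝ) : ℂ) := by
    intro n
    by_cases h : 0 < κ n
    · have hi1 : IntegrableOn (fun y => Real.exp (-(κ n) * y)) (Ioi 0) := integrableOn_exp_mul_Ioi (by linarith) 0
      have hi : Integrable (fun y => ((Real.exp (-N * U y) : ℝ) : ℂ) * ((Real.exp (-(κ n) * y) : ℝ) : ℂ)) nuH := by
        refine Integrable.bdd_mul (c := 1) hi1.ofReal (by fun_prop) ?_
        filter_upwards [ae_restrict_mem measurableSet_Ioi] with y hy using wle y hy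
      refine ⟨hi.toL1 _, fun _ => ⟨?_, hi.coeFn_toL1⟩⟩
      rw [L1.norm_of_fun_eq_integral_norm]
      have : ∫ y, Real.exp (-(κ n) * y) ∂nuH = 1 / κ n := by
        rw [integral_exp_mul_Ioi (by linarith)]; simp
      rw [← this]
      refine integral_mono_ae hi.norm hi1 ?_
      filter_upwards [ae_restrict_mem measurableSet_Ioi] with y hy
      rw [norm_mul]
      calc _ ≤ 1 * ‖((Real.exp (-(κ n) * y) : ℝ) : ℂ)‖ := by gcongr; exact wle y hy
        _ = _ := by rw [one_mul, Complex.norm_real, Real.norm_of_nonneg (Real.exp_pos _).le]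
    · exact ⟨0, fun h' => absurd h' h⟩
  choose β hβ using hβex
  have hβt : Tendsto β atTop (nhds 0) := by
    refine squeeze_zero_norm' (a := fun n => 1 / κ n) ?_ ?_
    · filter_upwards [hκt.eventually_gt_atTop 0] with n hn using (hβ n hn).1
    · simp only [one_div]; exact hκt.inv_tendsto_atTop
  -- ℓ
  obtain ⟨I, hI⟩ := exists_integral_clm
  obtain ⟨T, _, hT⟩ := exists_mul_op (m := fun y => ((Real.exp (N * U y) : ℝ) : ℂ)) (by fun_prop) (C := Real.exp N) (Real.exp_pos _).le
    (fun s hs => by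
      rw [Complex.norm_real, Real.norm_of_nonneg (Real.exp_pos _).le]
      apply Real.exp_le_exp.mpr
      nlinarith [(hU.U_lt_one hs.le).le])
  have hℓ : ∀ q : E1, (I.comp T) q = ∫ y, ((Real.exp (N * U y) : ℝ) : ℂ) * q y ∂nuH := by
    intro q
    rw [ContinuousLinearMap.comp_apply, hI]
    exact integral_congr_ae (hT q)
  -- q0
  have hq0ex : ∀ μ : ℂ, ∃ q : E1, 0 < μ.im → q = B μ q + b0 ∧ (I.comp T) q = PhiInv U μ := by
    intro μ
    by_cases h : 0 < μ.im
    · obtain ⟨v, hvc, hvi, hveq, hvint⟩ := hU.inviscid h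
      have hi : Integrable (fun y => ((Real.exp (-N * U y) : ℝ) : ℂ) * v y) nuH := by
        refine Integrable.bdd_mul (c := 1) hvi (by fun_prop) ?_
        filter_upwards [ae_restrict_mem measurableSet_Ioi] with y hy using wle y hy
      refine ⟨hi.toL1 _, fun _ => ⟨?_, ?_⟩⟩
      · refine Lp.ext ?_
        filter_upwards [hBf μ (hi.toL1 _) v hi.coeFn_toL1, hi.coeFn_toL1] with y h1 h2
        rw [h1, h2, fvis, hveq y]; ring
      · rw [hℓ, ← hvint]
        refine integral_congr_ae ?_
        filter_upwards [hi.coeFn_toL1] with y h1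
        rw [h1, ← mul_assoc, wcancel, one_mul]
    · exact ⟨0, fun h' => absurd h' h⟩
  choose q0 hq0 using hq0ex
  have hWpos : ∀ μ ∈ W, 0 < μ.im := fun μ hμ => by have := hWim μ hμ; linarith
  have main := hurwitz_abstract B hBd W hWo hWc ρ hρ0 hρ1 hBW S hSn hSs β hβt b0 (I.comp T) ((deltaS U : ℝ) : ℂ) q0
    (fun μ hμ => (hq0 μ (hWpos μ hμ)).1) μ0 (Complex.I * c) hmemW0 hmemW1
    (by rw [(hq0 μ0 hμ0).2, hU.Phi_eq_inv hμ0, hroot])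
    (by
      have hp := hWpos _ hmemW1
      rw [(hq0 _ hp).2, hU.Phi_eq_inv hp]
      intro h
      have h2 := hU.Phi_im_neg hp (Or.inl (by simp))
      rw [h] at h2
      simp at h2)
  refine ⟨c, hcpos, y0 / 2, by positivity, ?_⟩
  filter_upwards [main, hκt.eventually_gt_atTop (N * M)] with n hn hn2
  obtain ⟨μ, hμ, q, hq, hqΔ⟩ := hn
  have hκn : 0 < κ n := hNM.trans hn2
  refine ⟨μ, (hWim μ hμ).le, fun y => ((Real.exp (N * U y) : ℝ) : ℂ) * q y, ?_, ?_, ?_, ?_⟩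
  · refine (L1.integrable_coeFn (T q)).congr (hT q)
  · have hqv : (q : ℝ → ℂ) =ᵐ[nuH] fun y => ((Real.exp (-N * U y) : ℝ) : ℂ) * (((Real.exp (N * U y) : ℝ) : ℂ) * q y) := by
      refine Eventually.of_forall fun y => ?_
      show q y = ((Real.exp (-N * U y) : ℝ) : ℂ) * (((Real.exp (N * U y) : ℝ) : ℂ) * q y)
      rw [← mul_assoc, mul_comm ((Real.exp (-N * U y) : ℝ) : ℂ), wcancel, one_mul]
    have h1 := hBf μ q _ hqv
    refine (L1.integrable_coeFn (T (B μ q + b0))).congr ?_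
    filter_upwards [hT (B μ q + b0), h1] with y h2 h3
    rw [h2, h3, ← mul_assoc, wcancel, one_mul]
  · have hqv : (q : ℝ → ℂ) =ᵐ[nuH] fun y => ((Real.exp (-N * U y) : ℝ) : ℂ) * (((Real.exp (N * U y) : ℝ) : ℂ) * q y) := by
      refine Eventually.of_forall fun y => ?_
      show q y = ((Real.exp (-N * U y) : ℝ) : ℂ) * (((Real.exp (N * U y) : ℝ) : ℂ) * q y)
      rw [← mul_assoc, mul_comm ((Real.exp (-N * U y) : ℝ) : ℂ), wcancel, one_mul]
    have h1 := hBf μ q _ hqv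
    have h2 := (hS n hn2).2 (B μ q + b0)
    have h3 := (hβ n hκn).2
    have h4 : (q : ℝ → ℂ) =ᵐ[nuH] (S n (B μ q + b0) : ℝ → ℂ) + (β n : ℝ → ℂ) := by
      conv_lhs => rw [hq]
      exact Lp.coeFn_add _ _
    filter_upwards [h2, h3, h4] with y e2 e3 e4
    rw [e4, Pi.add_apply, e2, e3, mul_add, ← mul_assoc _ ((Real.exp (-N * U y) : ℝ) : ℂ), wcancel, one_mul, ← integral_const_mul]
    congr 1
    refine integral_congr_ae ?_
    filter_upwards [h1] with s hs
    rw [hs]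
    simp only [wk]
    have e5 := wcancel s
    have e6 := wcancel y
    rw [show -N * (U y - U s) = -N * U y + N * U s by ring, Real.exp_add]
    push_cast at *
    linear_combination (gk (Real.sqrt (c * n)) y s : ℂ) * fvis U μ c (fun y => Complex.exp (N * U y) * q y) s *
      (Complex.exp (N * U y) * Complex.exp (-N * U y) * e5 + e6)
  · rw [← hqΔ, hℓ]

end AdmissibleShearFlow

set_option linter.unusedVariables false

/-- A solution of a smooth autonomous ODE on `[0,∞)` extends to a smooth function on `ℝ`. -/
theorem smooth_extend {E : Type*} [NormedAddCommGroup E] [NormedSpace ℝ E] [CompleteSpace E] {f : E → E}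
    (hf : ContDiff ℝ (⊤ : ℕ∞) f) {α : ℝ → E}
    (hα : ∀ t, 0 ≤ t → HasDerivWithinAt α (f (α t)) (Ici 0) t) :
    ∃ β : ℝ → E, ContDiff ℝ (⊤ : ℕ∞) β ∧ ∀ t, 0 ≤ t → β t = α t := by
  have hf1 : ContDiffAt ℝ 1 f (α 0) := (hf.of_le (by exact_mod_cast le_top)).contDiffAt
  obtain ⟨γ, hγ0, ε, hε, hγ⟩ := hf1.exists_forall_mem_closedBall_exists_eq_forall_mem_Ioo_hasDerivAt₀ 0
  set δ : ℝ → E := fun t => if 0 ≤ t then α t else γ t with hδ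
  have hδα : ∀ t, 0 ≤ t → δ t = α t := fun t ht => by simp [hδ, ht]
  have hδγ : ∀ t, t ≤ 0 → δ t = γ t := by
    intro t ht
    rcases ht.lt_or_eq with h | h
    · simp [hδ, not_le.mpr h]
    · subst h; simp [hδ, hγ0]
  have hδd : ∀ t, -ε < t → HasDerivAt δ (f (δ t)) t := by
    intro t ht
    rcases lt_trichotomy t 0 with h | h | h
    · rw [hδγ t h.le]
      refine (hγ t ⟨by linarith, by linarith⟩).congr_of_eventuallyEq ?_
      filter_upwards [Iio_mem_nhds h] with s hs using hδγ s (le_of_lt hs)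
    · subst h
      have h1 : HasDerivWithinAt δ (f (δ 0)) (Ici 0) 0 := by
        rw [hδα 0 le_rfl]
        exact (hα 0 le_rfl).congr (fun s hs => hδα s hs) (hδα 0 le_rfl)
      have h2 : HasDerivWithinAt δ (f (δ 0)) (Iic 0) 0 := by
        rw [hδγ 0 le_rfl]
        exact (hγ 0 ⟨by linarith, by linarith⟩).hasDerivWithinAt.congr (fun s hs => hδγ s hs) (hδγ 0 le_rfl)
      have := h1.union h2
      rwa [Ici_union_Iic, hasDerivWithinAt_univ] at this
    · rw [hδα t h.le]
      refine ((hα t h.le).hasDerivAt (Ici_mem_nhds h)).congr_of_eventuallyEq ?_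
      filter_upwards [Ioi_mem_nhds h] with s hs using hδα s (le_of_lt hs)
  have hδs : ∀ t, -ε < t → ContDiffAt ℝ (⊤ : ℕ∞) δ t := by
    intro t ht
    obtain ⟨a, ha1, ha2⟩ := exists_between ht
    have : ContDiffOn ℝ (⊤ : ℕ∞) δ (Icc a (t + 1)) :=
      ODE.contDiffOn_enat_Icc_of_hasDerivWithinAt (f := fun _ x => f x) (u := univ)
        ((hf.comp contDiff_snd).contDiffOn)
        (fun s hs => (hδd s (by linarith [hs.1])).hasDerivWithinAt) (fun _ _ => mem_univ _)
    exact this.contDiffAt (Icc_mem_nhds ha2 (by linarith))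
  set χ : ℝ → ℝ := fun t => Real.smoothTransition (4 * t / ε + 2) with hχ
  have hχs : ContDiff ℝ (⊤ : ℕ∞) χ := by
    have := Real.smoothTransition.contDiff (n := (⊤ : ℕ∞))
    exact this.comp (by fun_prop)
  refine ⟨fun t => χ t • δ t, ?_, ?_⟩
  · rw [contDiff_iff_contDiffAt]
    intro t
    rcases le_or_gt t (-ε) with h | h
    swap
    · exact hχs.contDiffAt.smul (hδs t h)
    have hz : (fun t => χ t • δ t) =ᶠ[nhds t] fun _ => (0 : E) := by
      filter_upwards [Iio_mem_nhds (show t < -(ε / 2) by linarith)] with s hs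
      have : 4 * s / ε + 2 ≤ 0 := by
        have : 4 * s / ε ≤ -2 := by
          rw [div_le_iff₀ hε]; have := mem_Iio.mp hs; linarith
        linarith
      simp only [hχ]
      rw [Real.smoothTransition.zero_of_nonpos this, zero_smul]
    exact contDiffAt_const.congr_of_eventuallyEq hz
  · intro t ht
    have : 1 ≤ 4 * t / ε + 2 := by
      have : 0 ≤ 4 * t / ε := by positivity
      linarith
    simp only [hχ]
    rw [Real.smoothTransition.one_of_one_le this, one_smul, hδα t ht]

theorem deriv_eq_of_eqOn_Ici {E : Type*} [NormedAddCommGroup E] [NormedSpace ℝ E] {g h : ℝ → E} {g' : E} {t : ℝ} (ht : 0 ≤ t)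
    (hg : HasDerivWithinAt g g' (Ici 0) t) (hh : DifferentiableAt ℝ h t) (e : ∀ s, 0 ≤ s → h s = g s) : deriv h t = g' := by
  have h1 := hh.hasDerivAt.hasDerivWithinAt (s := Ici 0)
  have h2 : HasDerivWithinAt h g' (Ici 0) t := hg.congr (fun s hs => e s hs) (e t ht)
  exact (uniqueDiffOn_Ici (0:ℝ) t ht).eq_deriv _ h1 h2

set_option linter.unusedVariables false

/-- explicit form of the half-line resolvent -/
theorem gk_split {κ : ℝ} (hκ : 0 < κ) {f : ℝ → ℂ} (hf : Integrable f nuH) {y : ℝ} (hy : 0 ≤ y) :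
    ∫ s, (gk κ y s : ℂ) * f s ∂nuH = κ / 2 * (Complex.exp (-κ * y) * (∫ s in (0:ℝ)..y, Complex.exp (κ * s) * f s)
      + Complex.exp (κ * y) * ((∫ s : ℝ, Complex.exp (-κ * s) * f s ∂nuH) - ∫ s in (0:ℝ)..y, Complex.exp (-κ * s) * f s)
      - Complex.exp (-κ * y) * ∫ s : ℝ, Complex.exp (-κ * s) * f s ∂nuH) := by
  have i1 : Integrable (fun s : ℝ => Complex.exp (-κ * s) * f s) nuH := by
    refine Integrable.bdd_mul (c := 1) hf (by fun_prop) ?_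
    filter_upwards [ae_restrict_mem measurableSet_Ioi] with s hs
    rw [Complex.norm_exp]
    have : (-(κ:ℂ) * s).re = -(κ * s) := by simp
    rw [this, Real.exp_le_one_iff]
    have := mul_pos hκ hs; linarith
  have i2 : IntegrableOn (fun s : ℝ => Complex.exp (κ * s) * f s) (Ioc 0 y) := by
    have hf' : IntegrableOn f (Ioc 0 y) := hf.mono_measure (Measure.restrict_mono Ioc_subset_Ioi_self le_rfl)
    refine Integrable.bdd_mul (c := Real.exp (κ * y)) hf' (by fun_prop) ?_
    filter_upwards [ae_restrict_mem measurableSet_Ioc] with s hs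
    rw [Complex.norm_exp]
    have : ((κ:ℂ) * s).re = κ * s := by simp
    rw [this]
    exact Real.exp_le_exp.mpr (by nlinarith [hs.2])
  have i1a : IntegrableOn (fun s : ℝ => Complex.exp (-κ * s) * f s) (Ioc 0 y) := i1.mono_measure (Measure.restrict_mono Ioc_subset_Ioi_self le_rfl)
  have i1b : IntegrableOn (fun s : ℝ => Complex.exp (-κ * s) * f s) (Ioi y) := i1.mono_measure (Measure.restrict_mono (Ioi_subset_Ioi hy) le_rfl)
  have e0 : ∀ g : ℝ → ℂ, IntegrableOn g (Ioc 0 y) → IntegrableOn g (Ioi y) → ∫ s, g s ∂nuH = (∫ s in Ioc 0 y, g s) + ∫ s in Ioi y, g s := by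
    intro g h1 h2
    rw [← setIntegral_union (Ioc_disjoint_Ioi le_rfl) measurableSet_Ioi h1 h2, Ioc_union_Ioi_eq_Ioi hy]
  have ha : ∀ s ∈ Ioc (0:ℝ) y, (gk κ y s : ℂ) * f s = κ / 2 * (Complex.exp (-κ * y) * (Complex.exp (κ * s) * f s) - Complex.exp (-κ * y) * (Complex.exp (-κ * s) * f s)) := by
    intro s hs
    unfold gk
    rw [abs_of_nonneg (by linarith [hs.2])]
    push_cast
    rw [show -(κ:ℂ) * (y - s) = -κ * y + κ * s by ring, show -(κ:ℂ) * (y + s) = -κ * y + -κ * s by ring, Complex.exp_add, Complex.exp_add]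
    ring
  have hb : ∀ s ∈ Ioi y, (gk κ y s : ℂ) * f s = κ / 2 * (Complex.exp (κ * y) * (Complex.exp (-κ * s) * f s) - Complex.exp (-κ * y) * (Complex.exp (-κ * s) * f s)) := by
    intro s hs
    unfold gk
    rw [abs_of_nonpos (by linarith [mem_Ioi.mp hs])]
    push_cast
    rw [show -(κ:ℂ) * (-(y - s)) = κ * y + -κ * s by ring, show -(κ:ℂ) * (y + s) = -κ * y + -κ * s by ring, Complex.exp_add, Complex.exp_add]
    ring
  have ja := ((i2.const_mul (Complex.exp (-κ * y))).sub (i1a.const_mul (Complex.exp (-κ * y)))).const_mul ((κ : ℂ) / 2)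
  have jb := ((i1b.const_mul (Complex.exp (κ * y))).sub (i1b.const_mul (Complex.exp (-κ * y)))).const_mul ((κ : ℂ) / 2)
  rw [e0 _ (IntegrableOn.congr_fun ja (fun s hs => (ha s hs).symm) measurableSet_Ioc) (IntegrableOn.congr_fun jb (fun s hs => (hb s hs).symm) measurableSet_Ioi),
    setIntegral_congr_fun measurableSet_Ioc ha, setIntegral_congr_fun measurableSet_Ioi hb, e0 _ i1a i1b,
    intervalIntegral.integral_of_le hy, intervalIntegral.integral_of_le hy]
  rw [integral_const_mul, integral_const_mul, integral_sub (i2.const_mul _) (i1a.const_mul _), integral_sub (i1b.const_mul _) (i1b.const_mul _)]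
  simp only [integral_const_mul]
  ring

theorem gk_tendsto {κ : ℝ} (hκ : 0 < κ) {f : ℝ → ℂ} (hf : Integrable f nuH) :
    Tendsto (fun y => ∫ s, (gk κ y s : ℂ) * f s ∂nuH) atTop (nhds 0) := by
  have : Tendsto (fun y => ∫ s, (gk κ y s : ℂ) * f s ∂nuH) atTop (nhds (∫ s, (0:ℂ) ∂nuH)) := by
    refine tendsto_integral_filter_of_dominated_convergence (fun s => κ / 2 * ‖f s‖) ?_ ?_ (hf.norm.const_mul _) ?_
    · refine Eventually.of_forall fun y => ?_
      have : Continuous (fun s => ((gk κ y s : ℝ) : ℂ)) := by unfold gk; fun_prop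
      exact this.aestronglyMeasurable.mul hf.aestronglyMeasurable
    · filter_upwards [eventually_ge_atTop 0] with y hy
      filter_upwards [ae_restrict_mem measurableSet_Ioi] with s hs
      rw [norm_mul, Complex.norm_real, Real.norm_of_nonneg (gk_nonneg hκ hy (le_of_lt hs))]
      gcongr
      refine (gk_le hκ).trans ?_
      have : Real.exp (-κ * |y - s|) ≤ 1 := by
        rw [Real.exp_le_one_iff]; have := mul_nonneg hκ.le (abs_nonneg (y - s)); linarith
      nlinarith
    · refine Eventually.of_forall fun s => ?_
      have h1 : Tendsto (fun y : ℝ => gk κ y s) atTop (nhds 0) := by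
        unfold gk
        have t1 : Tendsto (fun y : ℝ => Real.exp (-κ * |y - s|)) atTop (nhds 0) := by
          refine Real.tendsto_exp_atBot.comp ?_
          refine Tendsto.const_mul_atTop_of_neg (by linarith) ?_
          exact tendsto_abs_atTop_atTop.comp (tendsto_atTop_add_const_right _ _ tendsto_id)
        have t2 : Tendsto (fun y : ℝ => Real.exp (-κ * (y + s))) atTop (nhds 0) := by
          refine Real.tendsto_exp_atBot.comp ?_
          refine Tendsto.const_mul_atTop_of_neg (by linarith) ?_
          exact (tendsto_atTop_add_const_right _ _ tendsto_id)
        simpa using (t1.sub t2).const_mul (κ / 2)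
      have h2 := ((Complex.continuous_ofReal.tendsto _).comp h1).mul_const (f s)
      simpa using h2
  simpa using this

/-- Derivatives of the explicit formula. -/
theorem resolvent_hasDerivAt {κ : ℝ} {f : ℝ → ℂ} (hf : Continuous f) (Bt : ℂ) (y : ℝ) :
    HasDerivAt (fun y : ℝ => κ / 2 * (Complex.exp (-κ * y) * (∫ s in (0:ℝ)..y, Complex.exp (κ * s) * f s)
      + Complex.exp (κ * y) * (Bt - ∫ s in (0:ℝ)..y, Complex.exp (-κ * s) * f s)
      - Complex.exp (-κ * y) * Bt) + Complex.exp (-κ * y))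
     (κ * (κ / 2 * (-(Complex.exp (-κ * y) * (∫ s in (0:ℝ)..y, Complex.exp (κ * s) * f s))
      + Complex.exp (κ * y) * (Bt - ∫ s in (0:ℝ)..y, Complex.exp (-κ * s) * f s)
      + Complex.exp (-κ * y) * Bt) - Complex.exp (-κ * y))) y ∧
    HasDerivAt (fun y : ℝ => (κ * (κ / 2 * (-(Complex.exp (-κ * y) * (∫ s in (0:ℝ)..y, Complex.exp (κ * s) * f s))
      + Complex.exp (κ * y) * (Bt - ∫ s in (0:ℝ)..y, Complex.exp (-κ * s) * f s)
      + Complex.exp (-κ * y) * Bt) - Complex.exp (-κ * y)) : ℂ))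
     (κ ^ 2 * ((κ / 2 * (Complex.exp (-κ * y) * (∫ s in (0:ℝ)..y, Complex.exp (κ * s) * f s)
      + Complex.exp (κ * y) * (Bt - ∫ s in (0:ℝ)..y, Complex.exp (-κ * s) * f s)
      - Complex.exp (-κ * y) * Bt) + Complex.exp (-κ * y)) - f y)) y := by
  have dm : HasDerivAt (fun y : ℝ => Complex.exp (-κ * y)) (Complex.exp (-κ * y) * -κ) y := by
    have := (((hasDerivAt_id (y : ℂ)).const_mul (-(κ : ℂ))).cexp).comp_ofReal
    simpa using this
  have dp : HasDerivAt (fun y : ℝ => Complex.exp (κ * y)) (Complex.exp (κ * y) * κ) y := by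
    have := (((hasDerivAt_id (y : ℂ)).const_mul (κ : ℂ)).cexp).comp_ofReal
    simpa using this
  have cA : Continuous (fun s : ℝ => Complex.exp (κ * s) * f s) := by fun_prop
  have cB : Continuous (fun s : ℝ => Complex.exp (-κ * s) * f s) := by fun_prop
  have dA := cA.integral_hasStrictDerivAt 0 y |>.hasDerivAt
  have dB := cB.integral_hasStrictDerivAt 0 y |>.hasDerivAt
  have ee : Complex.exp (κ * y) * Complex.exp (-κ * y) = 1 := by
    rw [← Complex.exp_add]; simp
  constructor
  · refine (((((dm.mul dA).add (dp.mul ((hasDerivAt_const y Bt).sub dB))).sub (dm.mul_const Bt)).const_mul ((κ:ℂ)/2)).add dm).congr_deriv ?_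
    simp only [Pi.sub_apply]
    linear_combination (0:ℂ) * ee
  · refine ((((((dm.mul dA).neg).add (dp.mul ((hasDerivAt_const y Bt).sub dB))).add (dm.mul_const Bt)).const_mul ((κ:ℂ)/2)).sub dm).const_mul (κ:ℂ) |>.congr_deriv ?_
    simp only [Pi.sub_apply]
    linear_combination (-(κ:ℂ)^2 * f y) * ee

set_option linter.unusedVariables false

namespace AdmissibleShearFlow
variable {U : ℝ → ℝ}

theorem viscous_smooth (hU : AdmissibleShearFlow U) {c η : ℝ} (hc : 0 < c) {k : ℕ} (hk : 0 < k) {μ : ℂ} {v : ℝ → ℂ} (hv : Integrable v nuH)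
    (hfv : Integrable (fvis U μ c v) nuH)
    (hfix : ∀ᵐ y ∂nuH, v y = (∫ s, (gk (Real.sqrt (c * k)) y s : ℂ) * fvis U μ c v s ∂nuH)
        + ((Real.exp (-Real.sqrt (c * k) * y) : ℝ) : ℂ))
    (hintg : ∫ y, v y ∂nuH = ((deltaS U : ℝ) : ℂ)) :
    ∃ φ : ℝ → ℂ, IsEigSolution U μ (k : ℝ) ((deltaS U : ℝ) : ℂ) φ := by
  have hc0 := hU.c0
  have hc1 := hU.c1
  have hkR : (0:ℝ) < k := by exact_mod_cast hk
  have hkC : (k:ℂ) ≠ 0 := by exact_mod_cast hk.ne'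
  have hcC : (c:ℂ) ≠ 0 := by exact_mod_cast hc.ne'
  set κ := Real.sqrt (c * k) with hκdef
  have hκ : 0 < κ := Real.sqrt_pos.mpr (by positivity)
  have hκ2 : (κ:ℂ) ^ 2 = c * k := by
    have : κ ^ 2 = c * k := Real.sq_sqrt (by positivity)
    exact_mod_cast this
  set f0 : ℝ → ℂ := (Ioi (0:ℝ)).indicator (fvis U μ c v) with hf0
  have hf0i : Integrable f0 := by
    rw [hf0, integrable_indicator_iff measurableSet_Ioi]; exact hfv
  have hf0v : f0 =ᵐ[nuH] fvis U μ c v := indicator_ae_eq_restrict measurableSet_Ioi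
  set Bt : ℂ := ∫ s : ℝ, Complex.exp (-κ * s) * fvis U μ c v s ∂nuH with hBt
  -- interval integrals of functions which agree a.e. on the half line
  have icongr : ∀ (a b : ℝ → ℂ), a =ᵐ[nuH] b → ∀ y, 0 ≤ y → ∫ s in (0:ℝ)..y, a s = ∫ s in (0:ℝ)..y, b s := by
    intro a b hab y hy
    rw [intervalIntegral.integral_of_le hy, intervalIntegral.integral_of_le hy]
    exact integral_congr_ae (ae_restrict_of_ae_restrict_of_subset Ioc_subset_Ioi_self hab)
  have emul : ∀ (a b : ℝ → ℂ), a =ᵐ[nuH] b → ∀ h : ℝ → ℂ, (fun s => h s * a s) =ᵐ[nuH] fun s => h s * b s := by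
    intro a b hab h
    filter_upwards [hab] with s hs
    rw [hs]
  set V : ℝ → ℂ := fun y => κ / 2 * (Complex.exp (-κ * y) * (∫ s in (0:ℝ)..y, Complex.exp (κ * s) * f0 s)
      + Complex.exp (κ * y) * (Bt - ∫ s in (0:ℝ)..y, Complex.exp (-κ * s) * f0 s)
      - Complex.exp (-κ * y) * Bt) + Complex.exp (-κ * y) with hV
  have hVc : Continuous V := by
    have h1 : Continuous (fun y : ℝ => ∫ s in (0:ℝ)..y, Complex.exp (κ * s) * f0 s) :=
      intervalIntegral.continuous_primitive (fun a b => (hf0i.intervalIntegrable).continuousOn_mul (by fun_prop)) 0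
    have h2 : Continuous (fun y : ℝ => ∫ s in (0:ℝ)..y, Complex.exp (-κ * s) * f0 s) :=
      intervalIntegral.continuous_primitive (fun a b => (hf0i.intervalIntegrable).continuousOn_mul (by fun_prop)) 0
    rw [hV]; fun_prop
  have hVgk : ∀ y, 0 ≤ y → V y = (∫ s, (gk κ y s : ℂ) * fvis U μ c v s ∂nuH) + ((Real.exp (-κ * y) : ℝ) : ℂ) := by
    intro y hy
    rw [gk_split hκ hfv hy]
    simp only [hV]
    rw [icongr _ _ (emul _ _ hf0v (fun s : ℝ => Complex.exp (κ * s))) y hy, icongr _ _ (emul _ _ hf0v (fun s : ℝ => Complex.exp (-κ * s))) y hy]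
    push_cast
    rfl
  have hVv : V =ᵐ[nuH] v := by
    filter_upwards [hfix, ae_restrict_mem measurableSet_Ioi] with y h1 h2
    rw [h1, hVgk y (le_of_lt h2)]
  have hVint : Integrable V nuH := hv.congr hVv.symm
  set g : ℝ → ℂ := fvis U μ c V with hg
  have hφd : ∀ y, HasDerivAt (fun y => ∫ t in (0:ℝ)..y, V t) (V y) y := fun y => (hVc.integral_hasStrictDerivAt 0 y).hasDerivAt
  have hφc : Continuous (fun y => ∫ t in (0:ℝ)..y, V t) := continuous_iff_continuousAt.mpr fun y => (hφd y).continuousAt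
  have hFc : Continuous (srcF U) := by unfold srcF; fun_prop
  have hgc : Continuous g := by
    rw [hg]; unfold fvis; fun_prop
  have hgf : f0 =ᵐ[nuH] g := by
    filter_upwards [hf0v, hVv, ae_restrict_mem measurableSet_Ioi] with y h1 h2 h3
    rw [h1, hg]
    unfold fvis
    rw [h2, icongr _ _ hVv y (le_of_lt h3)]
  set W : ℝ → ℂ := fun y => (κ * (κ / 2 * (-(Complex.exp (-κ * y) * (∫ s in (0:ℝ)..y, Complex.exp (κ * s) * g s))
      + Complex.exp (κ * y) * (Bt - ∫ s in (0:ℝ)..y, Complex.exp (-κ * s) * g s)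
      + Complex.exp (-κ * y) * Bt) - Complex.exp (-κ * y)) : ℂ) with hW
  have hVg : ∀ y, 0 ≤ y → V y = κ / 2 * (Complex.exp (-κ * y) * (∫ s in (0:ℝ)..y, Complex.exp (κ * s) * g s)
      + Complex.exp (κ * y) * (Bt - ∫ s in (0:ℝ)..y, Complex.exp (-κ * s) * g s)
      - Complex.exp (-κ * y) * Bt) + Complex.exp (-κ * y) := by
    intro y hy
    simp only [hV]
    rw [icongr _ _ (emul _ _ hgf (fun s : ℝ => Complex.exp (κ * s))) y hy, icongr _ _ (emul _ _ hgf (fun s : ℝ => Complex.exp (-κ * s))) y hy]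
  have dV : ∀ y, 0 ≤ y → HasDerivWithinAt V (W y) (Ici 0) y := by
    intro y hy
    exact (resolvent_hasDerivAt (κ := κ) hgc Bt y).1.hasDerivWithinAt.congr (fun s hs => hVg s hs) (hVg y hy)
  have dW : ∀ y, 0 ≤ y → HasDerivWithinAt W (-(Complex.I * k) * ((μ - (U y : ℂ)) * V y + ((deriv U y : ℝ) : ℂ) * (∫ t in (0:ℝ)..y, V t) - (srcF U y : ℂ))) (Ici 0) y := by
    intro y hy
    refine ((resolvent_hasDerivAt (κ := κ) hgc Bt y).2.congr_deriv ?_).hasDerivWithinAt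
    rw [← hVg y hy, hκ2, hg]
    unfold fvis
    field_simp
    ring
  -- the autonomous system
  have hcd1 := hU.cd1
  have hsm := hU.smooth
  have hofR : ContDiff ℝ (⊤ : ℕ∞) (fun x : ℝ => (x : ℂ)) := Complex.ofRealCLM.contDiff
  have hFs : ContDiff ℝ (⊤ : ℕ∞) (srcF U) := by
    have : srcF U = fun y => 1 - U y + y * deriv U y := rfl
    rw [this]
    exact (contDiff_const.sub hsm).add (contDiff_id.mul hcd1)
  set X : ℝ × ℂ × ℂ × ℂ → ℝ × ℂ × ℂ × ℂ := fun p => (1, p.2.2.1, p.2.2.2,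
    -(Complex.I * k) * ((μ - (U p.1 : ℂ)) * p.2.2.1 + ((deriv U p.1 : ℝ) : ℂ) * p.2.1 - (srcF U p.1 : ℂ))) with hX
  have hXs : ContDiff ℝ (⊤ : ℕ∞) X := by
    have p1 : ContDiff ℝ (⊤ : ℕ∞) (fun p : ℝ × ℂ × ℂ × ℂ => (U p.1 : ℂ)) := hofR.comp (hsm.comp contDiff_fst)
    have p2 : ContDiff ℝ (⊤ : ℕ∞) (fun p : ℝ × ℂ × ℂ × ℂ => ((deriv U p.1 : ℝ) : ℂ)) := hofR.comp (hcd1.comp contDiff_fst)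
    have p3 : ContDiff ℝ (⊤ : ℕ∞) (fun p : ℝ × ℂ × ℂ × ℂ => (srcF U p.1 : ℂ)) := hofR.comp (hFs.comp contDiff_fst)
    rw [hX]
    fun_prop
  obtain ⟨β, hβs, hβ⟩ := smooth_extend hXs (α := fun t => (t, (∫ s in (0:ℝ)..t, V s), V t, W t)) (by
    intro t ht
    exact (hasDerivAt_id t).hasDerivWithinAt.prodMk ((hφd t).hasDerivWithinAt.prodMk ((dV t ht).prodMk (dW t ht))))
  set φ : ℝ → ℂ := fun t => (β t).2.1 with hφ
  have hφs : ContDiff ℝ (⊤ : ℕ∞) φ := contDiff_fst.comp (contDiff_snd.comp hβs)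
  have e0 : ∀ t, 0 ≤ t → φ t = ∫ s in (0:ℝ)..t, V s := fun t ht => by simp only [hφ, hβ t ht]
  have hitd : ∀ n : ℕ, Differentiable ℝ (iteratedDeriv n φ) := fun n =>
    hφs.differentiable_iteratedDeriv n (by exact_mod_cast ENat.natCast_lt_top n)
  have e1 : ∀ t, 0 ≤ t → iteratedDeriv 1 φ t = V t := by
    intro t ht
    rw [iteratedDeriv_one]
    exact deriv_eq_of_eqOn_Ici ht (hφd t).hasDerivWithinAt (by simpa using hitd 0 t) e0
  have e2 : ∀ t, 0 ≤ t → iteratedDeriv 2 φ t = W t := by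
    intro t ht
    rw [iteratedDeriv_succ]
    exact deriv_eq_of_eqOn_Ici ht (dV t ht) (hitd 1 t) e1
  have e3 : ∀ t, 0 ≤ t → iteratedDeriv 3 φ t = -(Complex.I * k) * ((μ - (U t : ℂ)) * V t + ((deriv U t : ℝ) : ℂ) * (∫ s in (0:ℝ)..t, V s) - (srcF U t : ℂ)) := by
    intro t ht
    rw [iteratedDeriv_succ]
    exact deriv_eq_of_eqOn_Ici ht (dW t ht) (hitd 2 t) e2
  rw [iteratedDeriv_one] at e1
  refine ⟨φ, hφs, ?_, ?_, ?_, ?_, ?_⟩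
  · intro y hy
    rw [e0 y hy, e1 y hy, e3 y hy]
    push_cast
    field_simp
    ring_nf
    simp only [Complex.I_sq]
    ring
  · rw [e0 0 le_rfl]; simp
  · rw [e1 0 le_rfl, hVg 0 le_rfl]; simp
  · have h1 := gk_tendsto hκ hfv
    have h2 : Tendsto (fun y : ℝ => ((Real.exp (-κ * y) : ℝ) : ℂ)) atTop (nhds 0) := by
      have : Tendsto (fun y : ℝ => Real.exp (-κ * y)) atTop (nhds 0) :=
        Real.tendsto_exp_atBot.comp (Tendsto.const_mul_atTop_of_neg (by linarith) tendsto_id)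
      have h5 := (Complex.continuous_ofReal.tendsto _).comp this
      rw [Complex.ofReal_zero] at h5
      exact h5
    have h3 := h1.add h2
    rw [add_zero] at h3
    refine h3.congr' ?_
    filter_upwards [eventually_ge_atTop 0] with y hy
    rw [e1 y hy, hVgk y hy]
  · have h1 := intervalIntegral_tendsto_integral_Ioi 0 hVint tendsto_id
    rw [integral_congr_ae hVv, hintg] at h1
    refine h1.congr' ?_
    filter_upwards [eventually_ge_atTop 0] with y hy
    rw [e0 y hy]; rfl

end AdmissibleShearFlow

theorem pdt_instability_criterion1 (U : ℝ → ℝ) (hU : AdmissibleShearFlow U)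
    (hξ : xiEq U (deltaS U) = 0)
    (hξpm : xiPlus U (deltaS U) < xiMinus U (deltaS U)) :
    ∃ K : ℝ, 0 < K ∧ ∃ η : ℝ, 0 < η ∧
      ∀ k : ℕ, K ≤ (k : ℝ) → ∃ μ : ℂ, η ≤ μ.im ∧ ∃ φ : ℝ → ℂ,
        IsEigSolution U μ (k : ℝ) ((deltaS U : ℝ) : ℂ) φ := by
  obtain ⟨μ0, hμ0, hroot⟩ := hU.exists_root hξ hξpm
  obtain ⟨c, hc, η, hη, hev⟩ := hU.viscous_L1 hμ0 hroot
  obtain ⟨n, hn⟩ := eventually_atTop.mp hev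
  refine ⟨n + 1, by positivity, η, hη, fun k hk => ?_⟩
  have hk' : n + 1 ≤ k := by exact_mod_cast hk
  obtain ⟨μ, hμ, v, h1, h2, h3, h4⟩ := hn k (by omega)
  exact ⟨μ, hμ, hU.viscous_smooth (η := η) hc (by omega) h1 h2 h3 h4⟩

end
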